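/- Let G be a countable group and let G ↷ (X, μ) be a free ergodic p.m.p. action such that the orbit equivalence relation E_G^X is not μ-hyperfinite. If rh_G(X, μ) > 0, then there exists a measure-preserving action of the free group F₂ on two generators on (X, μ) which is free (μ-almost-every point has trivial F₂-stabilizer) and such that μ-almost-every F₂-orbit is contained in a G-orbit. -/

import Mathlib

open MeasureTheory
open scoped ENNReal symmDiff

/-- A countable ordered Borel partition of `X` (empty pieces allowed). -/
structure CtblPart (X : Type*) [MeasurableSpace X] where
  piece : ℕ → Set X
  measurable : ∀ i, MeasurableSet (piece i)
  disj : Pairwise fun i j => Disjoint (piece i) (piece j)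
  cover : (⋃ i, piece i) = Set.univ

/-- The Shannon entropy `H_μ(α)` of a countable partition. -/
noncomputable def partEnt {X : Type*} [MeasurableSpace X] (μ : Measure X)
    (α : CtblPart X) : ℝ≥0∞ :=
  ∑' i, ENNReal.ofReal (Real.negMulLog (μ (α.piece i)).toReal)

/-- `σ_G(C)`: the smallest `G`-invariant sub-σ-algebra containing the collection `C`. -/
def sigmaG (G : Type*) {X : Type*} [Group G] [MulAction G X]
    (C : Set (Set X)) : MeasurableSpace X :=
  MeasurableSpace.generateFrom {s | ∃ (g : G) (t : Set X), t ∈ C ∧ s = (fun x => g • x) ⁻¹' t}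

/-- The σ-algebra `m` equals the ambient (Borel) σ-algebra modulo `μ`-null sets. -/
def SpansModNull {X : Type*} (m : MeasurableSpace X) [mX : MeasurableSpace X]
    (μ : Measure X) : Prop :=
  ∀ s : Set X, MeasurableSet s → ∃ t : Set X, MeasurableSet[m] t ∧ μ (s ∆ t) = 0

/-- The Rokhlin entropy of an ergodic p.m.p. action: the infimum of the Shannon entropies of
countable generating partitions. -/
noncomputable def rokhlinEnt (G : Type*) {X : Type*} [Group G] [MulAction G X]
    [MeasurableSpace X] (μ : Measure X) : ℝ≥0∞ :=
  ⨅ (α : CtblPart X) (_ : SpansModNull (sigmaG G (Set.range α.piece)) μ), partEnt μ α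

/-- The orbit equivalence relation `E_G^X ⊆ X × X`. -/
def orbitRel' (G : Type*) (X : Type*) [Group G] [MulAction G X] : Set (X × X) :=
  {p | ∃ g : G, g • p.1 = p.2}

/-- The restriction of the relation `E` to the set `Y` is hyperfinite: it is the union of an
increasing sequence of finite Borel (sub)equivalence relations on `Y`. -/
def HyperfiniteOn {X : Type*} [MeasurableSpace X] (E : Set (X × X)) (Y : Set X) : Prop :=
  ∃ Rn : ℕ → Set (X × X), Monotone Rn ∧
    (∀ n, MeasurableSet (Rn n) ∧
      (∀ x ∈ Y, (x, x) ∈ Rn n) ∧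
      (∀ x y : X, (x, y) ∈ Rn n → (y, x) ∈ Rn n) ∧
      (∀ x y z : X, (x, y) ∈ Rn n → (y, z) ∈ Rn n → (x, z) ∈ Rn n) ∧
      Rn n ⊆ Y ×ˢ Y ∧
      ∀ x : X, {y | (x, y) ∈ Rn n}.Finite) ∧
    (⋃ n, Rn n) = E ∩ Y ×ˢ Y

/-- The orbit equivalence relation is `μ`-hyperfinite: it is hyperfinite on a `μ`-conull
`G`-invariant Borel set. -/
def MuHyperfinite (G : Type*) {X : Type*} [Group G] [MulAction G X] [MeasurableSpace X]
    (μ : Measure X) : Prop :=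
  ∃ Y : Set X, MeasurableSet Y ∧ μ Yᶜ = 0 ∧
    (∀ g : G, (fun x : X => g • x) ⁻¹' Y = Y) ∧
    HyperfiniteOn (orbitRel' G X) Y

section FullGroup

variable {G X : Type*} [Group G] [Countable G] [MeasurableSpace X] [StandardBorelSpace X]
  [MulAction G X] [MeasurableConstSMul G X]

lemma measurableSet_eq_of_measurable {f g : X → X} (hf : Measurable f) (hg : Measurable g) :
    MeasurableSet {x | f x = g x} :=
  measurableSet_eq_fun hf hg

omit [StandardBorelSpace X] in
/-- A map moving each point inside its orbit by a measurably chosen group element is measurable. -/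
lemma measurable_of_orbit_map {T : X → X} (h : ∀ x, ∃ g : G, T x = g • x)
    (hm : ∀ g : G, MeasurableSet {x | T x = g • x}) : Measurable T := by
  intro s hs
  have : T ⁻¹' s = ⋃ g : G, {x | T x = g • x} ∩ (fun x => g • x) ⁻¹' s := by
    ext x
    simp only [Set.mem_preimage, Set.mem_iUnion, Set.mem_inter_iff, Set.mem_ofPred_eq]
    constructor
    · intro hx
      obtain ⟨g, hg⟩ := h x
      exact ⟨g, hg, by rwa [← hg]⟩
    · rintro ⟨g, hg, hx⟩
      rwa [hg]
  rw [this]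
  exact MeasurableSet.iUnion fun g => (hm g).inter (measurable_const_smul g hs)

variable (G X) in
/-- The full group of the orbit equivalence relation: Borel automorphisms moving every point
inside its orbit. -/
def fullGroup : Subgroup (Equiv.Perm X) where
  carrier := {σ | (∀ x, ∃ g : G, σ x = g • x) ∧ ∀ g : G, MeasurableSet {x | σ x = g • x}}
  one_mem' := ⟨fun x => ⟨1, by simp⟩, fun g =>
    measurableSet_eq_of_measurable measurable_id (measurable_const_smul g)⟩
  mul_mem' := by
    rintro σ τ ⟨hσ, hσm⟩ ⟨hτ, hτm⟩
    refine ⟨fun x => ?_, fun g => ?_⟩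
    · obtain ⟨g, hg⟩ := hτ x
      obtain ⟨k, hk⟩ := hσ (τ x)
      exact ⟨k * g, by rw [Equiv.Perm.mul_apply, hk, hg, mul_smul]⟩
    · exact measurableSet_eq_of_measurable
        ((measurable_of_orbit_map hσ hσm).comp (measurable_of_orbit_map hτ hτm))
        (measurable_const_smul g)
  inv_mem' := by
    rintro σ ⟨hσ, hσm⟩
    refine ⟨fun x => ?_, fun g => ?_⟩
    · obtain ⟨g, hg⟩ := hσ (σ⁻¹ x)
      refine ⟨g⁻¹, ?_⟩
      rw [eq_inv_smul_iff, ← hg]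
      simp
    · have : {x | σ⁻¹ x = g • x} = {x | σ (g • x) = x} := by
        ext x
        simp only [Set.mem_ofPred_eq]
        rw [Equiv.Perm.inv_eq_iff_eq, eq_comm]
      rw [this]
      exact measurableSet_eq_of_measurable
        ((measurable_of_orbit_map hσ hσm).comp (measurable_const_smul g)) measurable_id

lemma mem_fullGroup_of_measurable {σ : Equiv.Perm X} (h : ∀ x, ∃ g : G, σ x = g • x)
    (hm : Measurable σ) : σ ∈ fullGroup G X :=
  ⟨h, fun g => measurableSet_eq_of_measurable hm (measurable_const_smul g)⟩

lemma measurable_of_mem_fullGroup {σ : Equiv.Perm X} (h : σ ∈ fullGroup G X) : Measurable σ :=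
  measurable_of_orbit_map h.1 h.2

omit [StandardBorelSpace X] in
/-- Mass transport along a measurable choice of group elements. -/
lemma lintegral_eq_lintegral_tsum_transport (μ : Measure X) [SMulInvariantMeasure G X μ]
    {c : X → G} (hc : ∀ g, MeasurableSet {x | c x = g}) {f : X → ℝ≥0∞} (hf : Measurable f) :
    ∫⁻ x, f x ∂μ
      = ∫⁻ y, ∑' g : G, {x | c x = g}.indicator f (g⁻¹ • y) ∂μ := by
  have h1 : ∀ x, f x = ∑' g : G, {x | c x = g}.indicator f x := by
    intro x
    rw [tsum_eq_single (c x)]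
    · simp
    · intro g hg
      simp only [Set.indicator_apply_eq_zero, Set.mem_ofPred_eq]
      exact fun h => absurd h.symm hg
  calc ∫⁻ x, f x ∂μ = ∫⁻ x, ∑' g : G, {x | c x = g}.indicator f x ∂μ := by
        exact lintegral_congr h1
    _ = ∑' g : G, ∫⁻ x, {x | c x = g}.indicator f x ∂μ :=
        lintegral_tsum fun g => (hf.indicator (hc g)).aemeasurable
    _ = ∑' g : G, ∫⁻ y, {x | c x = g}.indicator f (g⁻¹ • y) ∂μ := by
        refine tsum_congr fun g => ?_
        exact ((measurePreserving_smul g⁻¹ μ).lintegral_comp (hf.indicator (hc g))).symm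
    _ = _ := (lintegral_tsum fun g =>
        ((hf.indicator (hc g)).comp (measurable_const_smul g⁻¹)).aemeasurable).symm

lemma measurePreserving_of_mem_fullGroup (μ : Measure X) [SMulInvariantMeasure G X μ]
    (hfree : ∀ (g : G) (x : X), g • x = x → g = 1)
    {σ : Equiv.Perm X} (h : σ ∈ fullGroup G X) : MeasurePreserving σ μ μ := by
  have hσ := measurable_of_mem_fullGroup h
  classical
  refine ⟨hσ, ?_⟩
  choose c hc using h.1
  have hinj : ∀ (x : X) (g k : G), g • x = k • x → g = k := by
    intro x g k hgk
    have := hfree (k⁻¹ * g) x (by rw [mul_smul, hgk, inv_smul_smul])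
    rw [inv_mul_eq_one] at this
    exact this.symm
  have hcm : ∀ g, {x | c x = g} = {x | σ x = g • x} := by
    intro g
    ext x
    simp only [Set.mem_ofPred_eq, hc]
    exact ⟨fun h => by rw [h], fun h => hinj _ _ _ h⟩
  ext s hs
  rw [Measure.map_apply hσ hs, ← lintegral_indicator_one hs, ← lintegral_indicator_one (hσ hs),
    lintegral_eq_lintegral_tsum_transport μ (c := c) (fun g => by rw [hcm]; exact h.2 g)
      (measurable_one.indicator (hσ hs))]
  refine lintegral_congr fun y => ?_
  have hy : σ (σ⁻¹ y) = y := by simp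
  rw [tsum_eq_single (c (σ⁻¹ y))]
  · have h2 : (c (σ⁻¹ y))⁻¹ • y = σ⁻¹ y := by
      rw [inv_smul_eq_iff, ← hc, hy]
    rw [h2, Set.indicator_of_mem (by rfl)]
    simp only [Set.indicator_apply, Set.mem_preimage, hy, Pi.one_apply]
  · intro g hg
    simp only [Set.indicator_apply_eq_zero, Set.mem_ofPred_eq]
    intro h3
    exfalso
    apply hg
    have h4 : σ (g⁻¹ • y) = y := by rw [hc, h3, smul_inv_smul]
    have h5 : g⁻¹ • y = σ⁻¹ y := by rw [Equiv.Perm.eq_inv_iff_eq, h4]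
    rw [← h5, h3]

end FullGroup

section Separation

variable {G X : Type*} [Group G] [MeasurableSpace X] [StandardBorelSpace X]
  [MulAction G X] [MeasurableConstSMul G X]

/-- Countable Borel colouring of a free action: each colour class is disjoint from its translates
by the nontrivial elements of a given finite set. -/
lemma exists_measurable_cover_separated (hfree : ∀ (g : G) (x : X), g • x = x → g = 1)
    (K : Finset G) : ∃ B : ℕ → Set X, (∀ k, MeasurableSet (B k)) ∧ (⋃ k, B k) = Set.univ ∧
      ∀ k, ∀ x ∈ B k, ∀ g ∈ K, g ≠ 1 → g • x ∉ B k := by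
  classical
  set e := embeddingReal X
  have hem : Measurable e := (measurableEmbedding_embeddingReal X).measurable
  have hei : Function.Injective e := (measurableEmbedding_embeddingReal X).injective
  let C : (K → ℚ × Bool) → Set X := fun p => {x | ∀ g : K, (g : G) ≠ 1 →
    if (p g).2 then e x < (p g).1 ∧ (p g).1 ≤ e ((g : G) • x)
    else e ((g : G) • x) < (p g).1 ∧ (p g).1 ≤ e x}
  have hC : ∀ p, MeasurableSet (C p) := by
    intro p
    have : C p = ⋂ g : K, ⋂ _ : (g : G) ≠ 1, {x |
      if (p g).2 then e x < (p g).1 ∧ (p g).1 ≤ e ((g : G) • x)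
      else e ((g : G) • x) < (p g).1 ∧ (p g).1 ≤ e x} := by
      ext x; simp [C]
    rw [this]
    refine MeasurableSet.iInter fun g => MeasurableSet.iInter fun _ => ?_
    have hg : Measurable fun x : X => e ((g : G) • x) := hem.comp (measurable_const_smul (g : G))
    by_cases hb : (p g).2
    · simp only [hb, if_true]
      exact (measurableSet_lt hem measurable_const).inter (measurableSet_le measurable_const hg)
    · simp only [hb]
      exact (measurableSet_lt hg measurable_const).inter (measurableSet_le measurable_const hem)
  obtain ⟨φ, hφ⟩ := exists_surjective_nat (K → ℚ × Bool)
  refine ⟨fun k => C (φ k), fun k => hC _, ?_, ?_⟩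
  · rw [Set.eq_univ_iff_forall]
    intro x
    have : ∀ g : K, ∃ p : ℚ × Bool, (g : G) ≠ 1 →
        if p.2 then e x < p.1 ∧ p.1 ≤ e ((g : G) • x)
        else e ((g : G) • x) < p.1 ∧ p.1 ≤ e x := by
      intro g
      by_cases hg : (g : G) = 1
      · exact ⟨(0, true), fun h => absurd hg h⟩
      · have hne : e x ≠ e ((g : G) • x) := fun h => hg (hfree _ _ (hei h).symm)
        rcases lt_or_gt_of_ne hne with h | h
        · obtain ⟨q, h1, h2⟩ := exists_rat_btwn h
          exact ⟨(q, true), fun _ => by simp [h1, h2.le]⟩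
        · obtain ⟨q, h1, h2⟩ := exists_rat_btwn h
          exact ⟨(q, false), fun _ => by simp [h1, h2.le]⟩
    choose p hp using this
    obtain ⟨k, hk⟩ := hφ p
    refine Set.mem_iUnion.2 ⟨k, ?_⟩
    rw [hk]
    exact hp
  · intro k x hx g hg hg1 hgx
    have h1 := hx ⟨g, hg⟩ hg1
    have h2 := hgx ⟨g, hg⟩ hg1
    by_cases hb : (φ k ⟨g, hg⟩).2
    · simp only [hb, if_true] at h1 h2
      exact absurd h2.1 (not_lt.2 h1.2)
    · simp only [hb] at h1 h2
      exact absurd h1.1 (not_lt.2 h2.2)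

omit [MeasurableSpace X] [StandardBorelSpace X] [MeasurableConstSMul G X] in
lemma smul_left_injective_of_free (hfree : ∀ (g : G) (x : X), g • x = x → g = 1)
    {g k : G} {x : X} (h : g • x = k • x) : g = k := by
  have := hfree (k⁻¹ * g) x (by rw [mul_smul, h, inv_smul_smul])
  rw [inv_mul_eq_one] at this
  exact this.symm

/-- Countable Borel colouring such that tiles of a given finite shape rooted in one colour class
are pairwise disjoint. -/
lemma exists_measurable_cover_disjoint_tiles (hfree : ∀ (g : G) (x : X), g • x = x → g = 1)
    (K : Finset G) : ∃ B : ℕ → Set X, (∀ k, MeasurableSet (B k)) ∧ (⋃ k, B k) = Set.univ ∧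
      ∀ k, ∀ x ∈ B k, ∀ y ∈ B k, ∀ g ∈ K, ∀ g' ∈ K, g • x = g' • y → x = y := by
  classical
  obtain ⟨B, h1, h2, h3⟩ := exists_measurable_cover_separated hfree
    (Finset.image₂ (fun g g' => g⁻¹ * g') K K)
  refine ⟨B, h1, h2, fun k x hx y hy g hg g' hg' h => ?_⟩
  have hxy : x = (g⁻¹ * g') • y := by rw [mul_smul, ← h, inv_smul_smul]
  by_contra hne
  refine h3 k y hy (g⁻¹ * g') (Finset.mem_image₂_of_mem hg hg') ?_ (hxy ▸ hx)
  intro h1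
  rw [h1, one_smul] at hxy
  exact hne hxy

end Separation

section Expansion

open Pointwise in
/-- A group without Følner sets has a finite symmetric set which doubles every finite set. -/
lemma exists_doubling_of_not_folner {G : Type*} [Group G] [DecidableEq G]
    (h : ¬ ∀ (S : Finset G) (ε : ℝ), 0 < ε → ∃ K : Finset G, K.Nonempty ∧
      (((S * K) \ K).card : ℝ) ≤ ε * K.card) :
    ∃ S : Finset G, 1 ∈ S ∧ (∀ s ∈ S, s⁻¹ ∈ S) ∧ ∀ K : Finset G, 2 * K.card ≤ (S * K).card := by
  push Not at h
  obtain ⟨S₀, ε, hε, h⟩ := h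
  set S : Finset G := insert 1 (S₀ ∪ S₀⁻¹) with hS
  have h1S : (1 : G) ∈ S := Finset.mem_insert_self _ _
  have hsymm : S⁻¹ = S := by
    ext x
    simp only [hS, Finset.mem_inv', Finset.mem_insert, Finset.mem_union, inv_eq_one, inv_inv]
    tauto
  have hgrow : ∀ K : Finset G, (1 + ε) * K.card ≤ ((S * K).card : ℝ) := by
    intro K
    rcases K.eq_empty_or_nonempty with rfl | hK
    · simp
    have h2 := h K hK
    have h3 : K ⊆ S * K := fun x hx => by
      simpa using Finset.mul_mem_mul h1S hx
    have h4 : (S₀ * K) \ K ⊆ (S * K) \ K := by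
      apply Finset.sdiff_subset_sdiff _ le_rfl
      exact Finset.mul_subset_mul_right fun x hx => by simp [hS, hx]
    have h5 := Finset.card_le_card h4
    have h6 := Finset.card_sdiff_add_card_eq_card h3
    have h7 : (((S * K) \ K).card : ℝ) + K.card = (S * K).card := by exact_mod_cast h6
    have h8 : (((S₀ * K) \ K).card : ℝ) ≤ ((S * K) \ K).card := by exact_mod_cast h5
    linarith
  have hpow : ∀ (n : ℕ) (K : Finset G), (1 + ε) ^ n * K.card ≤ ((S ^ n * K).card : ℝ) := by
    intro n
    induction n with
    | zero => intro K; simp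
    | succ n ih =>
      intro K
      have h2 := ih K
      have h3 := hgrow (S ^ n * K)
      rw [← mul_assoc, ← pow_succ'] at h3
      calc (1 + ε) ^ (n + 1) * K.card = (1 + ε) * ((1 + ε) ^ n * K.card) := by ring
        _ ≤ (1 + ε) * ((S ^ n * K).card : ℝ) := by gcongr
        _ ≤ _ := h3
  obtain ⟨n, hn⟩ := pow_unbounded_of_one_lt (2 : ℝ) (by linarith : 1 < 1 + ε)
  refine ⟨S ^ n, Finset.one_mem_pow h1S, fun s hs => ?_, fun K => ?_⟩
  · rw [← Finset.mem_inv', ← inv_pow, hsymm]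
    exact hs
  · have := hpow n K
    have h9 : (2 : ℝ) * K.card ≤ ((S ^ n * K).card : ℝ) :=
      le_trans (by gcongr) this
    exact_mod_cast h9

open Pointwise in
/-- Hall's theorem turns a doubling set into a two-to-one injection. -/
lemma exists_injective_of_doubling {G : Type*} [Group G] [DecidableEq G] {S : Finset G}
    (h : ∀ K : Finset G, 2 * K.card ≤ (S * K).card) :
    ∃ ψ : G × Bool → G, Function.Injective ψ ∧ ∀ p, ∃ s ∈ S, ψ p = s * p.1 := by
  have := (Finset.all_card_le_biUnion_card_iff_exists_injective
    (fun p : G × Bool => S.image (fun s => s * p.1))).1 ?_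
  · obtain ⟨ψ, hψ, hmem⟩ := this
    refine ⟨ψ, hψ, fun p => ?_⟩
    obtain ⟨s, hs, he⟩ := Finset.mem_image.1 (hmem p)
    exact ⟨s, hs, he.symm⟩
  · intro s
    have h1 : s.card ≤ 2 * (s.image Prod.fst).card := by
      have : s ⊆ (s.image Prod.fst) ×ˢ (Finset.univ : Finset Bool) := fun p hp => by
        simp only [Finset.mem_product, Finset.mem_univ, and_true]
        exact Finset.mem_image_of_mem _ hp
      calc s.card ≤ _ := Finset.card_le_card this
        _ = _ := by rw [Finset.card_product]; simp [mul_comm]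
    refine h1.trans ((h _).trans (Finset.card_le_card ?_))
    intro x hx
    obtain ⟨a, ha, b, hb, rfl⟩ := Finset.mem_mul.1 hx
    obtain ⟨p, hp, rfl⟩ := Finset.mem_image.1 hb
    exact Finset.mem_biUnion.2 ⟨p, hp, Finset.mem_image.2 ⟨a, ha, rfl⟩⟩

lemma sq_sum_le_card_mul_sub {ι : Type*} [DecidableEq ι] (S : Finset ι) {a : ι} (ha : a ∈ S)
    (u : ι → ℝ) :
    (∑ s ∈ S, u s) ^ 2 ≤ S.card * ∑ s ∈ S, u s ^ 2 - ∑ s ∈ S, (u a - u s) ^ 2 := by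
  have h1 : ∀ f : ι → ℝ, ∑ s ∈ S, f s = f a + ∑ s ∈ S.erase a, f s := fun f =>
    (Finset.add_sum_erase S f ha).symm
  have hc : (S.card : ℝ) = 1 + (S.erase a).card := by
    rw [Finset.card_erase_of_mem ha, Nat.cast_sub (Finset.card_pos.2 ⟨a, ha⟩)]
    simp
  have hcs := sq_sum_le_card_mul_sum_sq (s := S.erase a) (f := fun s => u a - u s)
  rw [h1, h1, h1, hc]
  have e1 : ∑ s ∈ S.erase a, (u a - u s) = (S.erase a).card * u a - ∑ s ∈ S.erase a, u s := by
    rw [Finset.sum_sub_distrib]; simp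
  have e2 : ∑ s ∈ S.erase a, (u a - u s) ^ 2 = (S.erase a).card * u a ^ 2
      - 2 * u a * (∑ s ∈ S.erase a, u s) + ∑ s ∈ S.erase a, u s ^ 2 := by
    rw [Finset.mul_sum, ← nsmul_eq_mul, ← Finset.sum_const, ← Finset.sum_sub_distrib,
      ← Finset.sum_add_distrib]
    exact Finset.sum_congr rfl fun s _ => by ring
  rw [e1, e2] at hcs
  rw [e2]
  nlinarith [hcs]

/-- The sum of translates of `f` over a finite family of group elements. -/
def translateSum {G I : Type*} [Group G] [Fintype I] (ev : I → G) (f : G → ℝ) : G → ℝ :=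
  fun g => ∑ i, f ((ev i)⁻¹ * g)

/-- The family `ev` acts by convolution with `ℓ²`-norm at most `ρ` on finitely supported
functions. -/
def ConvNormLE {G I : Type*} [Group G] [Fintype I] (ev : I → G) (ρ : ℝ) : Prop :=
  0 ≤ ρ ∧ ∀ f : G → ℝ, (Function.support f).Finite →
    ∑' g, translateSum ev f g ^ 2 ≤ ρ ^ 2 * ∑' g, f g ^ 2

variable {G : Type*} [Group G]

lemma finite_support_translate {f : G → ℝ} (hf : (Function.support f).Finite) (s : G) :
    (Function.support fun g => f (s * g)).Finite := by
  have : (Function.support fun g => f (s * g)) = (fun g => s * g) ⁻¹' Function.support f := rfl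
  rw [this]
  exact hf.preimage (mul_right_injective s).injOn

lemma finite_support_translateSum {I : Type*} [Fintype I] (ev : I → G) {f : G → ℝ}
    (hf : (Function.support f).Finite) : (Function.support (translateSum ev f)).Finite := by
  refine (Set.finite_iUnion fun i => finite_support_translate hf (ev i)⁻¹).subset ?_
  intro g hg
  by_contra h
  simp only [Set.mem_iUnion, Function.mem_support, not_exists, not_not] at h
  exact hg (Finset.sum_eq_zero fun i _ => h i)

omit [Group G] in
lemma summable_sq_of_finite_support {f : G → ℝ} (hf : (Function.support f).Finite) :
    Summable fun g => f g ^ 2 :=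
  summable_of_hasFiniteSupport (hf.subset fun g hg h => hg (by
    simp only [h]; norm_num))

lemma tsum_translate (f : G → ℝ) (s : G) : ∑' g, f (s * g) = ∑' g, f g :=
  (Equiv.mulLeft s).tsum_eq f

lemma ConvNormLE.comp {I J : Type*} [Fintype I] [Fintype J] {ev : I → G} {ev' : J → G}
    {ρ ρ' : ℝ} (h : ConvNormLE ev ρ) (h' : ConvNormLE ev' ρ') :
    ConvNormLE (fun p : I × J => ev' p.2 * ev p.1) (ρ * ρ') := by
  refine ⟨mul_nonneg h.1 h'.1, fun f hf => ?_⟩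
  have e : translateSum (fun p : I × J => ev' p.2 * ev p.1) f
      = translateSum ev' (translateSum ev f) := by
    ext g
    simp only [translateSum, Fintype.sum_prod_type_right, mul_inv_rev, mul_assoc]
  rw [e]
  calc _ ≤ ρ' ^ 2 * ∑' g, translateSum ev f g ^ 2 := h'.2 _ (finite_support_translateSum ev hf)
    _ ≤ ρ' ^ 2 * (ρ ^ 2 * ∑' g, f g ^ 2) := by gcongr; exact h.2 f hf
    _ = _ := by ring

lemma ConvNormLE.of_equiv {I J : Type*} [Fintype I] [Fintype J] {ev : I → G} {ρ : ℝ}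
    (h : ConvNormLE ev ρ) (e : J ≃ I) : ConvNormLE (fun j => ev (e j)) ρ := by
  refine ⟨h.1, fun f hf => ?_⟩
  have : translateSum (fun j => ev (e j)) f = translateSum ev f := by
    ext g
    exact e.sum_comp fun i => f ((ev i)⁻¹ * g)
  rw [this]
  exact h.2 f hf

lemma convNormLE_card {I : Type*} [Fintype I] (ev : I → G) :
    ConvNormLE ev (Fintype.card I) := by
  refine ⟨by positivity, fun f hf => ?_⟩
  have hs : ∀ i, Summable fun g => f ((ev i)⁻¹ * g) ^ 2 := fun i =>
    summable_sq_of_finite_support (finite_support_translate hf _)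
  calc ∑' g, translateSum ev f g ^ 2
      ≤ ∑' g, (Fintype.card I : ℝ) * ∑ i, f ((ev i)⁻¹ * g) ^ 2 := by
        refine Summable.tsum_le_tsum (fun g => ?_)
          (summable_sq_of_finite_support (finite_support_translateSum ev hf))
          ((summable_sum fun i _ => hs i).mul_left _)
        exact sq_sum_le_card_mul_sum_sq
    _ = (Fintype.card I : ℝ) * ∑ i, ∑' g, f ((ev i)⁻¹ * g) ^ 2 := by
        rw [tsum_mul_left, Summable.tsum_finsetSum fun i _ => hs i]
    _ = (Fintype.card I : ℝ) * ∑ _i : I, ∑' g, f g ^ 2 := by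
        congr 1
        exact Finset.sum_congr rfl fun i _ => tsum_translate (fun g => f g ^ 2) _
    _ = _ := by simp; ring

open Pointwise in
/-- Spectral gap for convolution by a symmetric doubling set. -/
lemma convNormLE_of_doubling [DecidableEq G] {S : Finset G} (h1 : (1 : G) ∈ S)
    (hsymm : ∀ s ∈ S, s⁻¹ ∈ S) (h : ∀ K : Finset G, 2 * K.card ≤ (S * K).card) :
    ConvNormLE (fun s : S => (s : G)) (Real.sqrt ((S.card : ℝ) ^ 2 - 1 / 6)) := by
  obtain ⟨ψ, hψ, hψS⟩ := exists_injective_of_doubling h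
  have hc1 : (1 : ℝ) ≤ S.card := by exact_mod_cast Finset.card_pos.2 ⟨1, h1⟩
  refine ⟨Real.sqrt_nonneg _, fun f hf => ?_⟩
  rw [Real.sq_sqrt (by nlinarith)]
  have hN := summable_sq_of_finite_support hf
  have hs : ∀ s : G, Summable fun g => f (s * g) ^ 2 := fun s =>
    summable_sq_of_finite_support (finite_support_translate hf s)
  have hsψ : Summable fun p : G × Bool => f (ψ p) ^ 2 := hN.comp_injective hψ
  have hsb : ∀ b : Bool, Summable fun g => f (ψ (g, b)) ^ 2 := fun b =>
    hN.comp_injective (hψ.comp (Prod.mk_left_injective b))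
  have hne : ∀ g, ψ (g, true) ≠ ψ (g, false) := fun g e => by simpa using hψ e
  have hψsum : ∑' g, f (ψ (g, true)) ^ 2 + ∑' g, f (ψ (g, false)) ^ 2 ≤ ∑' g, f g ^ 2 := by
    have hs' : Summable fun c : Bool × G => f (ψ (c.2, c.1)) ^ 2 :=
      (Equiv.prodComm Bool G).summable_iff.2 hsψ
    have e : ∑' c : Bool × G, f (ψ (c.2, c.1)) ^ 2
        = ∑' g, f (ψ (g, true)) ^ 2 + ∑' g, f (ψ (g, false)) ^ 2 := by
      rw [Summable.tsum_prod hs', tsum_fintype]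
      simp
    rw [← e]
    exact tsum_comp_le_tsum_of_inj hN (fun g => sq_nonneg _)
      (i := fun c : Bool × G => ψ (c.2, c.1))
      (hψ.comp (Equiv.prodComm Bool G).injective)
  have key : ∀ g, translateSum (fun s : S => (s : G)) f g ^ 2
      ≤ S.card * ∑ s ∈ S, f (s * g) ^ 2 - 2 / 3 * f g ^ 2
        + 1 / 2 * (f (ψ (g, true)) ^ 2 + f (ψ (g, false)) ^ 2) := by
    intro g
    have e : translateSum (fun s : S => (s : G)) f g = ∑ s ∈ S, f (s * g) := by
      rw [translateSum, Finset.sum_coe_sort S fun s => f (s⁻¹ * g)]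
      exact Finset.sum_nbij' (fun s => s⁻¹) (fun s => s⁻¹) hsymm hsymm (by simp) (by simp)
        (by simp)
    rw [e]
    have h2 := sq_sum_le_card_mul_sub S h1 fun s => f (s * g)
    have h3 : (f g - f (ψ (g, true))) ^ 2 + (f g - f (ψ (g, false))) ^ 2
        ≤ ∑ s ∈ S, (f (1 * g) - f (s * g)) ^ 2 := by
      obtain ⟨s, hs, hse⟩ := hψS (g, true)
      obtain ⟨t, ht, hte⟩ := hψS (g, false)
      have hst : s ≠ t := by
        rintro rfl
        exact hne g (hse.trans hte.symm)
      have : ({s, t} : Finset G) ⊆ S := by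
        intro x hx
        simp only [Finset.mem_insert, Finset.mem_singleton] at hx
        rcases hx with rfl | rfl <;> assumption
      have h4 := Finset.sum_le_sum_of_subset_of_nonneg this
        (f := fun s => (f (1 * g) - f (s * g)) ^ 2) fun _ _ _ => sq_nonneg _
      rw [Finset.sum_pair hst] at h4
      simpa [hse, hte] using h4
    nlinarith [h2, h3, sq_nonneg (2 * f g - 3 * f (ψ (g, true))),
      sq_nonneg (2 * f g - 3 * f (ψ (g, false)))]
  have hsum1 : Summable fun g => (S.card : ℝ) * ∑ s ∈ S, f (s * g) ^ 2 :=
    (summable_sum fun s _ => hs s).mul_left _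
  have hsum2 := hN.mul_left (2 / 3 : ℝ)
  have hsum3 := ((hsb true).add (hsb false)).mul_left (1 / 2 : ℝ)
  calc _ ≤ ∑' g, (S.card * ∑ s ∈ S, f (s * g) ^ 2 - 2 / 3 * f g ^ 2
        + 1 / 2 * (f (ψ (g, true)) ^ 2 + f (ψ (g, false)) ^ 2)) :=
        Summable.tsum_le_tsum key
          (summable_sq_of_finite_support (finite_support_translateSum _ hf))
          ((hsum1.sub hsum2).add hsum3)
    _ = S.card * ∑ s ∈ S, ∑' g, f (s * g) ^ 2 - 2 / 3 * ∑' g, f g ^ 2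
        + 1 / 2 * (∑' g, f (ψ (g, true)) ^ 2 + ∑' g, f (ψ (g, false)) ^ 2) := by
        rw [(hsum1.sub hsum2).tsum_add hsum3, hsum1.tsum_sub hsum2, tsum_mul_left, tsum_mul_left,
          tsum_mul_left, Summable.tsum_finsetSum fun s _ => hs s, (hsb true).tsum_add (hsb false)]
    _ = (S.card : ℝ) ^ 2 * ∑' g, f g ^ 2 - 2 / 3 * ∑' g, f g ^ 2
        + 1 / 2 * (∑' g, f (ψ (g, true)) ^ 2 + ∑' g, f (ψ (g, false)) ^ 2) := by
        rw [Finset.sum_congr rfl fun s _ => tsum_translate (fun g => f g ^ 2) s]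
        simp; ring
    _ ≤ _ := by linarith

end Expansion

section Counting

universe u

variable {G : Type u} [Group G]

/-- Alphabets of size `r ^ j` with convolution norm `R ^ j`, obtained by composing letters. -/
lemma exists_letters {I₀ : Type u} [Fintype I₀] {ev₀ : I₀ → G} {R : ℝ} (h : ConvNormLE ev₀ R)
    (h' : ConvNormLE (fun i => (ev₀ i)⁻¹) R) (j : ℕ) :
    ∃ (I : Type u) (_ : Fintype I) (ev : I → G), Fintype.card I = Fintype.card I₀ ^ j ∧
      ConvNormLE ev (R ^ j) ∧ ConvNormLE (fun i => (ev i)⁻¹) (R ^ j) := by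
  induction j with
  | zero =>
    refine ⟨PUnit, inferInstance, fun _ => 1, by simp, ?_, ?_⟩
    · simpa using convNormLE_card (G := G) fun _ : PUnit.{u + 1} => 1
    · simpa using convNormLE_card (G := G) fun _ : PUnit.{u + 1} => 1
  | succ j ih =>
    obtain ⟨I, hI, ev, hc, h1, h2⟩ := ih
    refine ⟨I₀ × I, inferInstance, fun p => ev p.2 * ev₀ p.1, ?_, ?_, ?_⟩
    · rw [Fintype.card_prod, hc, pow_succ']
    · rw [pow_succ']
      exact h.comp h1
    · rw [pow_succ]
      simpa using (h2.comp h').of_equiv (Equiv.prodComm I₀ I)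

/-- The elementary steps of a cycle code: letter, gap, letter, gap. -/
abbrev CycStep (I : Type*) {G : Type*} (Q : Finset G) := ((I × Q) × I) × Q

variable {I : Type*} {Q : Finset G} (ev : I → G)

/-- The displacement of the first half of an elementary step. -/
def halfDisp (c : CycStep I Q) : G := (ev c.1.2)⁻¹ * ((c.1.1.2 : G) * ev c.1.1.1)

/-- The displacement of an elementary step. -/
def stepDisp (c : CycStep I Q) : G := (c.2 : G) * halfDisp ev c

/-- The total displacement of a cycle code. -/
def codeDisp : List (CycStep I Q) → G
  | [] => 1
  | c :: v => stepDisp ev c * codeDisp v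

/-- The positions visited by a cycle code together with the letters read there. -/
def codePos : List (CycStep I Q) → List (G × I)
  | [] => []
  | c :: v => (codeDisp ev v, c.1.1.1) :: (halfDisp ev c * codeDisp ev v, c.1.2) :: codePos v

lemma length_codePos (v : List (CycStep I Q)) : (codePos ev v).length = 2 * v.length := by
  induction v with
  | nil => rfl
  | cons c v ih => simp [codePos, ih]; ring

lemma one_mem_codePos {v : List (CycStep I Q)} (hv : v ≠ []) :
    ∃ s, ((1 : G), s) ∈ codePos ev v := by
  induction v with
  | nil => exact absurd rfl hv
  | cons c v ih =>
    rcases v.eq_nil_or_concat with rfl | ⟨w, a, rfl⟩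
    · exact ⟨c.1.1.1, by simp [codePos, codeDisp]⟩
    · obtain ⟨s, hs⟩ := ih (by simp)
      exact ⟨s, by simp only [codePos, List.mem_cons]; exact Or.inr (Or.inr hs)⟩

variable [Fintype I]

lemma convNormLE_stepDisp {R : ℝ} (h : ConvNormLE ev R) (h' : ConvNormLE (fun i => (ev i)⁻¹) R) :
    ConvNormLE (stepDisp ev : CycStep I Q → G) ((Q.card * R) ^ 2) := by
  have hQ : ConvNormLE (fun q : Q => (q : G)) Q.card := by
    simpa using convNormLE_card fun q : Q => (q : G)
  have := ((h.comp hQ).comp h').comp hQ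
  have e : R * Q.card * R * Q.card = ((Q.card : ℝ) * R) ^ 2 := by ring
  rw [e] at this
  exact this

/-- The number of closed codes of length `n` is at most `B ^ n`. -/
lemma card_closed_codes_le [DecidableEq G] {B : ℝ}
    (h : ConvNormLE (stepDisp ev : CycStep I Q → G) B) (n : ℕ) (J : Finset (List (CycStep I Q)))
    (hJ : ∀ v ∈ J, v.length = n ∧ codeDisp ev v = 1) : (J.card : ℝ) ≤ B ^ n := by
  classical
  have key : ∀ n : ℕ, ∃ c : G → ℝ, (Function.support c).Finite ∧ ∑' g, c g ^ 2 ≤ (B ^ n) ^ 2 ∧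
      ∀ (g : G) (J : Finset (List (CycStep I Q))),
        (∀ v ∈ J, v.length = n ∧ codeDisp ev v = g) → (J.card : ℝ) ≤ c g := by
    intro n
    induction n with
    | zero =>
      refine ⟨Pi.single 1 1, ?_, ?_, ?_⟩
      · exact (Set.finite_singleton (1 : G)).subset Pi.support_single_subset
      · rw [tsum_eq_single 1 fun g hg => by simp [hg]]
        simp
      · intro g J hJ
        by_cases hg : g = 1
        · subst hg
          have : J ⊆ {[]} := fun v hv => by
            simpa using (hJ v hv).1
          simpa using Finset.card_le_card this
        · have : J = ∅ := Finset.eq_empty_of_forall_notMem fun v hv => by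
            obtain ⟨h1, h2⟩ := hJ v hv
            rw [List.length_eq_zero_iff] at h1
            subst h1
            exact hg h2.symm
          simp [this, hg]
    | succ n ih =>
      obtain ⟨c, hc1, hc2, hc3⟩ := ih
      refine ⟨translateSum (stepDisp ev : CycStep I Q → G) c, finite_support_translateSum _ hc1,
        ?_, ?_⟩
      · calc _ ≤ B ^ 2 * ∑' g, c g ^ 2 := h.2 c hc1
          _ ≤ B ^ 2 * (B ^ n) ^ 2 := by gcongr
          _ = _ := by ring
      · intro g J hJ
        have hsub : J ⊆ Finset.univ.biUnion fun a : CycStep I Q =>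
            ((J.filter fun v => v.head? = some a).image List.tail).image (List.cons a) := by
          intro v hv
          cases v with
          | nil => simpa using (hJ _ hv).1
          | cons a w =>
            simp only [Finset.mem_biUnion, Finset.mem_univ, true_and, Finset.mem_image]
            exact ⟨a, w, ⟨a :: w, by simp [hv], rfl⟩, rfl⟩
        have h1 : (J.card : ℝ) ≤ ∑ a : CycStep I Q,
            (((J.filter fun v => v.head? = some a).image List.tail).card : ℝ) := by
          have := (Finset.card_le_card hsub).trans Finset.card_biUnion_le
          refine le_trans (Nat.cast_le.2 this) ?_
          push_cast
          exact Finset.sum_le_sum fun a _ => by exact_mod_cast Finset.card_image_le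
        refine h1.trans (Finset.sum_le_sum fun a _ => hc3 _ _ ?_)
        intro w hw
        obtain ⟨v, hv, rfl⟩ := Finset.mem_image.1 hw
        rw [Finset.mem_filter] at hv
        obtain ⟨h2, h3⟩ := hJ v hv.1
        cases v with
        | nil => simp at hv
        | cons b w =>
          have : b = a := by simpa using hv.2
          subst this
          refine ⟨by simpa using h2, ?_⟩
          rw [← h3]
          simp [codeDisp]
  obtain ⟨c, hc1, hc2, hc3⟩ := key n
  have h1 := hc3 1 J hJ
  have h2 : c 1 ^ 2 ≤ (B ^ n) ^ 2 :=
    le_trans ((summable_sq_of_finite_support hc1).le_tsum 1 fun _ _ => sq_nonneg _) hc2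
  exact h1.trans (le_trans (le_abs_self _) (abs_le_of_sq_le_sq h2 (pow_nonneg h.1 n)))

/-- Kraft's inequality for closed codes. -/
lemma sum_closed_codes_le [DecidableEq G] {B : ℝ} (hB : 0 < B)
    (h : ConvNormLE (stepDisp ev : CycStep I Q → G) B) (J : Finset (List (CycStep I Q)))
    (hJ : ∀ v ∈ J, v ≠ [] ∧ codeDisp ev v = 1) :
    ∑ v ∈ J, ((2 * B) ^ v.length)⁻¹ ≤ 1 := by
  classical
  set N := J.sup List.length with hN
  have hmaps : ∀ v ∈ J, v.length ∈ Finset.Icc 1 N := fun v hv => by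
    rw [Finset.mem_Icc]
    exact ⟨List.length_pos_iff.2 (hJ v hv).1, Finset.le_sup (f := List.length) hv⟩
  rw [← Finset.sum_fiberwise_of_maps_to hmaps]
  have h1 : ∀ n ∈ Finset.Icc 1 N, ∑ v ∈ J with v.length = n, ((2 * B) ^ v.length)⁻¹
      ≤ (1 / 2 : ℝ) ^ n := by
    intro n _
    have h2 : ((J.filter fun v => v.length = n).card : ℝ) ≤ B ^ n :=
      card_closed_codes_le ev h n _ fun v hv => by
        rw [Finset.mem_filter] at hv
        exact ⟨hv.2, (hJ v hv.1).2⟩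
    calc ∑ v ∈ J with v.length = n, ((2 * B) ^ v.length)⁻¹
        = ∑ v ∈ J with v.length = n, ((2 * B) ^ n)⁻¹ := Finset.sum_congr rfl fun v hv => by
          rw [(Finset.mem_filter.1 hv).2]
      _ = ((J.filter fun v => v.length = n).card : ℝ) * ((2 * B) ^ n)⁻¹ := by simp
      _ ≤ B ^ n * ((2 * B) ^ n)⁻¹ := by gcongr
      _ = _ := by rw [mul_pow, one_div, inv_pow]; field_simp
  refine (Finset.sum_le_sum h1).trans ?_
  have h3 : ∀ N : ℕ, ∑ n ∈ Finset.Icc 1 N, (1 / 2 : ℝ) ^ n = 1 - (1 / 2) ^ N := by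
    intro N
    induction N with
    | zero => simp
    | succ N ih => rw [Finset.sum_Icc_succ_top (by omega), ih]; ring
  rw [h3]
  have : (0 : ℝ) ≤ (1 / 2) ^ N := by positivity
  linarith

end Counting

section Greedy

variable {G X : Type*} [Group G] [Countable G] [MeasurableSpace X] [StandardBorelSpace X]
  [MulAction G X] [MeasurableConstSMul G X]

omit [Countable G] [StandardBorelSpace X] in
lemma measurableSet_smul_image (g : G) {s : Set X} (hs : MeasurableSet s) :
    MeasurableSet ((fun x => g • x) '' s) := by
  have : (fun x : X => g • x) '' s = (fun x => g⁻¹ • x) ⁻¹' s := by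
    ext x
    constructor
    · rintro ⟨y, hy, rfl⟩
      simpa using hy
    · intro h
      exact ⟨g⁻¹ • x, h, by simp⟩
  rw [this]
  exact measurable_const_smul g⁻¹ hs

/-- Union of the tiles of shape `Q` rooted in `R`. -/
def tiles (Q : Finset G) (R : Set X) : Set X := ⋃ q ∈ Q, (fun x => q • x) '' R

omit [Countable G] [MeasurableSpace X] [StandardBorelSpace X] [MeasurableConstSMul G X] in
lemma mem_tiles {Q : Finset G} {R : Set X} {x : X} :
    x ∈ tiles Q R ↔ ∃ q ∈ Q, ∃ r ∈ R, q • r = x := by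
  simp [tiles]

omit [Countable G] [StandardBorelSpace X] in
lemma measurableSet_tiles (Q : Finset G) {R : Set X} (hR : MeasurableSet R) :
    MeasurableSet (tiles Q R) :=
  Finset.measurableSet_biUnion _ fun q _ => measurableSet_smul_image q hR

omit [Countable G] in
/-- Greedy removal of pairwise disjoint tiles: each of countably many kinds of tiles is considered
infinitely often at each point. -/
lemma exists_greedy (hfree : ∀ (g : G) (x : X), g • x = x → g = 1) {A₀ : Set X}
    (hA₀ : MeasurableSet A₀) (Q : ℕ → Finset G) (C : ℕ → Set X → Set X)
    (hC : ∀ i A, MeasurableSet A → MeasurableSet (C i A)) :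
    ∃ (p : ℕ → ℕ) (A R : ℕ → Set X), A 0 = A₀ ∧ (∀ n, MeasurableSet (A n)) ∧
      (∀ n, MeasurableSet (R n)) ∧ (∀ n, A (n + 1) = A n \ tiles (Q (p n)) (R n)) ∧
      (∀ n, R n ⊆ C (p n) (A n)) ∧
      (∀ n, ∀ x ∈ R n, ∀ y ∈ R n, ∀ q ∈ Q (p n), ∀ q' ∈ Q (p n), q • x = q' • y → x = y) ∧
      ∀ (i : ℕ) (x : X) (N : ℕ), ∃ n, N ≤ n ∧ p n = i ∧ (x ∈ C i (A n) → x ∈ R n) := by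
  choose B hB1 hB2 hB3 using fun i => exists_measurable_cover_disjoint_tiles hfree (Q i)
  let p : ℕ → ℕ := fun n => n.unpair.1.unpair.1
  let k : ℕ → ℕ := fun n => n.unpair.1.unpair.2
  let R' : ℕ → Set X → Set X := fun n A => B (p n) (k n) ∩ C (p n) A
  let A : ℕ → Set X := fun n => Nat.rec A₀ (fun n A => A \ tiles (Q (p n)) (R' n A)) n
  have hAs : ∀ n, A (n + 1) = A n \ tiles (Q (p n)) (R' n (A n)) := fun n => rfl
  have hA : ∀ n, MeasurableSet (A n) := by
    intro n
    induction n with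
    | zero => exact hA₀
    | succ n ih =>
      rw [hAs]
      exact ih.diff (measurableSet_tiles _ ((hB1 _ _).inter (hC _ _ ih)))
  refine ⟨p, A, fun n => R' n (A n), rfl, hA, fun n => (hB1 _ _).inter (hC _ _ (hA n)), hAs,
    fun n => Set.inter_subset_right, ?_, ?_⟩
  · intro n x hx y hy q hq q' hq' h
    exact hB3 _ _ x hx.1 y hy.1 q hq q' hq' h
  · intro i x N
    obtain ⟨l, hl⟩ := Set.mem_iUnion.1 ((hB2 i).symm ▸ Set.mem_univ x)
    refine ⟨Nat.pair (Nat.pair i l) N, Nat.right_le_pair _ _, by simp [p], fun h => ?_⟩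
    simp only [R', p, k, Nat.unpair_pair, Set.mem_inter_iff]
    exact ⟨hl, h⟩

end Greedy

lemma greedy_antitone {Z : Type*} {A T : ℕ → Set Z} (h : ∀ n, A (n + 1) = A n \ T n) :
    Antitone A :=
  antitone_nat_of_succ_le fun n => by rw [h]; exact Set.sdiff_subset

lemma exists_mem_removed {Z : Type*} {A T : ℕ → Set Z} (h : ∀ n, A (n + 1) = A n \ T n)
    {x : Z} (h0 : x ∈ A 0) (hx : x ∉ ⋂ n, A n) : ∃ n, x ∈ A n ∧ x ∈ T n := by
  classical
  simp only [Set.mem_iInter, not_forall] at hx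
  have hf := Nat.find_spec hx
  obtain ⟨m, hm⟩ : ∃ m, Nat.find hx = m + 1 :=
    Nat.exists_eq_succ_of_ne_zero fun e => hf (by rw [e]; exact h0)
  have hm' : x ∈ A m := not_not.1 (Nat.find_min hx (m := m) (by omega))
  rw [hm, h] at hf
  exact ⟨m, hm', by by_contra hT; exact hf ⟨hm', hT⟩⟩

section Hyperfinite

variable {G X : Type*} [Group G] [Countable G] [MeasurableSpace X] [StandardBorelSpace X]
  [MulAction G X] [MeasurableConstSMul G X]

omit [Countable G] [StandardBorelSpace X] in
lemma measure_tiles (hfree : ∀ (g : G) (x : X), g • x = x → g = 1) (μ : Measure X)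
    [SMulInvariantMeasure G X μ] {Q : Finset G} {R : Set X} (hR : MeasurableSet R)
    (hd : ∀ x ∈ R, ∀ y ∈ R, ∀ q ∈ Q, ∀ q' ∈ Q, q • x = q' • y → x = y) :
    μ (tiles Q R) = Q.card * μ R := by
  rw [tiles, measure_biUnion_finset _ fun q _ => measurableSet_smul_image q hR]
  · have : ∀ q ∈ Q, μ ((fun x => q • x) '' R) = μ R := fun q _ => measure_smul q R (μ := μ)
    rw [Finset.sum_congr rfl this]
    simp
  · intro q hq q' hq' hne
    refine Set.disjoint_left.2 ?_
    rintro _ ⟨x, hx, rfl⟩ ⟨y, hy, h⟩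
    have := hd y hy x hx q' hq' q hq h
    subst this
    exact hne (smul_left_injective_of_free hfree h.symm)

/-- The points `x` such that `q • x` lies on the `S`-boundary of the tile `Q • x` inside `A`. -/
def tileBoundary (S Q : Finset G) (A : Set X) (q : G) : Set X :=
  {x | ∃ s ∈ S, s • q • x ∈ A ∧ s * q ∉ Q}

omit [Countable G] [StandardBorelSpace X] in
lemma measurableSet_tileBoundary (S Q : Finset G) {A : Set X} (hA : MeasurableSet A) (q : G) :
    MeasurableSet (tileBoundary S Q A q) := by
  have : tileBoundary S Q A q = ⋃ s ∈ S, {x | s • q • x ∈ A ∧ s * q ∉ Q} := by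
    ext x
    simp only [tileBoundary, Set.mem_ofPred_eq, Set.mem_iUnion, exists_prop]
  rw [this]
  refine Finset.measurableSet_biUnion _ fun s _ => ?_
  refine MeasurableSet.inter ?_ (MeasurableSet.const _)
  exact (measurable_const_smul s).comp (measurable_const_smul q) hA

open Pointwise in
/-- In a group with Følner sets almost all of the space can be tiled by finite tiles with small
boundary. -/
lemma exists_tiling [DecidableEq G]
    (hfree : ∀ (g : G) (x : X), g • x = x → g = 1) (μ : Measure X)
    [SMulInvariantMeasure G X μ] [IsProbabilityMeasure μ]
    (hF : ∀ (S : Finset G) (ε : ℝ), 0 < ε → ∃ K : Finset G, K.Nonempty ∧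
      (((S * K) \ K).card : ℝ) ≤ ε * K.card)
    (S : Finset G) {ε : ℝ} (hε : 0 < ε) :
    ∃ (Q : ℕ → Finset G) (A R : ℕ → Set X), A 0 = Set.univ ∧ (∀ n, MeasurableSet (A n)) ∧
      (∀ n, MeasurableSet (R n)) ∧ (∀ n, A (n + 1) = A n \ tiles (Q n) (R n)) ∧
      (∀ n, ∀ x ∈ R n, (∀ q ∈ Q n, q • x ∈ A n) ∧
        ∑ q ∈ Q n, (tileBoundary S (Q n) (A n) q).indicator (1 : X → ℝ≥0∞) x
          ≤ ENNReal.ofReal ε * ((Q n).card : ℝ≥0∞)) ∧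
      (∀ n, ∀ x ∈ R n, ∀ y ∈ R n, ∀ q ∈ Q n, ∀ q' ∈ Q n, q • x = q' • y → x = y) ∧
      μ (⋂ n, A n) = 0 := by
  classical
  obtain ⟨Q, hQ⟩ := exists_surjective_nat (Finset G)
  let C : ℕ → Set X → Set X := fun i A =>
    (⋂ q ∈ Q i, (fun x => q • x) ⁻¹' A) ∩
      {x | ∑ q ∈ Q i, (tileBoundary S (Q i) A q).indicator (1 : X → ℝ≥0∞) x
        ≤ ENNReal.ofReal ε * ((Q i).card : ℝ≥0∞)}
  have hC : ∀ i A, MeasurableSet A → MeasurableSet (C i A) := by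
    intro i A hA
    refine MeasurableSet.inter
      (Finset.measurableSet_biInter _ fun q _ => measurable_const_smul q hA)
      (measurableSet_le ?_ measurable_const)
    exact Finset.measurable_sum _ fun q _ =>
      measurable_one.indicator (measurableSet_tileBoundary S _ hA q)
  obtain ⟨p, A, R, hA0, hA, hR, hAs, hRC, hRd, hgr⟩ :=
    exists_greedy hfree MeasurableSet.univ Q C hC
  have hanti := greedy_antitone hAs
  refine ⟨fun n => Q (p n), A, R, hA0, hA, hR, hAs, fun n x hx => ⟨fun q hq => ?_, (hRC n hx).2⟩,
    hRd, ?_⟩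
  · exact Set.mem_iInter₂.1 (hRC n hx).1 q hq
  · by_contra hpos
    set A' := ⋂ n, A n with hA'
    have hA'm : MeasurableSet A' := MeasurableSet.iInter hA
    set a := (μ A').toReal with ha
    have hapos : 0 < a := ENNReal.toReal_pos hpos (measure_ne_top _ _)
    obtain ⟨K, hK, hKc⟩ := hF S (ε * a / (S.card + 1)) (by positivity)
    obtain ⟨x, hx⟩ : ∃ x : X, a * K.card ≤ ((K.filter fun k => k • x ∈ A').card : ℝ) := by
      have hm : ∀ k : G, MeasurableSet ((fun x : X => k • x) ⁻¹' A') := fun k =>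
        measurable_const_smul k hA'm
      have h1 : ∫ x, ∑ k ∈ K, ((fun x : X => k • x) ⁻¹' A').indicator (fun _ => (1 : ℝ)) x ∂μ
          = a * K.card := by
        rw [integral_finsetSum _ fun k _ => (integrable_const _).indicator (hm k)]
        have : ∀ k ∈ K, ∫ x, ((fun x : X => k • x) ⁻¹' A').indicator (fun _ => (1 : ℝ)) x ∂μ
            = a := by
          intro k _
          rw [integral_indicator_const _ (hm k), ha, Measure.real, measure_preimage_smul]
          simp
        rw [Finset.sum_congr rfl this]
        simp [mul_comm]
      obtain ⟨x, hx⟩ := exists_integral_le (μ := μ) (f := fun x => ∑ k ∈ K,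
        ((fun x : X => k • x) ⁻¹' A').indicator (fun _ => (1 : ℝ)) x)
        (integrable_finsetSum _ fun k _ => (integrable_const _).indicator (hm k))
      refine ⟨x, ?_⟩
      rw [h1] at hx
      refine hx.trans (le_of_eq ?_)
      rw [Finset.card_filter]
      push_cast
      exact Finset.sum_congr rfl fun k _ => by simp [Set.indicator_apply]
    set Q' := K.filter fun k => k • x ∈ A' with hQ'
    have hQ'ne : Q'.Nonempty := by
      rw [← Finset.card_pos]
      have : (0 : ℝ) < K.card := by exact_mod_cast hK.card_pos
      have : (0 : ℝ) < Q'.card := lt_of_lt_of_le (by positivity) hx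
      exact_mod_cast this
    obtain ⟨i, hi⟩ := hQ Q'
    obtain ⟨N, hN⟩ : ∃ N, ∀ n ≥ N, ∀ s ∈ S, ∀ q ∈ Q', s • q • x ∈ A n → s • q • x ∈ A' := by
      have h1 : ∀ y : X, ∃ N, ∀ n ≥ N, y ∈ A n → y ∈ A' := by
        intro y
        by_cases hy : y ∈ A'
        · exact ⟨0, fun _ _ _ => hy⟩
        · obtain ⟨N, hN⟩ := by simpa [A'] using hy
          exact ⟨N, fun n hn h => absurd (hanti hn h) hN⟩
      choose f hf using h1
      refine ⟨S.sup fun s => Q'.sup fun q => f (s • q • x), fun n hn s hs q hq => hf _ _ ?_⟩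
      refine le_trans ?_ hn
      exact le_trans (Finset.le_sup (f := fun q => f (s • q • x)) hq)
        (Finset.le_sup (f := fun s => Q'.sup fun q => f (s • q • x)) hs)
    obtain ⟨n, hn, hpn, hxn⟩ := hgr i x N
    have hxC : x ∈ C i (A n) := by
      refine ⟨Set.mem_iInter₂.2 fun q hq => ?_, ?_⟩
      · rw [hi] at hq
        exact Set.mem_iInter.1 (Finset.mem_filter.1 hq).2 n
      · set F := (Q i).filter fun q => x ∈ tileBoundary S (Q i) (A n) q with hF
        have hsub : F ⊆ S.biUnion fun s => ((S * K) \ K).image fun g => s⁻¹ * g := by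
          intro q hq
          rw [hF, hi, Finset.mem_filter] at hq
          obtain ⟨hq1, s, hs, h2, h3⟩ := hq
          have h4 := hN n hn s hs q hq1 h2
          have hqK := (Finset.mem_filter.1 hq1).1
          refine Finset.mem_biUnion.2 ⟨s, hs, Finset.mem_image.2 ⟨s * q, ?_, by simp⟩⟩
          refine Finset.mem_sdiff.2 ⟨Finset.mul_mem_mul hs hqK, fun h5 => h3 ?_⟩
          exact Finset.mem_filter.2 ⟨h5, by rwa [mul_smul]⟩
        have h1 : F.card ≤ S.card * ((S * K) \ K).card := by
          refine (Finset.card_le_card hsub).trans (Finset.card_biUnion_le.trans ?_)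
          calc _ ≤ ∑ s ∈ S, ((S * K) \ K).card := Finset.sum_le_sum fun s _ => Finset.card_image_le
            _ = _ := by simp
        have h2 : (F.card : ℝ) ≤ ε * (Q i).card := by
          rw [hi]
          have h3 : (F.card : ℝ) ≤ S.card * ((S * K) \ K).card := by
            exact_mod_cast h1
          have h4 : (S.card : ℝ) * (ε * a / (S.card + 1) * K.card) ≤ ε * (a * K.card) := by
            have : (S.card : ℝ) * (ε * a / (S.card + 1) * K.card)
                = (ε * (a * K.card)) * (S.card / (S.card + 1)) := by
              field_simp
            rw [this]
            refine mul_le_of_le_one_right (by positivity) ?_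
            rw [div_le_one (by positivity)]
            linarith
          calc _ ≤ (S.card : ℝ) * (ε * a / (S.card + 1) * K.card) := h3.trans (by gcongr)
            _ ≤ _ := h4
            _ ≤ _ := by gcongr
        have h3 := ENNReal.ofReal_le_ofReal h2
        rw [ENNReal.ofReal_mul hε.le, ENNReal.ofReal_natCast, ENNReal.ofReal_natCast] at h3
        refine le_trans (le_of_eq ?_) h3
        rw [hF, Finset.card_filter]
        push_cast
        exact Finset.sum_congr rfl fun q _ => by simp [Set.indicator_apply]
    have hxR := hxn hxC
    obtain ⟨q, hq⟩ := hQ'ne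
    have h1 : q • x ∈ A (n + 1) := Set.mem_iInter.1 (Finset.mem_filter.1 hq).2 _
    rw [hAs] at h1
    exact h1.2 (mem_tiles.2 ⟨q, by rw [hpn, hi]; exact hq, x, hxR, rfl⟩)

omit [Countable G] [StandardBorelSpace X] in
lemma measure_boundary_le (hfree : ∀ (g : G) (x : X), g • x = x → g = 1) (μ : Measure X)
    [SMulInvariantMeasure G X μ] {S Q : Finset G} {A R : Set X} (hA : MeasurableSet A)
    (hR : MeasurableSet R)
    (hRd : ∀ x ∈ R, ∀ y ∈ R, ∀ q ∈ Q, ∀ q' ∈ Q, q • x = q' • y → x = y) {c : ℝ≥0∞}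
    (hc : ∀ x ∈ R, ∑ q ∈ Q, (tileBoundary S Q A q).indicator (1 : X → ℝ≥0∞) x ≤ c * Q.card) :
    μ (⋃ q ∈ Q, (fun x => q • x) '' (R ∩ tileBoundary S Q A q)) ≤ c * μ (tiles Q R) := by
  have hm := measurableSet_tileBoundary (X := X) S Q hA
  rw [measure_tiles hfree μ hR hRd]
  calc μ (⋃ q ∈ Q, (fun x => q • x) '' (R ∩ tileBoundary S Q A q))
      ≤ ∑ q ∈ Q, μ ((fun x => q • x) '' (R ∩ tileBoundary S Q A q)) :=
        measure_biUnion_finset_le _ _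
    _ = ∑ q ∈ Q, μ (R ∩ tileBoundary S Q A q) :=
        Finset.sum_congr rfl fun q _ => measure_smul q _ (μ := μ)
    _ = ∑ q ∈ Q, ∫⁻ x in R, (tileBoundary S Q A q).indicator 1 x ∂μ := by
        refine Finset.sum_congr rfl fun q _ => ?_
        rw [lintegral_indicator_one (hm q), Measure.restrict_apply (hm q), Set.inter_comm]
    _ = ∫⁻ x in R, ∑ q ∈ Q, (tileBoundary S Q A q).indicator 1 x ∂μ :=
        (lintegral_finsetSum _ fun q _ => measurable_one.indicator (hm q)).symm
    _ ≤ ∫⁻ x in R, c * (Q.card : ℝ≥0∞) ∂μ := setLIntegral_mono measurable_const hc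
    _ = _ := by simp [mul_assoc]

set_option maxHeartbeats 1000000 in
open Pointwise in
/-- In a group with Følner sets the orbit relation is well approximated by finite
subrelations. -/
lemma exists_finite_subrelation [DecidableEq G]
    (hfree : ∀ (g : G) (x : X), g • x = x → g = 1) (μ : Measure X)
    [SMulInvariantMeasure G X μ] [IsProbabilityMeasure μ]
    (hF : ∀ (S : Finset G) (ε : ℝ), 0 < ε → ∃ K : Finset G, K.Nonempty ∧
      (((S * K) \ K).card : ℝ) ≤ ε * K.card)
    (S : Finset G) (hS : ∀ s ∈ S, s⁻¹ ∈ S) {ε : ℝ} (hε : 0 < ε) :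
    ∃ R : Set (X × X), MeasurableSet R ∧ (∀ x, (x, x) ∈ R) ∧
      (∀ x y, (x, y) ∈ R → (y, x) ∈ R) ∧ (∀ x y z, (x, y) ∈ R → (y, z) ∈ R → (x, z) ∈ R) ∧
      (∀ x, {y | (x, y) ∈ R}.Finite) ∧ R ⊆ orbitRel' G X ∧
      μ {x | ∃ s ∈ S, (x, s • x) ∉ R} ≤ ENNReal.ofReal ((1 + S.card) * ε) := by
  classical
  obtain ⟨Q, A, R, hA0, hA, hR, hAs, hRC, hRd, hinf⟩ := exists_tiling hfree μ hF S hε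
  have hanti := greedy_antitone hAs
  have htA : ∀ n, tiles (Q n) (R n) ⊆ A n := by
    intro n x hx
    obtain ⟨q, hq, r, hr, rfl⟩ := mem_tiles.1 hx
    exact (hRC n r hr).1 q hq
  -- stages are disjoint
  have hstage : ∀ n m x, x ∈ tiles (Q n) (R n) → x ∈ tiles (Q m) (R m) → n = m := by
    have : ∀ n m x, n < m → x ∈ tiles (Q n) (R n) → x ∉ tiles (Q m) (R m) := by
      intro n m x hnm h1 h2
      have h3 := hanti (show n + 1 ≤ m from hnm) (htA m h2)
      rw [hAs] at h3
      exact h3.2 h1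
    intro n m x h1 h2
    rcases lt_trichotomy n m with h | h | h
    · exact absurd h2 (this n m x h h1)
    · exact h
    · exact absurd h1 (this m n x h h2)
  -- the relation
  obtain ⟨E, hEm, hE⟩ : ∃ E : Set (X × X), MeasurableSet E ∧ ∀ x y, (x, y) ∈ E ↔ x = y ∨
      ∃ n, ∃ r ∈ R n, ∃ q ∈ Q n, ∃ q' ∈ Q n, q • r = x ∧ q' • r = y := by
    let E : Set (X × X) := {z | z.1 = z.2} ∪ ⋃ n, ⋃ q ∈ Q n, ⋃ q' ∈ Q n,
      {z | q⁻¹ • z.1 ∈ R n ∧ q'⁻¹ • z.2 = q⁻¹ • z.1}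
    refine ⟨E, ?_, fun x y => ?_⟩
    · refine (measurableSet_eq_fun measurable_fst measurable_snd).union ?_
      refine MeasurableSet.iUnion fun n => Finset.measurableSet_biUnion _ fun q _ =>
        Finset.measurableSet_biUnion _ fun q' _ => MeasurableSet.inter ?_ ?_
      · exact (measurable_const_smul q⁻¹).comp measurable_fst (hR n)
      · exact measurableSet_eq_fun ((measurable_const_smul q'⁻¹).comp measurable_snd)
          ((measurable_const_smul q⁻¹).comp measurable_fst)
    · simp only [E, Set.mem_union, Set.mem_ofPred_eq, Set.mem_iUnion]
      refine or_congr Iff.rfl (exists_congr fun n => ?_)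
      constructor
      · rintro ⟨q, hq, q', hq', h1, h2⟩
        exact ⟨_, h1, q, hq, q', hq', by simp, by rw [← h2]; simp⟩
      · rintro ⟨r, hr, q, hq, q', hq', rfl, rfl⟩
        exact ⟨q, hq, q', hq', by simpa using hr, by simp⟩
  have hroot : ∀ n m r r' q q', r ∈ R n → r' ∈ R m → q ∈ Q n → q' ∈ Q m →
      q • r = q' • r' → n = m ∧ r = r' := by
    intro n m r r' q q' hr hr' hq hq' h
    have hnm := hstage n m (q • r) (mem_tiles.2 ⟨q, hq, r, hr, rfl⟩)
      (mem_tiles.2 ⟨q', hq', r', hr', h.symm⟩)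
    subst hnm
    exact ⟨rfl, hRd n r hr r' hr' q hq q' hq' h⟩
  refine ⟨E, hEm, fun x => (hE x x).2 (Or.inl rfl), ?_, ?_, ?_, ?_, ?_⟩
  · intro x y h
    rw [hE] at h ⊢
    rcases h with h | ⟨n, r, hr, q, hq, q', hq', h1, h2⟩
    · exact Or.inl h.symm
    · exact Or.inr ⟨n, r, hr, q', hq', q, hq, h2, h1⟩
  · intro x y z h h'
    rw [hE] at h h' ⊢
    rcases h with rfl | ⟨n, r, hr, q, hq, q', hq', h1, h2⟩
    · exact h'
    rcases h' with rfl | ⟨m, r', hr', q₁, hq₁, q₂, hq₂, h3, h4⟩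
    · exact Or.inr ⟨n, r, hr, q, hq, q', hq', h1, h2⟩
    obtain ⟨rfl, rfl⟩ := hroot _ _ _ _ _ _ hr hr' hq' hq₁ (h2.trans h3.symm)
    exact Or.inr ⟨n, r, hr, q, hq, q₂, hq₂, h1, h4⟩
  · intro x
    by_cases hx : ∃ n, ∃ r ∈ R n, ∃ q ∈ Q n, q • r = x
    · obtain ⟨n, r, hr, q, hq, h1⟩ := hx
      refine ((Set.finite_singleton x).union
        ((Q n).finite_toSet.image fun q => q • r)).subset ?_
      intro y hy
      rcases (hE x y).1 hy with rfl | ⟨m, r', hr', q₁, hq₁, q₂, hq₂, h3, h4⟩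
      · exact Or.inl rfl
      · obtain ⟨rfl, rfl⟩ := hroot _ _ _ _ _ _ hr hr' hq hq₁ (h1.trans h3.symm)
        exact Or.inr ⟨q₂, hq₂, h4⟩
    · refine (Set.finite_singleton x).subset ?_
      intro y hy
      rcases (hE x y).1 hy with rfl | ⟨m, r', hr', q₁, hq₁, q₂, hq₂, h3, h4⟩
      · rfl
      · exact absurd ⟨m, r', hr', q₁, hq₁, h3⟩ hx
  · rintro ⟨x, y⟩ h
    rcases (hE x y).1 h with rfl | ⟨m, r', hr', q₁, hq₁, q₂, hq₂, h3, h4⟩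
    · exact ⟨1, one_smul _ _⟩
    · exact ⟨q₂ * q₁⁻¹, by rw [← h3, ← h4]; simp [mul_smul]⟩
  · -- the boundary is small
    let b : ℕ → Set X := fun n =>
      ⋃ q ∈ Q n, (fun x => q • x) '' (R n ∩ tileBoundary S (Q n) (A n) q)
    have hb : ∀ n, μ (b n) ≤ ENNReal.ofReal ε * μ (tiles (Q n) (R n)) := fun n =>
      measure_boundary_le hfree μ (hA n) (hR n) (hRd n) fun x hx => (hRC n x hx).2
    have hbU : μ (⋃ n, b n) ≤ ENNReal.ofReal ε := by
      calc μ (⋃ n, b n) ≤ ∑' n, μ (b n) := measure_iUnion_le _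
        _ ≤ ∑' n, ENNReal.ofReal ε * μ (tiles (Q n) (R n)) := ENNReal.tsum_le_tsum hb
        _ = ENNReal.ofReal ε * μ (⋃ n, tiles (Q n) (R n)) := by
            rw [ENNReal.tsum_mul_left, measure_iUnion _ fun n => measurableSet_tiles _ (hR n)]
            intro n m hnm
            exact Set.disjoint_left.2 fun x h1 h2 => hnm (hstage n m x h1 h2)
        _ ≤ ENNReal.ofReal ε * 1 := by gcongr; exact prob_le_one
        _ = _ := mul_one _
    set B := (⋂ n, A n) ∪ ⋃ n, b n with hB
    have hBm : μ B ≤ ENNReal.ofReal ε := by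
      refine (measure_union_le _ _).trans ?_
      rw [hinf, zero_add]
      exact hbU
    have htile : ∀ x, x ∉ ⋂ n, A n → ∃ n, x ∈ tiles (Q n) (R n) := fun x hx => by
      obtain ⟨n, -, hn⟩ := exists_mem_removed hAs (by rw [hA0]; trivial) hx
      exact ⟨n, hn⟩
    have hmain : ∀ (x : X) (s : G), s ∈ S → ∀ n m, n ≤ m → x ∈ tiles (Q n) (R n) →
        s • x ∈ tiles (Q m) (R m) → (x, s • x) ∈ E ∨ x ∈ B := by
      intro x s hs n m hnm hx hsx
      obtain ⟨q, hq, r, hr, rfl⟩ := mem_tiles.1 hx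
      by_cases hsq : s * q ∈ Q n
      · exact Or.inl ((hE _ _).2 (Or.inr ⟨n, r, hr, q, hq, s * q, hsq, rfl, mul_smul _ _ _⟩))
      · refine Or.inr (Or.inr (Set.mem_iUnion.2 ⟨n, Set.mem_iUnion₂.2 ⟨q, hq, r, ⟨hr, ?_⟩, rfl⟩⟩))
        exact ⟨s, hs, hanti hnm (htA m hsx), hsq⟩
    have hsub : {x | ∃ s ∈ S, (x, s • x) ∉ E} ⊆ B ∪ ⋃ s ∈ S, (fun x => s • x) ⁻¹' B := by
      rintro x ⟨s, hs, hx⟩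
      by_contra hcon
      have h1 : x ∉ B := fun h => hcon (Or.inl h)
      have h2 : s • x ∉ B := fun h => hcon (Or.inr (Set.mem_iUnion₂.2 ⟨s, hs, h⟩))
      obtain ⟨n, hn⟩ := htile x fun h => h1 (Or.inl h)
      obtain ⟨m, hm⟩ := htile (s • x) fun h => h2 (Or.inl h)
      rcases le_total n m with h | h
      · rcases hmain x s hs n m h hn hm with h3 | h3
        · exact hx h3
        · exact h1 h3
      · rcases hmain (s • x) s⁻¹ (hS s hs) m n h hm (by simpa using hn) with h3 | h3
        · rw [inv_smul_smul] at h3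
          rcases (hE _ _).1 h3 with h4 | ⟨m, r', hr', q₁, hq₁, q₂, hq₂, h3, h4⟩
          · exact hx ((hE _ _).2 (Or.inl h4.symm))
          · exact hx ((hE _ _).2 (Or.inr ⟨m, r', hr', q₂, hq₂, q₁, hq₁, h4, h3⟩))
        · exact h2 h3
    refine (measure_mono hsub).trans ((measure_union_le _ _).trans ?_)
    have h1 : μ (⋃ s ∈ S, (fun x => s • x) ⁻¹' B) ≤ S.card * ENNReal.ofReal ε := by
      refine (measure_biUnion_finset_le _ _).trans ?_
      calc _ = ∑ s ∈ S, μ B := Finset.sum_congr rfl fun s _ => measure_preimage_smul μ s B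
        _ = S.card * μ B := by simp
        _ ≤ _ := by gcongr
    rw [ENNReal.ofReal_mul (by positivity), ENNReal.ofReal_add (by norm_num) (by positivity),
      add_mul]
    simpa using add_le_add hBm h1

end Hyperfinite

section Hyperfinite

variable {G X : Type*} [Group G] [Countable G] [MeasurableSpace X] [StandardBorelSpace X]
  [MulAction G X] [MeasurableConstSMul G X]

open Pointwise in
/-- Free actions of amenable groups have hyperfinite orbit relations almost everywhere. -/
theorem muHyperfinite_of_folner [DecidableEq G]
    (hfree : ∀ (g : G) (x : X), g • x = x → g = 1) (μ : Measure X)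
    [SMulInvariantMeasure G X μ] [IsProbabilityMeasure μ]
    (hF : ∀ (S : Finset G) (ε : ℝ), 0 < ε → ∃ K : Finset G, K.Nonempty ∧
      (((S * K) \ K).card : ℝ) ≤ ε * K.card) : MuHyperfinite G μ := by
  obtain ⟨f, hf⟩ := exists_surjective_nat G
  let S : ℕ → Finset G := fun n => (Finset.range n).image f ∪ ((Finset.range n).image f)⁻¹
  have hS : ∀ n, ∀ s ∈ S n, s⁻¹ ∈ S n := by
    intro n s hs
    rw [Finset.mem_union, Finset.mem_inv'] at hs ⊢
    rw [inv_inv]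
    exact hs.symm
  have hSmem : ∀ s, ∃ N, ∀ n ≥ N, s ∈ S n := by
    intro s
    obtain ⟨k, rfl⟩ := hf s
    exact ⟨k + 1, fun n hn => Finset.mem_union_left _
      (Finset.mem_image_of_mem f (Finset.mem_range.2 (by omega)))⟩
  choose E hEm hErefl hEsymm hEtrans hEfin hEsub hEbd using fun n =>
    exists_finite_subrelation hfree μ hF (S n) (hS n) (ε := (1 / 2) ^ n / (1 + (S n).card))
      (by positivity)
  have hbd : ∀ n, μ {x | ∃ s ∈ S n, (x, s • x) ∉ E n} ≤ ENNReal.ofReal ((1 / 2) ^ n) := by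
    intro n
    refine (hEbd n).trans (le_of_eq ?_)
    congr 1
    field_simp
  have hsum : ∑' n, μ {x | ∃ s ∈ S n, (x, s • x) ∉ E n} ≠ ∞ := by
    refine ne_top_of_le_ne_top ?_ (ENNReal.tsum_le_tsum hbd)
    rw [← ENNReal.ofReal_tsum_of_nonneg (fun n => by positivity) summable_geometric_two]
    exact ENNReal.ofReal_ne_top
  have hBC := ae_eventually_notMem hsum
  have hev : ∀ᵐ x ∂μ, ∀ g : G, ∀ᶠ n in Filter.atTop,
      g • x ∉ {x | ∃ s ∈ S n, (x, s • x) ∉ E n} := by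
    rw [ae_all_iff]
    intro g
    exact (measurePreserving_smul g μ).quasiMeasurePreserving.ae hBC
  let Y : Set X := {x | ∀ g k : G, ∃ N, ∀ m ≥ N, (g • x, k • x) ∈ E m}
  have hYm : MeasurableSet Y := by
    have : Y = ⋂ g : G, ⋂ k : G, ⋃ N : ℕ, ⋂ m ≥ N,
        (fun x : X => (g • x, k • x)) ⁻¹' E m := by
      ext x; simp [Y]
    rw [this]
    refine MeasurableSet.iInter fun g => MeasurableSet.iInter fun k => MeasurableSet.iUnion fun N =>
      MeasurableSet.iInter fun m => MeasurableSet.iInter fun _ => ?_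
    exact ((measurable_const_smul g).prodMk (measurable_const_smul k)) (hEm m)
  refine ⟨Y, hYm, ?_, ?_, fun n => {z | ∀ m ≥ n, z ∈ E m} ∩ Y ×ˢ Y, ?_, ?_, ?_⟩
  · change ∀ᵐ x ∂μ, x ∈ Y
    filter_upwards [hev] with x hx g k
    obtain ⟨N₁, h1⟩ := Filter.eventually_atTop.1 (hx g)
    obtain ⟨N₂, h2⟩ := hSmem (k * g⁻¹)
    refine ⟨max N₁ N₂, fun m hm => ?_⟩
    by_contra hcon
    refine h1 m (le_trans (le_max_left _ _) hm)
      ⟨k * g⁻¹, h2 m (le_trans (le_max_right _ _) hm), ?_⟩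
    simpa [mul_smul] using hcon
  · intro h
    ext x
    constructor
    · intro hx g k
      simpa [mul_smul] using hx (g * h⁻¹) (k * h⁻¹)
    · intro hx g k
      simpa [mul_smul] using hx (g * h) (k * h)
  · intro n m hnm z hz
    exact ⟨fun k hk => hz.1 k (le_trans hnm hk), hz.2⟩
  · intro n
    refine ⟨?_, fun x hx => ⟨fun m _ => hErefl m x, hx, hx⟩, fun x y h => ⟨fun m hm =>
      hEsymm m _ _ (h.1 m hm), h.2.2, h.2.1⟩, fun x y z h h' => ⟨fun m hm =>
      hEtrans m _ _ _ (h.1 m hm) (h'.1 m hm), h.2.1, h'.2.2⟩, Set.inter_subset_right, fun x =>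
      (hEfin n x).subset fun y hy => hy.1 n le_rfl⟩
    refine MeasurableSet.inter ?_ (hYm.prod hYm)
    have : {z : X × X | ∀ m ≥ n, z ∈ E m} = ⋂ m ≥ n, E m := by ext; simp
    rw [this]
    exact MeasurableSet.iInter fun m => MeasurableSet.iInter fun _ => hEm m
  · ext ⟨x, y⟩
    constructor
    · intro h
      obtain ⟨n, hn⟩ := Set.mem_iUnion.1 h
      exact ⟨hEsub n (hn.1 n le_rfl), hn.2⟩
    · rintro ⟨⟨g, rfl : g • x = y⟩, hxy⟩
      obtain ⟨N, hN⟩ := hxy.1 1 g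
      rw [one_smul] at hN
      exact Set.mem_iUnion.2 ⟨N, hN, hxy⟩

end Hyperfinite

section FreeOn

variable (G : Type*) {X : Type*} [Group G] [MeasurableSpace X] [MulAction G X]

/-- `T` is an action of the free group by elements of the full group, supported on `A` and free
there. -/
structure FreeOn (A : Set X) (T : FreeGroup (Fin 2) → X → X) : Prop where
  map_one : T 1 = id
  map_mul : ∀ w w', T (w * w') = T w ∘ T w'
  measurable : ∀ w, Measurable (T w)
  orbit : ∀ w x, ∃ g : G, T w x = g • x
  fix : ∀ w, ∀ x ∉ A, T w x = x
  free : ∀ x ∈ A, ∀ w, w ≠ 1 → T w x ≠ x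

variable {G}

lemma FreeOn.inv_apply {A : Set X} {T : FreeGroup (Fin 2) → X → X} (h : FreeOn G A T)
    (w : FreeGroup (Fin 2)) (x : X) : T w⁻¹ (T w x) = x := by
  have := congrFun (h.map_mul w⁻¹ w) x
  rw [inv_mul_cancel, h.map_one] at this
  exact this.symm

lemma FreeOn.mem {A : Set X} {T : FreeGroup (Fin 2) → X → X} (h : FreeOn G A T)
    (w : FreeGroup (Fin 2)) {x : X} (hx : x ∈ A) : T w x ∈ A := by
  by_contra hn
  have := h.fix w⁻¹ _ hn
  rw [h.inv_apply] at this
  exact hn (this ▸ hx)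

variable [Countable G] [StandardBorelSpace X] [MeasurableConstSMul G X]

lemma FreeOn.measurePreserving (hfree : ∀ (g : G) (x : X), g • x = x → g = 1) (μ : Measure X)
    [SMulInvariantMeasure G X μ] {A : Set X} {T : FreeGroup (Fin 2) → X → X} (h : FreeOn G A T)
    (w : FreeGroup (Fin 2)) : MeasurePreserving (T w) μ μ := by
  let σ : Equiv.Perm X := ⟨T w, T w⁻¹, h.inv_apply w, fun x => by
    simpa using h.inv_apply w⁻¹ x⟩
  exact measurePreserving_of_mem_fullGroup (G := G) μ hfree (σ := σ)
    (mem_fullGroup_of_measurable (h.orbit w) (h.measurable w))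

omit [StandardBorelSpace X] in
/-- Ergodicity allows one to move a set into any set of larger measure along orbits. -/
lemma exists_partial_transport (μ : Measure X) [IsProbabilityMeasure μ]
    [SMulInvariantMeasure G X μ]
    (herg : ∀ s : Set X, MeasurableSet s → (∀ g : G, (fun x : X => g • x) ⁻¹' s = s) →
      μ s = 0 ∨ μ s = 1)
    {A D : Set X} (hA : MeasurableSet A) (hD : MeasurableSet D) (hAD : μ A ≤ μ D) :
    ∃ (A' : Set X) (φ ψ : X → X), MeasurableSet A' ∧ A' ⊆ A ∧ μ (A \ A') = 0 ∧ Measurable φ ∧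
      Measurable ψ ∧ (∀ x ∈ A', (∃ g : G, φ x = g • x) ∧ φ x ∈ D ∧ ψ (φ x) = x) := by
  obtain ⟨f, hf⟩ := exists_surjective_nat G
  let st : ℕ → Set X × Set X → Set X × Set X := fun n p =>
    (p.1 \ (fun x => f n • x) ⁻¹' p.2, p.2 \ (fun x => f n • x) '' p.1)
  let u : ℕ → Set X × Set X := fun n => Nat.rec (A, D) st n
  have hu : ∀ n, u (n + 1) = st n (u n) := fun n => rfl
  have hum : ∀ n, MeasurableSet (u n).1 ∧ MeasurableSet (u n).2 := by
    intro n
    induction n with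
    | zero => exact ⟨hA, hD⟩
    | succ n ih =>
      rw [hu]
      exact ⟨ih.1.diff (measurable_const_smul (f n) ih.2),
        ih.2.diff (measurableSet_smul_image _ ih.1)⟩
  let P : ℕ → Set X := fun n => (u n).1 ∩ (fun x => f n • x) ⁻¹' (u n).2
  have hPm : ∀ n, MeasurableSet (P n) := fun n =>
    (hum n).1.inter (measurable_const_smul (f n) (hum n).2)
  have h1 : ∀ n, (u (n + 1)).1 = (u n).1 \ P n := by
    intro n
    rw [hu]
    ext x
    simp only [st, P, Set.mem_sdiff, Set.mem_inter_iff]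
    tauto
  have h2 : ∀ n, (u (n + 1)).2 = (u n).2 \ (fun x => f n • x) '' P n := by
    intro n
    rw [hu]
    ext y
    simp only [st, P, Set.mem_sdiff, Set.mem_image, Set.mem_inter_iff, Set.mem_preimage]
    constructor
    · rintro ⟨ha, hb⟩
      exact ⟨ha, fun ⟨x, hx, e⟩ => hb ⟨x, hx.1, e⟩⟩
    · rintro ⟨ha, hb⟩
      exact ⟨ha, fun ⟨x, hx, e⟩ => hb ⟨x, ⟨hx, by rw [e]; exact ha⟩, e⟩⟩
  have ha1 : ∀ {n m}, n ≤ m → (u m).1 ⊆ (u n).1 := @(greedy_antitone (A := fun n => (u n).1) h1)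
  have ha2 : ∀ {n m}, n ≤ m → (u m).2 ⊆ (u n).2 := @(greedy_antitone (A := fun n => (u n).2) h2)
  have hPdisj : ∀ n m, n < m → Disjoint (P n) (P m) := by
    intro n m hnm
    refine Set.disjoint_left.2 fun x hx hx' => ?_
    have := ha1 (show n + 1 ≤ m from hnm) hx'.1
    rw [h1] at this
    exact this.2 hx
  have hPdisj' : Pairwise (Function.onFun Disjoint P) := fun n m hnm => by
    rcases lt_or_gt_of_ne hnm with h | h
    · exact hPdisj n m h
    · exact (hPdisj m n h).symm
  have hQdisj : ∀ n m, n < m →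
      Disjoint ((fun x => f n • x) '' P n) ((fun x => f m • x) '' P m) := by
    intro n m hnm
    refine Set.disjoint_left.2 fun y hy hy' => ?_
    obtain ⟨x, hx, rfl⟩ := hy'
    have := ha2 (show n + 1 ≤ m from hnm) hx.2
    rw [h2] at this
    exact this.2 hy
  have hQdisj' : Pairwise (Function.onFun Disjoint fun n => (fun x => f n • x) '' P n) :=
    fun n m hnm => by
      rcases lt_or_gt_of_ne hnm with h | h
      · exact hQdisj n m h
      · exact (hQdisj m n h).symm
  have hPA : ∀ n, P n ⊆ A := fun n x hx => ha1 (Nat.zero_le n) hx.1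
  have hQD : ∀ n, (fun x => f n • x) '' P n ⊆ D := by
    rintro n _ ⟨x, hx, rfl⟩
    exact ha2 (Nat.zero_le n) hx.2
  obtain ⟨φ, hφm, hφ⟩ := exists_measurable_piecewise P hPm (fun n x => f n • x)
    (fun n => measurable_const_smul (f n)) (fun n m hnm x hx =>
      absurd hx.2 (Set.disjoint_left.1 (hPdisj' hnm) hx.1))
  obtain ⟨ψ, hψm, hψ⟩ := exists_measurable_piecewise (fun n => (fun x => f n • x) '' P n)
    (fun n => measurableSet_smul_image _ (hPm n)) (fun n x => (f n)⁻¹ • x)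
    (fun n => measurable_const_smul (f n)⁻¹) (fun n m hnm x hx =>
      absurd hx.2 (Set.disjoint_left.1 (hQdisj' hnm) hx.1))
  refine ⟨⋃ n, P n, φ, ψ, MeasurableSet.iUnion hPm, Set.iUnion_subset hPA, ?_, hφm, hψm, ?_⟩
  · set A' := ⋂ n, (u n).1 with hA'
    set D' := ⋂ n, (u n).2 with hD'
    have hA'm : MeasurableSet A' := MeasurableSet.iInter fun n => (hum n).1
    have hsub : A \ ⋃ n, P n ⊆ A' := by
      rintro x ⟨hx, hx'⟩
      by_contra hcon
      obtain ⟨n, -, hn⟩ := exists_mem_removed (A := fun n => (u n).1) h1 (x := x) hx hcon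
      exact hx' (Set.mem_iUnion.2 ⟨n, hn⟩)
    refine measure_mono_null hsub ?_
    by_contra hpos
    have hsat : μ (⋃ g : G, (fun x => g • x) ⁻¹' A') = 1 := by
      refine (herg _ (MeasurableSet.iUnion fun g => measurable_const_smul g hA'm)
        fun h => ?_).resolve_left ?_
      · ext x
        simp only [Set.mem_preimage, Set.mem_iUnion]
        constructor
        · rintro ⟨g, hg⟩
          exact ⟨g * h, by rwa [mul_smul]⟩
        · rintro ⟨g, hg⟩
          exact ⟨g * h⁻¹, by simpa [mul_smul] using hg⟩
      · intro h0
        refine hpos (measure_mono_null ?_ h0)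
        intro x hx
        exact Set.mem_iUnion.2 ⟨1, by simpa using hx⟩
    have hD'0 : μ D' = 0 := by
      have h3 : μ (⋃ g : G, (fun x => g • x) ⁻¹' A')ᶜ = 0 :=
        (prob_compl_eq_zero_iff (MeasurableSet.iUnion fun g => measurable_const_smul g hA'm)).2 hsat
      refine measure_mono_null ?_ h3
      intro y hy hy'
      obtain ⟨g, hg⟩ := Set.mem_iUnion.1 hy'
      obtain ⟨n, hn⟩ := hf g⁻¹
      have hx1 : g • y ∈ (u n).1 := Set.mem_iInter.1 hg n
      have hx2 : g • y ∈ P n := ⟨hx1, by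
        have := Set.mem_iInter.1 hy n
        simpa [hn] using this⟩
      have hx3 : g • y ∈ (u (n + 1)).1 := Set.mem_iInter.1 hg (n + 1)
      rw [h1] at hx3
      exact hx3.2 hx2
    have e1 : μ (⋃ n, P n) = ∑' n, μ (P n) := measure_iUnion hPdisj' hPm
    have e2 : μ (⋃ n, (fun x => f n • x) '' P n) = ∑' n, μ (P n) := by
      rw [measure_iUnion hQdisj' fun n => measurableSet_smul_image _ (hPm n)]
      exact tsum_congr fun n => measure_smul (f n) (P n) (μ := μ)
    have e3 : μ D ≤ ∑' n, μ (P n) := by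
      rw [← e2]
      have : D ⊆ (⋃ n, (fun x => f n • x) '' P n) ∪ D' := by
        intro y hy
        by_cases hy' : y ∈ D'
        · exact Or.inr hy'
        · obtain ⟨n, -, hn⟩ := exists_mem_removed (A := fun n => (u n).2) h2 (x := y) hy hy'
          exact Or.inl (Set.mem_iUnion.2 ⟨n, hn⟩)
      refine (measure_mono this).trans ((measure_union_le _ _).trans ?_)
      rw [hD'0, add_zero]
    have e4 : μ (⋃ n, P n) + μ A' ≤ μ A := by
      rw [← measure_union _ hA'm]
      · exact measure_mono (Set.union_subset (Set.iUnion_subset hPA) (Set.iInter_subset _ 0))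
      · refine Set.disjoint_left.2 fun x hx hx' => ?_
        obtain ⟨n, hn⟩ := Set.mem_iUnion.1 hx
        have hx3 := Set.mem_iInter.1 hx' (n + 1)
        rw [h1] at hx3
        exact hx3.2 hn
    have e5 : μ (⋃ n, P n) + μ A' ≤ μ (⋃ n, P n) + 0 := by
      rw [add_zero]
      exact e4.trans (hAD.trans (e3.trans e1.ge))
    exact hpos (le_antisymm ((ENNReal.add_le_add_iff_left (measure_ne_top _ _)).1 e5) zero_le)
  · intro x hx
    obtain ⟨n, hn⟩ := Set.mem_iUnion.1 hx
    have e : φ x = f n • x := hφ n hn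
    refine ⟨⟨f n, e⟩, ?_, ?_⟩
    · rw [e]
      exact hQD n ⟨x, hn, rfl⟩
    · rw [e]
      have := hψ n ⟨x, hn, rfl⟩
      simpa using this


lemma FreeOn.exists_transport (hfree : ∀ (g : G) (x : X), g • x = x → g = 1)
    (μ : Measure X) [IsProbabilityMeasure μ] [SMulInvariantMeasure G X μ]
    (herg : ∀ s : Set X, MeasurableSet s → (∀ g : G, (fun x : X => g • x) ⁻¹' s = s) →
      μ s = 0 ∨ μ s = 1)
    {A D : Set X} {T : FreeGroup (Fin 2) → X → X} (h : FreeOn G A T)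
    (hA : MeasurableSet A) (hD : MeasurableSet D) (hA0 : 0 < μ A) (hAD : μ A ≤ μ D) :
    ∃ (B : Set X) (S : FreeGroup (Fin 2) → X → X), MeasurableSet B ∧ B ⊆ D ∧ 0 < μ B ∧
      FreeOn G B S := by
  classical
  obtain ⟨A', φ, ψ, hA', hA'A, hAA', hφm, hψm, hφ⟩ :=
    exists_partial_transport (G := G) μ herg hA hD hAD
  have : Countable (FreeGroup (Fin 2)) := inferInstance
  set E : Set X := ⋂ w, T w ⁻¹' A' with hE
  have hEm : MeasurableSet E := MeasurableSet.iInter fun w => h.measurable w hA'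
  have hEA' : E ⊆ A' := fun x hx => by
    have := Set.mem_iInter.1 hx 1
    rwa [h.map_one] at this
  have hET : ∀ w, ∀ x ∈ E, T w x ∈ E := fun w x hx => by
    refine Set.mem_iInter.2 fun w' => ?_
    have := Set.mem_iInter.1 hx (w' * w)
    rwa [h.map_mul] at this
  have hE0 : 0 < μ E := by
    have h0 : μ (A \ E) = 0 := by
      refine measure_mono_null (t := ⋃ w, T w ⁻¹' (A \ A')) ?_ ?_
      · rintro x ⟨hx, hx'⟩
        simp only [hE, Set.mem_iInter, not_forall] at hx'
        obtain ⟨w, hw⟩ := hx'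
        exact Set.mem_iUnion.2 ⟨w, h.mem w hx, hw⟩
      · refine measure_iUnion_null fun w => ?_
        rw [(h.measurePreserving hfree μ w).measure_preimage (hA.diff hA').nullMeasurableSet, hAA']
    by_contra hn
    have hE00 : μ E = 0 := le_antisymm (not_lt.1 hn) zero_le
    refine hA0.ne' (measure_mono_null (t := (A \ E) ∪ E) ?_ (measure_union_null h0 hE00))
    intro x hx
    by_cases hxE : x ∈ E
    · exact Or.inr hxE
    · exact Or.inl ⟨hx, hxE⟩
  set B : Set X := {y | ψ y ∈ E ∧ φ (ψ y) = y} with hB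
  have hBm : MeasurableSet B :=
    (hψm hEm).inter (measurableSet_eq_of_measurable (hφm.comp hψm) measurable_id)
  have hφB : ∀ x ∈ E, φ x ∈ B := fun x hx => by
    have e := (hφ x (hEA' hx)).2.2
    exact ⟨by rw [e]; exact hx, by rw [e]⟩
  refine ⟨B, fun w y => if y ∈ B then φ (T w (ψ y)) else y, hBm, ?_, ?_, ?_⟩
  · intro y hy
    rw [← hy.2]
    exact (hφ _ (hEA' hy.1)).2.1
  · by_contra hn
    have hB0 : μ B = 0 := le_antisymm (not_lt.1 hn) zero_le
    refine hE0.ne' (measure_mono_null (t := ⋃ g : G, (fun x => g • x) ⁻¹' B) ?_ ?_)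
    · intro x hx
      obtain ⟨g, hg⟩ := (hφ x (hEA' hx)).1
      refine Set.mem_iUnion.2 ⟨g, ?_⟩
      simp only [Set.mem_preimage]
      rw [← hg]
      exact hφB x hx
    · refine measure_iUnion_null fun g => ?_
      rw [measure_preimage_smul μ g B, hB0]
  · constructor
    · funext y
      simp only [h.map_one, id]
      split_ifs with hy
      · exact hy.2
      · rfl
    · intro w w'
      funext y
      simp only [Function.comp]
      by_cases hy : y ∈ B
      · have h1 : T w' (ψ y) ∈ E := hET w' _ hy.1
        rw [if_pos hy, if_pos hy, if_pos (hφB _ h1), (hφ _ (hEA' h1)).2.2, h.map_mul]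
        rfl
      · simp [hy]
    · intro w
      exact Measurable.ite hBm (hφm.comp ((h.measurable w).comp hψm)) measurable_id
    · intro w y
      by_cases hy : y ∈ B
      · obtain ⟨g, hg⟩ := (hφ _ (hEA' hy.1)).1
        obtain ⟨k, hk⟩ := h.orbit w (ψ y)
        obtain ⟨l, hl⟩ := (hφ _ (hEA' (hET w _ hy.1))).1
        refine ⟨l * k * g⁻¹, ?_⟩
        rw [if_pos hy, hl, hk]
        rw [hy.2] at hg
        conv_rhs => rw [hg]
        simp [mul_smul]
      · exact ⟨1, by simp [hy]⟩
    · intro w y hy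
      simp [hy]
    · intro y hy w hw
      rw [if_pos hy]
      intro e
      have := congrArg ψ e
      rw [(hφ _ (hEA' (hET w _ hy.1))).2.2] at this
      exact h.free _ (hA'A (hEA' hy.1)) w hw this

/-- Free actions on sets of arbitrarily small positive measure patch together to a free action on
a conull set. -/
lemma exists_freeOn_conull (hfree : ∀ (g : G) (x : X), g • x = x → g = 1)
    (μ : Measure X) [IsProbabilityMeasure μ] [SMulInvariantMeasure G X μ]
    (herg : ∀ s : Set X, MeasurableSet s → (∀ g : G, (fun x : X => g • x) ⁻¹' s = s) →
      μ s = 0 ∨ μ s = 1)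
    (hsmall : ∀ ε : ℝ≥0∞, 0 < ε → ∃ (A : Set X) (T : FreeGroup (Fin 2) → X → X),
      MeasurableSet A ∧ 0 < μ A ∧ μ A ≤ ε ∧ FreeOn G A T) :
    ∃ (A : Set X) (T : FreeGroup (Fin 2) → X → X), MeasurableSet A ∧ μ Aᶜ = 0 ∧
      FreeOn G A T := by
  classical
  obtain ⟨F, hF⟩ := zorn_subset {F : Set (Set X) | (∀ A ∈ F, MeasurableSet A ∧ 0 < μ A ∧
      ∃ T : FreeGroup (Fin 2) → X → X, FreeOn G A T) ∧ F.PairwiseDisjoint id} (by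
    intro c hc hchain
    refine ⟨⋃₀ c, ⟨?_, ?_⟩, fun s hs => Set.subset_sUnion_of_mem hs⟩
    · rintro A ⟨s, hs, hA⟩
      exact (hc hs).1 A hA
    · exact (Set.pairwiseDisjoint_sUnion hchain.directedOn).2 fun s hs => (hc hs).2)
  obtain ⟨hF1, hF2⟩ := hF.prop
  have hdisj : Pairwise (Function.onFun Disjoint fun A : F => (A : Set X)) := by
    intro A B hAB
    exact hF2 A.2 B.2 (fun e => hAB (Subtype.ext e))
  have hcount : Countable F := by
    have := Measure.countable_meas_pos_of_disjoint_iUnion (μ := μ)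
      (As := fun A : F => (A : Set X)) (fun A => (hF1 _ A.2).1) hdisj
    rw [← Set.countable_univ_iff]
    refine this.mono fun A _ => (hF1 _ A.2).2.1
  set U : Set X := ⋃ A : F, (A : Set X) with hU
  have hUm : MeasurableSet U := MeasurableSet.iUnion fun A => (hF1 _ A.2).1
  have hU0 : μ Uᶜ = 0 := by
    by_contra hn
    obtain ⟨A, T, hA, hA0, hAU, hT⟩ := hsmall _ (pos_iff_ne_zero.2 hn)
    obtain ⟨B, S, hB, hBU, hB0, hS⟩ := hT.exists_transport hfree μ herg hA hUm.compl hA0 hAU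
    have hdisjB : ∀ A ∈ F, Disjoint B A := fun A hA => by
      refine Set.disjoint_left.2 fun x hx hx' => hBU hx ?_
      exact Set.mem_iUnion.2 ⟨⟨A, hA⟩, hx'⟩
    have hmem : insert B F ∈ {F : Set (Set X) | (∀ A ∈ F, MeasurableSet A ∧ 0 < μ A ∧
      ∃ T : FreeGroup (Fin 2) → X → X, FreeOn G A T) ∧ F.PairwiseDisjoint id} := by
      refine ⟨?_, ?_⟩
      · rintro A (rfl | hA)
        · exact ⟨hB, hB0, S, hS⟩
        · exact hF1 A hA
      · exact hF2.insert fun A hA _ => hdisjB A hA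
    have : B ∈ F := hF.le_of_ge hmem (Set.subset_insert _ _) (Set.mem_insert _ _)
    have h2 := hdisjB B this
    rw [disjoint_self] at h2
    rw [h2] at hB0
    simp at hB0
  choose S hS using fun A : F => (hF1 _ A.2).2.2
  have hmix : ∀ (w : FreeGroup (Fin 2)), ∃ f : X → X, Measurable f ∧
      (∀ A : F, ∀ x ∈ (A : Set X), f x = S A w x) ∧ ∀ x ∉ U, f x = x := by
    intro w
    obtain ⟨f, hf, hf'⟩ := exists_measurable_piecewise
      (fun o : Option F => o.elim Uᶜ fun A => (A : Set X))
      (by rintro (_ | A); exacts [hUm.compl, (hF1 _ A.2).1])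
      (fun o : Option F => o.elim id fun A => S A w)
      (by rintro (_ | A); exacts [measurable_id, (hS A).measurable w])
      (by
        rintro (_ | A) (_ | B) hne x ⟨hx, hx'⟩
        · exact absurd rfl hne
        · exact absurd (Set.mem_iUnion.2 ⟨B, hx'⟩) hx
        · exact absurd (Set.mem_iUnion.2 ⟨A, hx⟩) hx'
        · exact absurd hx' (Set.disjoint_left.1 (hdisj fun e => hne (by rw [e])) hx))
    exact ⟨f, hf, fun A x hx => hf' (some A) hx, fun x hx => hf' none hx⟩
  choose T hTm hT1 hT2 using hmix
  refine ⟨U, T, hUm, hU0, ?_⟩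
  constructor
  · funext x
    by_cases hx : x ∈ U
    · obtain ⟨A, hA⟩ := Set.mem_iUnion.1 hx
      rw [hT1 1 A x hA, (hS A).map_one]
    · rw [hT2 1 x hx]
      rfl
  · intro w w'
    funext x
    simp only [Function.comp]
    by_cases hx : x ∈ U
    · obtain ⟨A, hA⟩ := Set.mem_iUnion.1 hx
      rw [hT1 _ A x hA, hT1 w' A x hA, hT1 w A _ ((hS A).mem w' hA), (hS A).map_mul]
      rfl
    · rw [hT2 _ x hx, hT2 w' x hx, hT2 w x hx]
  · exact hTm
  · intro w x
    by_cases hx : x ∈ U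
    · obtain ⟨A, hA⟩ := Set.mem_iUnion.1 hx
      rw [hT1 _ A x hA]
      exact (hS A).orbit w x
    · exact ⟨1, by rw [hT2 _ x hx, one_smul]⟩
  · intro w x hx
    exact hT2 w x hx
  · intro x hx w hw
    obtain ⟨A, hA⟩ := Set.mem_iUnion.1 hx
    rw [hT1 _ A x hA]
    exact (hS A).free x hA w hw

end FreeOn

section Rotation

variable {G X : Type*} [Group G] [Countable G] [MeasurableSpace X] [StandardBorelSpace X]
  [MulAction G X] [MeasurableConstSMul G X]

/-- A Borel equivalence relation with finite classes is generated by a Borel automorphism permuting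
each class cyclically. -/
lemma exists_rotation (hfree : ∀ (g : G) (x : X), g • x = x → g = 1) {W : Set X}
    (hW : MeasurableSet W) {τ : X → X} (hτ : Measurable τ) (Q : Finset G)
    (hQ : ∀ x ∈ W, ∀ y ∈ W, τ x = τ y → ∃ g ∈ Q, y = g • x) :
    ∃ t ∈ fullGroup G X, (∀ x ∉ W, t x = x) ∧ (∀ x ∈ W, t x ∈ W ∧ τ (t x) = τ x) ∧
      ∀ x ∈ W, ∀ k : ℕ, 0 < k → ∀ K : Finset X, (∀ y ∈ K, y ∈ W ∧ τ y = τ x) → k < K.card →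
        (t ^ k) x ≠ x := by
  classical
  have hinj : ∀ (x : X), Function.Injective fun g : G => g • x :=
    fun x g k h => smul_left_injective_of_free hfree h
  let e : X → ℝ := embeddingReal X
  have he : Measurable e := measurable_embeddingReal X
  have heinj : Function.Injective e := (measurableEmbedding_embeddingReal X).injective
  let cl : X → Finset X := fun x => (Q.image fun g => g • x).filter
    (fun y => y ∈ W ∧ τ y = τ x)
  let N : X → ℕ := fun x => (cl x).card
  let r : X → ℕ := fun x => ((cl x).filter fun y => e y < e x).card
  have hcl : ∀ x ∈ W, ∀ y, y ∈ cl x ↔ y ∈ W ∧ τ y = τ x := by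
    intro x hx y
    simp only [cl, Finset.mem_filter, Finset.mem_image, and_iff_right_iff_imp]
    rintro ⟨hy, h⟩
    obtain ⟨g, hg, e⟩ := hQ x hx y hy h.symm
    exact ⟨g, hg, e.symm⟩
  have hcleq : ∀ x ∈ W, ∀ y ∈ cl x, cl y = cl x := by
    intro x hx y hy
    have h := (hcl x hx y).1 hy
    ext z
    rw [hcl x hx, hcl y h.1, h.2]
  have hrN : ∀ x ∈ W, r x < N x := by
    intro x hx
    refine Finset.card_lt_card (Finset.filter_ssubset.2 ⟨x, (hcl x hx x).2 ⟨hx, rfl⟩, lt_irrefl _⟩)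
  have hrlt : ∀ x ∈ W, ∀ y ∈ cl x, ∀ z ∈ cl x, e y < e z → r y < r z := by
    intro x hx y hy z hz hyz
    refine Finset.card_lt_card ?_
    rw [hcleq x hx y hy, hcleq x hx z hz]
    refine (Finset.ssubset_iff_of_subset ?_).2 ⟨y, ?_, ?_⟩
    · intro w hw
      rw [Finset.mem_filter] at hw ⊢
      exact ⟨hw.1, hw.2.trans hyz⟩
    · exact Finset.mem_filter.2 ⟨hy, hyz⟩
    · simp
  have hrinj : ∀ x ∈ W, Set.InjOn r (cl x) := by
    intro x hx y hy z hz hyz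
    rcases lt_trichotomy (e y) (e z) with h | h | h
    · exact absurd hyz (hrlt x hx y hy z hz h).ne
    · exact heinj h
    · exact absurd hyz (hrlt x hx z hz y hy h).ne'
  have hex : ∀ x ∈ W, ∀ i < N x, ∃ y ∈ cl x, r y = i := by
    intro x hx i hi
    have himg : (cl x).image r = Finset.range (N x) := by
      refine Finset.eq_of_subset_of_card_le ?_ ?_
      · intro i hi
        obtain ⟨y, hy, rfl⟩ := Finset.mem_image.1 hi
        rw [Finset.mem_range]
        have := hrN y ((hcl x hx y).1 hy).1
        simpa only [N, hcleq x hx y hy] using this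
      · rw [Finset.card_range, Finset.card_image_of_injOn (hrinj x hx)]
    have : i ∈ (cl x).image r := by rw [himg]; exact Finset.mem_range.2 hi
    simpa using this
  have hNpos : ∀ x ∈ W, 0 < N x := fun x hx => (Nat.zero_le _).trans_lt (hrN x hx)
  choose! nx hnx1 hnx2 using fun x (hx : x ∈ W) =>
    hex x hx ((r x + 1) % N x) (Nat.mod_lt _ (hNpos x hx))
  let f : X → X := fun x => if x ∈ W then nx x else x
  have hf : ∀ x ∈ W, f x = nx x := fun x hx => if_pos hx
  have hf' : ∀ x ∉ W, f x = x := fun x hx => if_neg hx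
  have hfW : ∀ x ∈ W, f x ∈ W := fun x hx => by
    rw [hf x hx]; exact ((hcl x hx _).1 (hnx1 x hx)).1
  have hfcl : ∀ x ∈ W, f x ∈ cl x := fun x hx => by rw [hf x hx]; exact hnx1 x hx
  have hitcl : ∀ x ∈ W, ∀ k, f^[k] x ∈ cl x := by
    intro x hx k
    induction k with
    | zero => exact (hcl x hx x).2 ⟨hx, rfl⟩
    | succ k ih =>
      rw [Function.iterate_succ_apply', ← hcleq x hx _ ih]
      exact hfcl _ ((hcl x hx _).1 ih).1
  have hitr : ∀ x ∈ W, ∀ k, r (f^[k] x) = (r x + k) % N x := by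
    intro x hx k
    induction k with
    | zero => simp [Nat.mod_eq_of_lt (hrN x hx)]
    | succ k ih =>
      have h1 := ((hcl x hx _).1 (hitcl x hx k)).1
      rw [Function.iterate_succ_apply', hf _ h1, hnx2 _ h1, ih]
      have : N (f^[k] x) = N x := by simp only [N, hcleq x hx _ (hitcl x hx k)]
      rw [this, Nat.mod_add_mod, add_assoc]
  have hper : ∀ x ∈ W, f^[N x] x = x := by
    intro x hx
    refine hrinj x hx (hitcl x hx _) ((hcl x hx x).2 ⟨hx, rfl⟩) ?_
    rw [hitr x hx, Nat.add_mod_right, Nat.mod_eq_of_lt (hrN x hx)]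
  have hfinj : Function.Injective f := by
    intro x y hxy
    by_cases hx : x ∈ W
    · have hy : y ∈ W := by
        by_contra hy
        rw [hf' y hy] at hxy
        exact hy (hxy ▸ hfW x hx)
      have h1 : cl x = cl y := by
        rw [← hcleq x hx _ (hfcl x hx), hxy, hcleq y hy _ (hfcl y hy)]
      have h2 : N x = N y := by simp only [N, h1]
      refine hrinj x hx ((hcl x hx x).2 ⟨hx, rfl⟩)
        (by rw [h1]; exact (hcl y hy y).2 ⟨hy, rfl⟩) ?_
      have h3 := hitr x hx 1
      have h4 := hitr y hy 1
      simp only [Function.iterate_one] at h3 h4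
      rw [hxy, h4, h2] at h3
      have h5 : r y ≡ r x [MOD N y] := Nat.ModEq.add_right_cancel' 1 h3
      have h6 := hrN x hx
      rw [h2] at h6
      exact (h5.eq_of_lt_of_lt (hrN y hy) h6).symm
    · by_cases hy : y ∈ W
      · rw [hf' x hx] at hxy
        exact absurd (hxy ▸ hfW y hy) hx
      · rwa [hf' x hx, hf' y hy] at hxy
  have hfsurj : Function.Surjective f := by
    intro x
    by_cases hx : x ∈ W
    · refine ⟨f^[N x - 1] x, ?_⟩
      rw [← Function.iterate_succ_apply' f, Nat.succ_eq_add_one, Nat.sub_add_cancel (hNpos x hx)]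
      exact hper x hx
    · exact ⟨x, hf' x hx⟩
  have hcard : ∀ (x : X) (p : X → Prop), ((cl x).filter p).card =
      ∑ g ∈ Q, if g • x ∈ W ∧ τ (g • x) = τ x ∧ p (g • x) then 1 else 0 := by
    intro x p
    rw [← Finset.card_filter]
    have : (cl x).filter p
        = (Q.filter fun g => g • x ∈ W ∧ τ (g • x) = τ x ∧ p (g • x)).image fun g => g • x := by
      ext y
      simp only [cl, Finset.mem_filter, Finset.mem_image]
      constructor
      · rintro ⟨⟨⟨g, hg, rfl⟩, h1, h2⟩, h3⟩
        exact ⟨g, ⟨hg, h1, h2, h3⟩, rfl⟩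
      · rintro ⟨g, ⟨hg, h1, h2, h3⟩, rfl⟩
        exact ⟨⟨⟨g, hg, rfl⟩, h1, h2⟩, h3⟩
    rw [this, Finset.card_image_of_injective _ (hinj x)]
  have hsm : ∀ g : G, Measurable fun x : X => g • x := fun g => measurable_const_smul g
  have hrm : Measurable r := by
    have : r = fun x => ∑ g ∈ Q, if g • x ∈ W ∧ τ (g • x) = τ x ∧ e (g • x) < e x
        then 1 else 0 := funext fun x => hcard x fun y => e y < e x
    rw [this]
    refine Finset.measurable_fun_sum _ fun g _ => Measurable.ite ?_ measurable_const
      measurable_const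
    exact (hsm g hW).inter ((measurableSet_eq_of_measurable (hτ.comp (hsm g)) hτ).inter
      (measurableSet_lt (he.comp (hsm g)) he))
  have hNm : Measurable N := by
    have : N = fun x => ∑ g ∈ Q, if g • x ∈ W ∧ τ (g • x) = τ x ∧ True
        then 1 else 0 := funext fun x => by
      have h := hcard x fun _ => True
      rw [Finset.filter_true] at h
      convert h
    rw [this]
    refine Finset.measurable_fun_sum _ fun g _ => Measurable.ite ?_ measurable_const
      measurable_const
    exact (hsm g hW).inter ((measurableSet_eq_of_measurable (hτ.comp (hsm g)) hτ).inter
      MeasurableSet.univ)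
  let t : Equiv.Perm X := Equiv.ofBijective f ⟨hfinj, hfsurj⟩
  have htf : ∀ x, t x = f x := fun x => rfl
  have htk : ∀ k x, (t ^ k) x = f^[k] x := by
    intro k x
    rw [Equiv.Perm.coe_pow]
    rfl
  refine ⟨t, ⟨fun x => ?_, fun g => ?_⟩, hf', fun x hx => ?_, ?_⟩
  · by_cases hx : x ∈ W
    · have := hfcl x hx
      simp only [cl, Finset.mem_filter, Finset.mem_image] at this
      obtain ⟨⟨g, -, hg⟩, -⟩ := this
      exact ⟨g, hg.symm⟩
    · exact ⟨1, by rw [one_smul]; exact hf' x hx⟩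
  · have : {x | t x = g • x} = (W ∩ ((fun x => g • x) ⁻¹' W ∩ ({x | τ (g • x) = τ x} ∩
        {x | r (g • x) = (r x + 1) % N x}))) ∪ (Wᶜ ∩ {x | x = g • x}) := by
      ext x
      simp only [Set.mem_ofPred_eq, Set.mem_union, Set.mem_inter_iff, Set.mem_preimage,
        Set.mem_compl_iff]
      by_cases hx : x ∈ W
      · simp only [hx, true_and, not_true, false_and, or_false]
        constructor
        · intro h
          rw [← h]
          have h1 := (hcl x hx _).1 (hfcl x hx)
          refine ⟨h1.1, h1.2, ?_⟩
          rw [htf, hf x hx, hnx2 x hx]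
        · rintro ⟨h1, h2, h3⟩
          refine hrinj x hx (hfcl x hx) ((hcl x hx _).2 ⟨h1, h2⟩) ?_
          rw [h3, hf x hx, hnx2 x hx]
      · simp only [hx, false_and, not_false_eq_true, true_and, false_or]
        rw [htf, hf' x hx]
    rw [this]
    refine (hW.inter ((hsm g hW).inter ((measurableSet_eq_of_measurable (hτ.comp (hsm g)) hτ).inter
      ?_))).union (hW.compl.inter (measurableSet_eq_of_measurable measurable_id (hsm g)))
    exact measurableSet_eq_fun (hrm.comp (hsm g))
      ((measurable_of_countable fun p : ℕ × ℕ => (p.1 + 1) % p.2).comp (hrm.prodMk hNm))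
  · exact (hcl x hx _).1 (hfcl x hx)
  · intro x hx k hk K hK hkK heq
    have hKN : K.card ≤ N x := Finset.card_le_card fun y hy => (hcl x hx y).2 (hK y hy)
    have h1 := hitr x hx k
    rw [← htk, heq] at h1
    have h2 : r x + 0 ≡ r x + k [MOD N x] := by
      unfold Nat.ModEq
      rw [← h1, add_zero, Nat.mod_eq_of_lt (hrN x hx)]
    have h3 : 0 ≡ k [MOD N x] := Nat.ModEq.add_left_cancel' _ h2
    have h4 := h3.eq_of_lt_of_lt (hNpos x hx) (hkK.trans_le hKN)
    omega

end Rotation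

section AltWalk

/-- `y 0, …, y N` is a walk in `W` without stationary steps moving alternately inside the fibres
of `κ false` and of `κ true`. -/
def AltWalk {X : Type*} (W : Set X) (κ : Bool → X → X) (N : ℕ) (y : ℕ → X) : Prop :=
  (∀ i ≤ N, y i ∈ W) ∧ ∀ i < N, y i ≠ y (i + 1) ∧ κ i.bodd (y i) = κ i.bodd (y (i + 1))

variable {X : Type*} {W : Set X} {κ : Bool → X → X} {N : ℕ} {y : ℕ → X}

lemma AltWalk.snoc (h : AltWalk W κ N y) {z : X} (hz : z ∈ W) (hne : y N ≠ z)
    (hκ : κ N.bodd (y N) = κ N.bodd z) :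
    ∃ y', AltWalk W κ (N + 1) y' ∧ (∀ i ≤ N, y' i = y i) ∧ y' (N + 1) = z := by
  refine ⟨fun i => if i ≤ N then y i else z, ⟨fun i hi => ?_, fun i hi => ?_⟩,
    fun i hi => by simp [hi], by simp⟩
  · dsimp only
    split_ifs with h1
    · exact h.1 i h1
    · exact hz
  · have h1 : i ≤ N := by omega
    by_cases h2 : i + 1 ≤ N
    · simp only [h1, h2, if_true]
      exact h.2 i h2
    · have h3 : i = N := by omega
      subst h3
      simpa using ⟨hne, hκ⟩

/-- `y 0, …, y (2 * m) = y 0` is an alternating cycle starting with a step in a fibre of `κ β`. -/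
def AltCycle (W : Set X) (κ : Bool → X → X) (β : Bool) (m : ℕ) (y : ℕ → X) : Prop :=
  1 ≤ m ∧ (∀ i, y i ∈ W) ∧ Set.InjOn y (Set.Iio (2 * m)) ∧ y (2 * m) = y 0 ∧
    ∀ i < 2 * m, κ (xor β i.bodd) (y i) = κ (xor β i.bodd) (y (i + 1))

lemma AltCycle.rotate {β : Bool} {m : ℕ} (h : AltCycle W κ β m y) :
    ∃ y', AltCycle W κ (!β) m y' := by
  obtain ⟨hm, hW, hinj, hc, hs⟩ := h
  refine ⟨fun i => if i < 2 * m then y (i + 1) else y 1, hm, fun i => ?_, ?_, ?_, ?_⟩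
  · dsimp only
    split_ifs <;> exact hW _
  · have key : ∀ i < 2 * m, ∃ j < 2 * m, y (i + 1) = y j ∧ (j = i + 1 ∨ (i + 1 = 2 * m ∧ j = 0)) := by
      intro i hi
      by_cases h1 : i + 1 < 2 * m
      · exact ⟨i + 1, h1, rfl, Or.inl rfl⟩
      · have h2 : i + 1 = 2 * m := by omega
        exact ⟨0, by omega, by rw [h2, hc], Or.inr ⟨h2, rfl⟩⟩
    intro i hi j hj hij
    rw [Set.mem_Iio] at hi hj
    simp only [hi, hj, if_true] at hij
    obtain ⟨i', hi', e1, h1⟩ := key i hi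
    obtain ⟨j', hj', e2, h2⟩ := key j hj
    have := hinj (Set.mem_Iio.2 hi') (Set.mem_Iio.2 hj') (by rw [← e1, ← e2, hij])
    omega
  · simp [show 0 < 2 * m by omega]
  · intro i hi
    have h0 : (if i < 2 * m then y (i + 1) else y 1) = y (i + 1) := if_pos hi
    have h1 : (xor (!β) i.bodd) = xor β (i + 1).bodd := by
      rw [Nat.bodd_succ]; cases β <;> cases i.bodd <;> rfl
    simp only [h0, h1]
    by_cases h2 : i + 1 < 2 * m
    · rw [if_pos h2]
      exact hs _ h2
    · have h3 : i + 1 = 2 * m := by omega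
      rw [if_neg h2, h3, hc]
      have := hs 0 (by omega)
      simpa [Nat.bodd_mul] using this

/-- A closed alternating walk contains an alternating cycle. -/
lemma AltWalk.exists_altCycle (h : AltWalk W κ N y) (hN : 1 ≤ N) (hc : y N = y 0) :
    ∃ β m y', AltCycle W κ β m y' := by
  classical
  have hex : ∃ n, 1 ≤ n ∧ ∃ i, i + n ≤ N ∧ y (i + n) = y i :=
    ⟨N, hN, 0, by omega, by simpa using hc⟩
  obtain ⟨n, ⟨hn, i, hi, he⟩, hmin⟩ : ∃ n, (1 ≤ n ∧ ∃ i, i + n ≤ N ∧ y (i + n) = y i) ∧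
      ∀ k < n, ¬ (1 ≤ k ∧ ∃ i, i + k ≤ N ∧ y (i + k) = y i) :=
    ⟨Nat.find hex, Nat.find_spec hex, fun k hk => Nat.find_min hex hk⟩
  have hinj : ∀ a b, a < b → b ≤ N → b < a + n → y a ≠ y b := by
    intro a b hab hb hbn heq
    refine hmin (b - a) (by omega) ⟨by omega, a, by omega, ?_⟩
    rw [show a + (b - a) = b by omega, heq]
  have hinj' : ∀ s, Set.InjOn (fun k => y (s + k)) {k | k < n ∧ s + k ≤ N} := by
    intro s a ha b hb hab
    rcases lt_trichotomy a b with h1 | h1 | h1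
    · exact absurd hab (hinj _ _ (by omega) hb.2 (by have := hb.1; omega))
    · exact h1
    · exact absurd hab.symm (hinj _ _ (by omega) ha.2 (by have := ha.1; omega))
  have hxor : ∀ a b : ℕ, xor a.bodd b.bodd = (a + b).bodd := fun a b => (Nat.bodd_add a b).symm
  obtain ⟨m, hm | hm⟩ := Nat.even_or_odd' n
  · refine ⟨i.bodd, m, fun k => if k ≤ n then y (i + k) else y i, by omega, fun k => ?_, ?_, ?_, ?_⟩
    · dsimp only
      split_ifs with h1
      · exact h.1 _ (by omega)
      · exact h.1 _ (by omega)
    · intro a ha b hb hab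
      rw [Set.mem_Iio] at ha hb
      simp only [show a ≤ n by omega, show b ≤ n by omega, if_true] at hab
      exact hinj' i ⟨by omega, by omega⟩ ⟨by omega, by omega⟩ hab
    · simp [← hm, he]
    · intro k hk
      simp only [show k ≤ n by omega, show k + 1 ≤ n by omega, if_true, hxor]
      exact (h.2 (i + k) (by omega)).2
  · have hn1 : n ≠ 1 := by
      rintro rfl
      exact (h.2 i (by omega)).1 he.symm
    refine ⟨(i + 1).bodd, m, fun k => if k < 2 * m then y (i + 1 + k) else y (i + 1), by omega,
      fun k => ?_, ?_, ?_, ?_⟩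
    · dsimp only
      split_ifs with h1
      · exact h.1 _ (by omega)
      · exact h.1 _ (by omega)
    · intro a ha b hb hab
      rw [Set.mem_Iio] at ha hb
      simp only [ha, hb, if_true] at hab
      exact hinj' (i + 1) ⟨by omega, by omega⟩ ⟨by omega, by omega⟩ hab
    · simp [show 0 < m by omega]
    · intro k hk
      simp only [hk, if_true, hxor]
      by_cases h2 : k + 1 < 2 * m
      · simp only [h2, if_true]
        exact (h.2 (i + 1 + k) (by omega)).2
      · have h3 : k + 1 = 2 * m := by omega
        simp only [h2, if_false]
        have h4 : (i + 1 + k).bodd = i.bodd := by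
          rw [show i + 1 + k = i + 2 * m by omega, Nat.bodd_add, Nat.bodd_mul]; simp
        have h5 := (h.2 (i + 1 + k) (by omega)).2
        rw [h4] at h5 ⊢
        rw [h5, show i + 1 + k + 1 = i + n by omega, he]
        exact (h.2 i (by omega)).2

end AltWalk

section Prune

variable {G X : Type*} [Group G] [Countable G] [MeasurableSpace X]
  [MulAction G X] [MeasurableConstSMul G X]

/-- Mass transport: a set mapped at most `k`-to-one into `Y` along orbits. -/
lemma measure_le_of_card_fiber_le (μ : Measure X) [SMulInvariantMeasure G X μ] {c : X → G}
    (hc : ∀ g, MeasurableSet {x | c x = g}) {A Y : Set X} (hA : MeasurableSet A)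
    (hY : MeasurableSet Y) (hAY : ∀ x ∈ A, c x • x ∈ Y) (k : ℕ)
    (hk : ∀ (y : X) (K : Finset G), (∀ g ∈ K, g⁻¹ • y ∈ A ∧ c (g⁻¹ • y) = g) → K.card ≤ k) :
    μ A ≤ k * μ Y := by
  classical
  rw [← lintegral_indicator_one hA, lintegral_eq_lintegral_tsum_transport μ hc
    (measurable_one.indicator hA), ← lintegral_indicator_one hY, ← lintegral_const_mul _
    (measurable_one.indicator hY)]
  refine lintegral_mono fun y => ?_
  rw [ENNReal.tsum_eq_iSup_sum]
  refine iSup_le fun s => ?_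
  have h1 : ∀ g, {x | c x = g}.indicator (A.indicator (1 : X → ℝ≥0∞)) (g⁻¹ • y)
      = if g⁻¹ • y ∈ A ∧ c (g⁻¹ • y) = g then 1 else 0 := by
    intro g
    by_cases h2 : g⁻¹ • y ∈ A <;> by_cases h3 : c (g⁻¹ • y) = g <;>
      simp [h2, h3]
  simp only [h1]
  rw [← Finset.sum_filter, Finset.sum_const, nsmul_one]
  set K := s.filter fun g => g⁻¹ • y ∈ A ∧ c (g⁻¹ • y) = g with hK
  have hK' : ∀ g ∈ K, g⁻¹ • y ∈ A ∧ c (g⁻¹ • y) = g := fun g hg => (Finset.mem_filter.1 hg).2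
  rcases K.eq_empty_or_nonempty with h | ⟨g, hg⟩
  · simp [h]
  · have hy : y ∈ Y := by
      have := hAY _ (hK' g hg).1
      rwa [(hK' g hg).2, smul_inv_smul] at this
    rw [Set.indicator_of_mem hy, Pi.one_apply, mul_one]
    exact_mod_cast hk y K hK'

/-- If two finite-class relations on `W` have few classes, then `W` has a nonnull part on which all
classes have at least five elements. -/
lemma exists_prune [StandardBorelSpace X] (hfree : ∀ (g : G) (x : X), g • x = x → g = 1)
    (μ : Measure X) [IsFiniteMeasure μ]
    [SMulInvariantMeasure G X μ] {W Y : Set X} (hW : MeasurableSet W) (hY : MeasurableSet Y)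
    {κ : Bool → X → X} (hκ : ∀ b, Measurable (κ b)) (hκo : ∀ b x, ∃ g : G, κ b x = g • x)
    (hκY : ∀ b, ∀ x ∈ W, κ b x ∈ Y) (Q : Finset G)
    (hQ : ∀ b, ∀ x ∈ W, ∀ y ∈ W, κ b x = κ b y → ∃ g ∈ Q, y = g • x)
    (hlarge : 8 * μ Y < μ W) :
    ∃ W' ⊆ W, MeasurableSet W' ∧ 0 < μ W' ∧ ∀ b, ∀ x ∈ W', ∃ K : Finset X, 5 ≤ K.card ∧
      ∀ y ∈ K, y ∈ W' ∧ κ b y = κ b x := by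
  classical
  have hsm : ∀ g : G, Measurable fun x : X => g • x := fun g => measurable_const_smul g
  let Big : Bool → Set X → Set X := fun b V => {x | ∃ K : Finset G, K.card = 5 ∧
    ∀ g ∈ K, g • x ∈ V ∧ κ b (g • x) = κ b x}
  have hBig : ∀ b V, MeasurableSet V → MeasurableSet (Big b V) := by
    intro b V hV
    have : Big b V = ⋃ (K : Finset G) (_ : K.card = 5), ⋂ g ∈ K, ((fun x => g • x) ⁻¹' V ∩
        {x | κ b (g • x) = κ b x}) := by
      ext x
      simp [Big]
    rw [this]
    refine MeasurableSet.iUnion fun K => MeasurableSet.iUnion fun _ =>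
      Finset.measurableSet_biInter _ fun g _ => (hsm g hV).inter ?_
    exact measurableSet_eq_of_measurable ((hκ b).comp (hsm g)) (hκ b)
  let u : ℕ → Set X := fun n => Nat.rec W (fun _ V => V ∩ (Big false V ∩ Big true V)) n
  have hu : ∀ n, u (n + 1) = u n ∩ (Big false (u n) ∩ Big true (u n)) := fun n => rfl
  have hum : ∀ n, MeasurableSet (u n) := by
    intro n
    induction n with
    | zero => exact hW
    | succ n ih =>
      rw [hu]
      exact ih.inter ((hBig _ _ ih).inter (hBig _ _ ih))
  have hanti : Antitone u := antitone_nat_of_succ_le fun n => by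
    rw [hu]; exact Set.inter_subset_left
  have huW : ∀ n, u n ⊆ W := fun n => hanti (Nat.zero_le n)
  have hW'm : MeasurableSet (⋂ n, u n) := MeasurableSet.iInter hum
  let Rem : Bool → Set X := fun b => ⋃ n, (u n \ Big b (u n))
  have hRem : ∀ b, MeasurableSet (Rem b) := fun b =>
    MeasurableSet.iUnion fun n => (hum n).diff (hBig _ _ (hum n))
  have hRemW : ∀ b, Rem b ⊆ W := fun b => Set.iUnion_subset fun n => fun x hx => huW n hx.1
  have hRem4 : ∀ b, μ (Rem b) ≤ (4 : ℕ) * μ Y := by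
    intro b
    choose c hc using hκo b
    refine measure_le_of_card_fiber_le μ (c := c) (fun g => ?_) (hRem b) hY
      (fun x hx => by rw [← hc]; exact hκY b x (hRemW b hx)) 4 ?_
    · have : {x | c x = g} = {x | κ b x = g • x} := by
        ext x
        simp only [Set.mem_ofPred_eq, hc]
        exact ⟨fun h => by rw [h], fun h => smul_left_injective_of_free hfree h⟩
      rw [this]
      exact measurableSet_eq_of_measurable (hκ b) (hsm g)
    · intro y K hK
      by_contra hcard
      obtain ⟨K', hK'K, hK'⟩ := Finset.exists_subset_card_eq (show 5 ≤ K.card by omega)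
      choose! n hn using fun g (hg : g ∈ K) => Set.mem_iUnion.1 (hK g hg).1
      obtain ⟨g₀, hg₀, hmin⟩ := K'.exists_min_image n (Finset.card_pos.1 (by omega))
      refine (hn g₀ (hK'K hg₀)).2 ⟨K'.image fun g => g⁻¹ * g₀, ?_, ?_⟩
      · rw [Finset.card_image_of_injective, hK']
        intro a b hab
        simpa using hab
      · intro k hk
        obtain ⟨g, hg, rfl⟩ := Finset.mem_image.1 hk
        have e : (g⁻¹ * g₀) • g₀⁻¹ • y = g⁻¹ • y := by simp [mul_smul]
        rw [e]
        refine ⟨hanti (hmin g hg) (hn g (hK'K hg)).1, ?_⟩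
        rw [hc, hc (g₀⁻¹ • y), (hK g (hK'K hg)).2, (hK g₀ (hK'K hg₀)).2, smul_inv_smul,
          smul_inv_smul]
  refine ⟨⋂ n, u n, Set.iInter_subset u 0, hW'm, ?_, ?_⟩
  · by_contra hn
    have h0 : μ (⋂ n, u n) = 0 := le_antisymm (not_lt.1 hn) zero_le
    have hcov : W ⊆ (⋂ n, u n) ∪ (Rem false ∪ Rem true) := by
      intro x hx
      by_contra hcon
      simp only [Set.mem_union, not_or, Rem, Set.mem_iUnion, not_exists, Set.mem_sdiff, not_and,
        not_not] at hcon
      refine hcon.1 (Set.mem_iInter.2 fun n => ?_)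
      induction n with
      | zero => exact hx
      | succ n ih =>
        rw [hu]
        exact ⟨ih, hcon.2.1 n ih, hcon.2.2 n ih⟩
    refine absurd ((measure_mono hcov).trans ((measure_union_le _ _).trans
      (add_le_add le_rfl ((measure_union_le _ _).trans
        (add_le_add (hRem4 false) (hRem4 true)))))) (not_le.2 ?_)
    rw [h0, zero_add, ← add_mul]
    norm_num
    exact hlarge
  · intro b x hx
    have hxn : ∀ n, x ∈ Big b (u n) := fun n => by
      have := Set.mem_iInter.1 hx (n + 1)
      rw [hu] at this
      cases b
      · exact this.2.1
      · exact this.2.2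
    have hxW : x ∈ W := Set.mem_iInter.1 hx 0
    suffices hs : ∃ K : Finset G, K.card = 5 ∧ ∀ n, ∀ g ∈ K, g • x ∈ u n ∧ κ b (g • x) = κ b x by
      obtain ⟨K, hK, hK'⟩ := hs
      refine ⟨K.image fun g => g • x, ?_, ?_⟩
      · rw [Finset.card_image_of_injective _ fun a b h => smul_left_injective_of_free hfree h, hK]
      · intro y hy
        obtain ⟨g, hg, rfl⟩ := Finset.mem_image.1 hy
        exact ⟨Set.mem_iInter.2 fun n => (hK' n g hg).1, (hK' 0 g hg).2⟩
    choose K hK hK' using hxn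
    have hKQ : ∀ n, K n ∈ Q.powerset := by
      intro n
      rw [Finset.mem_powerset]
      intro g hg
      obtain ⟨q, hq, e⟩ := hQ b x hxW _ (huW n (hK' n g hg).1) (hK' n g hg).2.symm
      rwa [smul_left_injective_of_free hfree e]
    by_contra hcon
    push Not at hcon
    have : ∀ L : Finset G, ∃ n, L.card = 5 → ∃ g ∈ L, g • x ∈ u n → κ b (g • x) ≠ κ b x := by
      intro L
      by_cases hL : L.card = 5
      · obtain ⟨n, hn⟩ := hcon L hL
        exact ⟨n, fun _ => hn⟩
      · exact ⟨0, fun h => absurd h hL⟩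
    choose n hn using this
    let m := Q.powerset.sup n
    obtain ⟨g, hg, hg'⟩ := hn (K m) (hK m)
    exact hg' (hanti (Finset.le_sup (hKQ m)) (hK' m g hg).1) (hK' m g hg).2

end Prune

section AcyclicFree

variable {G X : Type*} [Group G]

/-- The exponent of `t` in a letter of the free group mapped to `t * h * t` and
`t ^ 2 * h * t ^ 2`. -/
def tExp (l : Fin 2 × Bool) : ℤ :=
  cond l.2 (1 : ℤ) (-1) * ((l.1 : ℕ) + 1 : ℤ)

/-- The image of a letter of the free group. -/
def letterPerm (t h : Equiv.Perm X) (l : Fin 2 × Bool) : Equiv.Perm X :=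
  t ^ tExp l * h ^ (cond l.2 (1 : ℤ) (-1)) * t ^ tExp l

/-- The action of the free group by `t * h * t` and `t ^ 2 * h * t ^ 2`. -/
def freeHom (t h : Equiv.Perm X) : FreeGroup (Fin 2) →* Equiv.Perm X :=
  FreeGroup.lift fun i => t ^ ((i : ℕ) + 1) * h * t ^ ((i : ℕ) + 1)

lemma freeHom_eq (t h : Equiv.Perm X) (w : FreeGroup (Fin 2)) :
    freeHom t h w = (w.toWord.map (letterPerm t h)).prod := by
  conv_lhs => rw [← FreeGroup.mk_toWord (x := w), freeHom, FreeGroup.lift_mk]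
  congr 1
  refine List.map_congr_left fun l _ => ?_
  obtain ⟨i, b⟩ := l
  cases b
  · simp only [cond_false, letterPerm, tExp, mul_inv_rev, neg_mul, one_mul, zpow_neg, zpow_one,
      mul_assoc]
    norm_cast
  · simp only [cond_true, letterPerm, tExp, one_mul, zpow_one]
    norm_cast

lemma tExp_add_ne_zero {l l' : Fin 2 × Bool} (h : l.1 = l'.1 → l.2 = l'.2) :
    tExp l + tExp l' ≠ 0 := by
  revert h
  revert l l'
  decide

lemma abs_tExp_add_le (l l' : Fin 2 × Bool) : |tExp l + tExp l'| ≤ 4 := by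
  revert l l'
  decide

lemma tExp_ne_zero (l : Fin 2 × Bool) : tExp l ≠ 0 := by
  revert l
  decide

lemma abs_tExp_le (l : Fin 2 × Bool) : |tExp l| ≤ 4 := by
  revert l
  decide

/-- Integer powers of a permutation preserving the fibres of `τ` in `W`. -/
lemma zpow_mem_fiber {t : Equiv.Perm X} {W : Set X} {τ : X → X} (h1 : ∀ x ∉ W, t x = x)
    (h2 : ∀ x ∈ W, t x ∈ W ∧ τ (t x) = τ x) (k : ℤ) {x : X} (hx : x ∈ W) :
    (t ^ k) x ∈ W ∧ τ ((t ^ k) x) = τ x := by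
  have hinv : ∀ x ∈ W, t⁻¹ x ∈ W ∧ τ (t⁻¹ x) = τ x := by
    intro x hx
    have hti : t (t⁻¹ x) = x := by simp
    have hm : t⁻¹ x ∈ W := by
      by_contra hn
      have := h1 _ hn
      rw [hti] at this
      exact hn (this ▸ hx)
    refine ⟨hm, ?_⟩
    have := (h2 _ hm).2
    rw [hti] at this
    exact this.symm
  induction k with
  | zero => exact ⟨hx, rfl⟩
  | succ k ih =>
    rw [add_comm, zpow_add, zpow_one, Equiv.Perm.mul_apply]
    exact ⟨(h2 _ ih.1).1, (h2 _ ih.1).2.trans ih.2⟩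
  | pred k ih =>
    rw [sub_eq_add_neg, add_comm, zpow_add, zpow_neg_one, Equiv.Perm.mul_apply]
    exact ⟨(hinv _ ih.1).1, (hinv _ ih.1).2.trans ih.2⟩

lemma exists_walk_of_isReduced {W : Set X} {κ : Bool → X → X} {t h : Equiv.Perm X}
    (ht : ∀ (k : ℤ), ∀ x ∈ W, (t ^ k) x ∈ W ∧ κ false ((t ^ k) x) = κ false x)
    (hh : ∀ (k : ℤ), ∀ x ∈ W, (h ^ k) x ∈ W ∧ κ true ((h ^ k) x) = κ true x)
    (htf : ∀ (k : ℤ), ∀ x ∈ W, k ≠ 0 → |k| ≤ 4 → (t ^ k) x ≠ x)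
    (hhf : ∀ (k : ℤ), ∀ x ∈ W, k ≠ 0 → |k| ≤ 4 → (h ^ k) x ≠ x) {x : X} (hx : x ∈ W)
    (L : List (Fin 2 × Bool)) (l : Fin 2 × Bool) (hL : FreeGroup.IsReduced (l :: L)) :
    ∃ N y, N.bodd = false ∧ AltWalk W κ N y ∧ y 0 = x ∧
      (t ^ tExp l) (y N) = ((l :: L).map (letterPerm t h)).prod x := by
  have key : ∀ (N : ℕ) (y : ℕ → X) (k ε : ℤ), N.bodd = false → AltWalk W κ N y → k ≠ 0 → |k| ≤ 4 →
      ε ≠ 0 → |ε| ≤ 4 → ∃ N' y', N'.bodd = false ∧ AltWalk W κ N' y' ∧ y' 0 = y 0 ∧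
        y' N' = (h ^ ε) ((t ^ k) (y N)) := by
    intro N y k ε hN hy hk hk4 hε hε4
    have hyN := hy.1 N le_rfl
    have h1 := ht k _ hyN
    obtain ⟨y', hy', hy'0, hy'1⟩ := hy.snoc h1.1 (htf k _ hyN hk hk4).symm
      (by rw [hN]; exact h1.2.symm)
    have h2 := hh ε _ h1.1
    obtain ⟨y'', hy'', hy''0, hy''1⟩ := hy'.snoc (z := (h ^ ε) ((t ^ k) (y N))) h2.1
      (by rw [hy'1]; exact (hhf ε _ h1.1 hε hε4).symm)
      (by rw [Nat.bodd_succ, hN, hy'1]; exact h2.2.symm)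
    exact ⟨N + 1 + 1, y'', by simp [hN], hy'', by rw [hy''0 0 (by omega), hy'0 0 (by omega)],
      hy''1⟩
  have hε : ∀ l : Fin 2 × Bool, (cond l.2 (1 : ℤ) (-1)) ≠ 0 ∧ |cond l.2 (1 : ℤ) (-1)| ≤ 4 := by
    decide
  induction L generalizing l with
  | nil =>
    obtain ⟨N, y, hN, hy, hy0, hyN⟩ := key 0 (fun _ => x) (tExp l) _ rfl
      ⟨fun _ _ => hx, fun i hi => absurd hi (Nat.not_lt_zero i)⟩ (tExp_ne_zero l) (abs_tExp_le l)
      (hε l).1 (hε l).2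
    refine ⟨N, y, hN, hy, hy0, ?_⟩
    rw [hyN]
    simp [letterPerm]
  | cons l' L ih =>
    have hL' := List.isChain_cons_cons.1 hL
    obtain ⟨N, y, hN, hy, hy0, hyN⟩ := ih l' hL'.2
    obtain ⟨N', y', hN', hy', hy0', hyN'⟩ := key N y (tExp l + tExp l') _ hN hy
      (tExp_add_ne_zero hL'.1) (abs_tExp_add_le l l') (hε l).1 (hε l).2
    refine ⟨N', y', hN', hy', hy0'.trans hy0, ?_⟩
    rw [hyN', zpow_add, Equiv.Perm.mul_apply, hyN]
    simp [letterPerm]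

variable [Countable G] [MeasurableSpace X] [StandardBorelSpace X]
  [MulAction G X] [MeasurableConstSMul G X]

/-- An acyclic alternating graph with more edges than eight times the measure of its vertices
carries a free action of the free group. -/
lemma exists_freeOn_of_acyclic (hfree : ∀ (g : G) (x : X), g • x = x → g = 1)
    (μ : Measure X) [IsFiniteMeasure μ]
    [SMulInvariantMeasure G X μ] {W Y : Set X} (hW : MeasurableSet W) (hY : MeasurableSet Y)
    {κ : Bool → X → X} (hκ : ∀ b, Measurable (κ b)) (hκo : ∀ b x, ∃ g : G, κ b x = g • x)
    (hκY : ∀ b, ∀ x ∈ W, κ b x ∈ Y) (Q : Finset G)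
    (hQ : ∀ b, ∀ x ∈ W, ∀ y ∈ W, κ b x = κ b y → ∃ g ∈ Q, y = g • x)
    (hlarge : 8 * μ Y < μ W) (hac : ∀ m y, ¬ AltCycle W κ true m y) :
    ∃ (A : Set X) (T : FreeGroup (Fin 2) → X → X), MeasurableSet A ∧ A ⊆ W ∧ 0 < μ A ∧
      FreeOn G A T := by
  obtain ⟨W', hW'W, hW', hW'0, hdeg⟩ := exists_prune hfree μ hW hY hκ hκo hκY Q hQ hlarge
  choose ρ hρ hρ1 hρ2 hρ3 using fun b => exists_rotation hfree hW' (hκ b) Q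
    (fun x hx y hy => hQ b x (hW'W hx) y (hW'W hy))
  have hz : ∀ b (k : ℤ), ∀ x ∈ W', (ρ b ^ k) x ∈ W' ∧ κ b ((ρ b ^ k) x) = κ b x :=
    fun b k x hx => zpow_mem_fiber (hρ1 b) (hρ2 b) k hx
  have hzf : ∀ b (k : ℤ), ∀ x ∈ W', k ≠ 0 → |k| ≤ 4 → (ρ b ^ k) x ≠ x := by
    intro b k x hx hk hk4 heq
    obtain ⟨K, hK5, hK⟩ := hdeg b x hx
    have hnat : (ρ b ^ k.natAbs) x = x := by
      rcases Int.natAbs_eq k with h | h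
      · rw [h, zpow_natCast] at heq
        exact heq
      · rw [h, zpow_neg, zpow_natCast, Equiv.Perm.inv_eq_iff_eq] at heq
        exact heq.symm
    exact hρ3 b x hx k.natAbs (Int.natAbs_pos.2 hk) K hK (by rw [Int.abs_eq_natAbs] at hk4; omega) hnat
  have hFG : ∀ w, freeHom (ρ false) (ρ true) w ∈ fullGroup G X := by
    intro w
    have : (freeHom (ρ false) (ρ true)).range ≤ fullGroup G X := by
      rw [freeHom, FreeGroup.range_lift_eq_closure, Subgroup.closure_le]
      rintro _ ⟨i, rfl⟩
      exact mul_mem (mul_mem (pow_mem (hρ false) _) (hρ true)) (pow_mem (hρ false) _)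
    exact this ⟨w, rfl⟩
  have hac' : ∀ β m y, ¬ AltCycle W' κ β m y := by
    intro β m y hy
    have hy' : AltCycle W κ β m y := ⟨hy.1, fun i => hW'W (hy.2.1 i), hy.2.2⟩
    cases β
    · obtain ⟨y', hy''⟩ := hy'.rotate
      exact hac m y' hy''
    · exact hac m y hy'
  refine ⟨W', fun w => freeHom (ρ false) (ρ true) w, hW', hW'W, hW'0, ?_⟩
  constructor
  · simp only [map_one]
    rfl
  · intro w w'
    rw [map_mul]
    rfl
  · exact fun w => measurable_of_mem_fullGroup (hFG w)
  · exact fun w x => (hFG w).1 x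
  · intro w x hx
    have h1 : ∀ b, ρ b ∈ MulAction.stabilizer (Equiv.Perm X) x := fun b => hρ1 b x hx
    have : (freeHom (ρ false) (ρ true)).range ≤ MulAction.stabilizer (Equiv.Perm X) x := by
      rw [freeHom, FreeGroup.range_lift_eq_closure, Subgroup.closure_le]
      rintro _ ⟨i, rfl⟩
      exact mul_mem (mul_mem (pow_mem (h1 false) _) (h1 true)) (pow_mem (h1 false) _)
    exact this ⟨w, rfl⟩
  · intro x hx w hw heq
    rw [freeHom_eq] at heq
    have hred : FreeGroup.IsReduced w.toWord := FreeGroup.isReduced_toWord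
    cases hL : w.toWord with
    | nil => exact hw (FreeGroup.toWord_eq_nil_iff.1 hL)
    | cons l L =>
      rw [hL] at heq hred
      obtain ⟨N, y, hN, hy, hy0, hyN⟩ := exists_walk_of_isReduced (hz false) (hz true) (hzf false)
        (hzf true) hx L l hred
      have hmem := hy.1 N le_rfl
      obtain ⟨y', hy', hy'0, hy'1⟩ := hy.snoc (z := x)
        hx (by
          intro h
          have := hyN.trans heq
          rw [h] at this
          exact hzf false (tExp l) x hx (tExp_ne_zero l) (abs_tExp_le l) this)
        (by
          rw [hN, ← heq, ← hyN]
          exact (hz false _ _ hmem).2.symm)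
      obtain ⟨β, m, y'', h⟩ := hy'.exists_altCycle (by omega)
        (by rw [hy'1, hy'0 0 (by omega), hy0])
      exact hac' β m y'' h

end AcyclicFree

section Cycles

variable {G X I : Type*} [Group G] [MulAction G X] {Q : Finset G} (ev : I → G)

lemma exists_code_of_altCycle (hfree : ∀ (g : G) (x : X), g • x = x → g = 1)
    {L : X → Option I} {κ : Bool → X → X} {W : Set X} (hWL : ∀ x ∈ W, L x ≠ none)
    (hη : ∀ x y s s', L x = some s → L y = some s' → κ true x = κ true y →
      ∃ q ∈ Q, y = (ev s')⁻¹ • q • ev s • x)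
    (hτ : ∀ x ∈ W, ∀ y ∈ W, κ false x = κ false y → ∃ q ∈ Q, y = q • x) {m : ℕ} {y : ℕ → X}
    (h : AltCycle W κ true m y) :
    ∃ v : List (CycStep I Q), v ≠ [] ∧ codeDisp ev v = 1 ∧
      ((codePos ev v).map Prod.fst).Nodup ∧
      ∀ p ∈ codePos ev v, p.1 • y 0 ∈ W ∧ L (p.1 • y 0) = some p.2 := by
  obtain ⟨hm, hW, hinj, hc, hs⟩ := h
  have key : ∀ k ≤ m, ∃ v : List (CycStep I Q), v.length = k ∧ codeDisp ev v • y 0 = y (2 * k) ∧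
      ((codePos ev v).map Prod.fst).Nodup ∧
      ∀ p ∈ codePos ev v, ∃ i < 2 * k, p.1 • y 0 = y i ∧ L (y i) = some p.2 := by
    intro k
    induction k with
    | zero =>
      intro _
      exact ⟨[], rfl, by simp [codeDisp], by simp [codePos], by simp [codePos]⟩
    | succ k ih =>
      intro hk
      obtain ⟨v, hv1, hv2, hv3, hv4⟩ := ih (by omega)
      obtain ⟨s, hs1⟩ := Option.ne_none_iff_exists'.1 (hWL _ (hW (2 * k)))
      obtain ⟨s', hs2⟩ := Option.ne_none_iff_exists'.1 (hWL _ (hW (2 * k + 1)))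
      have e1 := hs (2 * k) (by omega)
      have e2 := hs (2 * k + 1) (by omega)
      simp only [Nat.bodd_succ, Nat.bodd_mul] at e1 e2
      obtain ⟨q, hq, hq1⟩ := hη _ _ s s' hs1 hs2 e1
      obtain ⟨q', hq', hq1'⟩ := hτ _ (hW _) _ (hW _) e2
      let c : CycStep I Q := (((s, ⟨q, hq⟩), s'), ⟨q', hq'⟩)
      have hhalf : (halfDisp ev c * codeDisp ev v) • y 0 = y (2 * k + 1) := by
        rw [mul_smul, hv2, hq1]
        simp [halfDisp, c, mul_smul]
      have hne : ∀ j, 2 * k ≤ j → j < 2 * m → ∀ g : G, g • y 0 = y j →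
          g ∉ (codePos ev v).map Prod.fst := by
        intro j hj hjm g hg hmem
        obtain ⟨p, hp, rfl⟩ := List.mem_map.1 hmem
        obtain ⟨i, hi, hi1, -⟩ := hv4 p hp
        have := hinj (Set.mem_Iio.2 (show i < 2 * m by omega)) (Set.mem_Iio.2 hjm)
          (by rw [← hi1, hg])
        omega
      refine ⟨c :: v, by simp [hv1], ?_, ?_, ?_⟩
      · rw [codeDisp, stepDisp, mul_assoc, mul_smul, hhalf, ← hq1']
        rfl
      · simp only [codePos, List.map_cons, List.nodup_cons, List.mem_cons, not_or]
        refine ⟨⟨fun e => ?_, hne _ le_rfl (by omega) _ hv2⟩,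
          hne _ (by omega) (by omega) _ hhalf, hv3⟩
        have h1 : y (2 * k) = y (2 * k + 1) := by rw [← hv2, e, hhalf]
        have := hinj (Set.mem_Iio.2 (show 2 * k < 2 * m by omega))
          (Set.mem_Iio.2 (show 2 * k + 1 < 2 * m by omega)) h1
        omega
      · intro p hp
        simp only [codePos, List.mem_cons] at hp
        rcases hp with rfl | rfl | hp
        · exact ⟨2 * k, by omega, hv2, hs1⟩
        · exact ⟨2 * k + 1, by omega, hhalf, hs2⟩
        · obtain ⟨i, hi, h⟩ := hv4 p hp
          exact ⟨i, by omega, h⟩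
  obtain ⟨v, hv1, hv2, hv3, hv4⟩ := key m le_rfl
  refine ⟨v, ?_, hfree _ _ (hv2.trans hc), hv3, ?_⟩
  · rintro rfl
    simp at hv1
    omega
  · intro p hp
    obtain ⟨i, hi, e1, e2⟩ := hv4 p hp
    rw [e1]
    exact ⟨hW i, e2⟩

variable [Countable G] [MeasurableSpace X] [StandardBorelSpace X] [MeasurableConstSMul G X]

/-- Removing cycles: unless a free action on a small set appears, all but few letters of `L` can be
recorded by codes of disjoint cycles. -/
lemma exists_cycle_removal [Countable I] (hfree : ∀ (g : G) (x : X), g • x = x → g = 1)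
    (μ : Measure X) [IsFiniteMeasure μ] [SMulInvariantMeasure G X μ] {L : X → Option I}
    (hL : ∀ o, MeasurableSet {x | L x = o}) {Y : Set X} (hY : MeasurableSet Y) (hY0 : 0 < μ Y)
    {κ : Bool → X → X} (hκ : ∀ b, Measurable (κ b)) (hκo : ∀ b x, ∃ g : G, κ b x = g • x)
    (hκY : ∀ b x, κ b x ∈ Y) (Q' : Finset G)
    (hQ' : ∀ b x y, L x ≠ none → L y ≠ none → κ b x = κ b y → ∃ g ∈ Q', y = g • x)
    (hη : ∀ x y s s', L x = some s → L y = some s' → κ true x = κ true y →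
      ∃ q ∈ Q, y = (ev s')⁻¹ • q • ev s • x)
    (hτ : ∀ x y, κ false x = κ false y → ∃ q ∈ Q, y = q • x) :
    (∃ (A : Set X) (T : FreeGroup (Fin 2) → X → X), MeasurableSet A ∧ A ⊆ {x | L x ≠ none} ∧
      0 < μ A ∧ FreeOn G A T) ∨
    ∃ (z : X → Option (I ⊕ List (CycStep I Q))) (J : Finset (List (CycStep I Q))),
      (∀ o, MeasurableSet {x | z x = o}) ∧ (∀ v ∈ J, v ≠ [] ∧ codeDisp ev v = 1) ∧
      (∀ x v, z x = some (Sum.inr v) → v ∈ J) ∧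
      (∀ x s, L x = some s ↔ z x = some (Sum.inl s) ∨
        ∃ v, ∃ g, (g, s) ∈ codePos ev v ∧ z (g⁻¹ • x) = some (Sum.inr v)) ∧
      μ {x | ∃ s, z x = some (Sum.inl s)} ≤ 9 * μ Y ∧
      ∑ v ∈ J, (2 * v.length : ℕ) * μ {x | z x = some (Sum.inr v)} ≤ μ {x | L x ≠ none} := by
  classical
  have : Countable (List (CycStep I Q)) := inferInstance
  obtain ⟨code, hcode⟩ := exists_surjective_nat (List (CycStep I Q))
  have hW₀ : MeasurableSet {x | L x ≠ none} := (hL none).compl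
  let Valid : List (CycStep I Q) → Prop := fun v =>
    v ≠ [] ∧ codeDisp ev v = 1 ∧ ((codePos ev v).map Prod.fst).Nodup
  let tl : List (CycStep I Q) → Finset G := fun v => ((codePos ev v).map Prod.fst).toFinset
  have htl : ∀ v g, g ∈ tl v ↔ ∃ s, (g, s) ∈ codePos ev v := by
    intro v g
    simp [tl]
  have htlcard : ∀ v, Valid v → (tl v).card = 2 * v.length := by
    intro v hv
    rw [List.toFinset_card_of_nodup hv.2.2, List.length_map, length_codePos]
  let C : ℕ → Set X → Set X := fun i A => {x | Valid (code i) ∧ ∀ p ∈ codePos ev (code i),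
    p.1 • x ∈ A ∧ L (p.1 • x) = some p.2}
  have hC : ∀ i A, MeasurableSet A → MeasurableSet (C i A) := by
    intro i A hA
    by_cases hv : Valid (code i)
    · have : C i A = ⋂ p ∈ (codePos ev (code i)).toFinset, (fun x => p.1 • x) ⁻¹'
          (A ∩ {x | L x = some p.2}) := by
        ext x
        simp only [C, hv, true_and, Set.mem_ofPred_eq, Set.mem_iInter, List.mem_toFinset]
        rfl
      rw [this]
      exact Finset.measurableSet_biInter _ fun p _ => measurable_const_smul p.1 (hA.inter (hL _))
    · have : C i A = ∅ := by
        ext x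
        simp [C, hv]
      rw [this]
      exact MeasurableSet.empty
  obtain ⟨p, A, R, hA0, hA, hR, hAs, hRC, hRd, hRex⟩ :=
    exists_greedy hfree hW₀ (fun i => tl (code i)) C hC
  have hanti := greedy_antitone hAs
  have hAL : ∀ n, ∀ x ∈ A n, L x ≠ none := fun n x hx => by
    have := hanti (Nat.zero_le n) hx
    rwa [hA0] at this
  have htilA : ∀ n, tiles (tl (code (p n))) (R n) ⊆ A n := by
    intro n x hx
    obtain ⟨g, hg, r, hr, rfl⟩ := mem_tiles.1 hx
    obtain ⟨s, hs⟩ := (htl _ _).1 hg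
    exact ((hRC n hr).2 _ hs).1
  have hRtil : ∀ n, R n ⊆ tiles (tl (code (p n))) (R n) := by
    intro n x hx
    obtain ⟨s, hs⟩ := one_mem_codePos (ev := ev) (hRC n hx).1.1
    exact mem_tiles.2 ⟨1, (htl _ _).2 ⟨s, hs⟩, x, hx, one_smul _ _⟩
  have htdisj : ∀ n n', n < n' → Disjoint (tiles (tl (code (p n))) (R n)) (A n') := by
    intro n n' hn
    refine Set.disjoint_left.2 fun x hx hx' => ?_
    have := hanti (show n + 1 ≤ n' from hn) hx'
    rw [hAs] at this
    exact this.2 hx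
  have hac : ∀ m y, ¬ AltCycle (⋂ n, A n) κ true m y := by
    intro m y hy
    obtain ⟨v, hv1, hv2, hv3, hv4⟩ := exists_code_of_altCycle ev hfree
      (fun x hx => hAL 0 x (Set.mem_iInter.1 hx 0)) hη (fun x _ y _ => hτ x y) hy
    obtain ⟨i, rfl⟩ := hcode v
    obtain ⟨n, -, hn, hn'⟩ := hRex i (y 0) 0
    have hyR : y 0 ∈ R n := hn' ⟨⟨hv1, hv2, hv3⟩, fun q hq =>
      ⟨Set.mem_iInter.1 (hv4 q hq).1 n, (hv4 q hq).2⟩⟩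
    exact Set.disjoint_left.1 (htdisj n (n + 1) (Nat.lt_succ_self n)) (hRtil n hyR)
      (Set.mem_iInter.1 (hy.2.1 0) (n + 1))
  by_cases hlarge : 8 * μ Y < μ (⋂ n, A n)
  · left
    obtain ⟨B, T, hB, hBW, hB0, hT⟩ := exists_freeOn_of_acyclic hfree μ (MeasurableSet.iInter hA)
      hY hκ hκo (fun b x _ => hκY b x) Q' (fun b x hx y hy => hQ' b x y
        (hAL 0 x (Set.mem_iInter.1 hx 0)) (hAL 0 y (Set.mem_iInter.1 hy 0))) hlarge hac
    exact ⟨B, T, hB, fun x hx => hAL 0 x (Set.mem_iInter.1 (hBW hx) 0), hB0, hT⟩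
  right
  obtain ⟨m, hm⟩ : ∃ m, μ (A m) ≤ 9 * μ Y := by
    have ht := tendsto_measure_iInter_atTop (μ := μ) (fun n => (hA n).nullMeasurableSet) hanti
      ⟨0, measure_ne_top _ _⟩
    have hlt : μ (⋂ n, A n) < 9 * μ Y := by
      refine (not_lt.1 hlarge).trans_lt ?_
      exact ENNReal.mul_lt_mul_left hY0.ne' (measure_ne_top _ _) (by norm_num)
    obtain ⟨m, hm⟩ := (ht.eventually_lt_const hlt).exists
    exact ⟨m, hm.le⟩
  let z : X → Option (I ⊕ List (CycStep I Q)) := fun x =>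
    if h : ∃ n < m, x ∈ R n then some (Sum.inr (code (p h.choose)))
    else if x ∈ A m then (L x).map Sum.inl else none
  have hRu : ∀ n n' x, x ∈ R n → x ∈ R n' → n = n' := by
    intro n n' x hx hx'
    rcases lt_trichotomy n n' with h | h | h
    · exact absurd (htilA _ (hRtil _ hx')) (Set.disjoint_left.1 (htdisj _ _ h) (hRtil _ hx))
    · exact h
    · exact absurd (htilA _ (hRtil _ hx)) (Set.disjoint_left.1 (htdisj _ _ h) (hRtil _ hx'))
  have hRA : ∀ n < m, ∀ x ∈ R n, x ∉ A m := fun n hn x hx =>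
    Set.disjoint_left.1 (htdisj n m hn) (hRtil n hx)
  have hz1 : ∀ n < m, ∀ x ∈ R n, z x = some (Sum.inr (code (p n))) := by
    intro n hn x hx
    have h : ∃ n < m, x ∈ R n := ⟨n, hn, hx⟩
    simp only [z, dif_pos h]
    rw [hRu _ _ x h.choose_spec.2 hx]
  have hzr : ∀ x v, z x = some (Sum.inr v) ↔ ∃ n < m, code (p n) = v ∧ x ∈ R n := by
    intro x v
    constructor
    · intro h
      by_cases h' : ∃ n < m, x ∈ R n
      · obtain ⟨n, hn, hx⟩ := h'
        rw [hz1 n hn x hx] at h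
        exact ⟨n, hn, by simpa using h, hx⟩
      · simp only [z, dif_neg h'] at h
        split_ifs at h
        simp at h
    · rintro ⟨n, hn, rfl, hx⟩
      exact hz1 n hn x hx
  have hzl : ∀ x s, z x = some (Sum.inl s) ↔ x ∈ A m ∧ L x = some s := by
    intro x s
    by_cases h' : ∃ n < m, x ∈ R n
    · obtain ⟨n, hn, hx⟩ := h'
      rw [hz1 n hn x hx]
      simp [hRA n hn x hx]
    · simp only [z, dif_neg h']
      by_cases hx : x ∈ A m
      · simp [hx]
      · simp [hx]
  have hzrm : ∀ v, MeasurableSet {x | z x = some (Sum.inr v)} := by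
    intro v
    have : {x | z x = some (Sum.inr v)} = ⋃ (n : ℕ) (_ : n < m ∧ code (p n) = v), R n := by
      ext x
      simp [hzr, and_assoc]
    rw [this]
    exact MeasurableSet.iUnion fun n => MeasurableSet.iUnion fun _ => hR n
  have hzlm : ∀ s, MeasurableSet {x | z x = some (Sum.inl s)} := by
    intro s
    have : {x | z x = some (Sum.inl s)} = A m ∩ {x | L x = some s} := by
      ext x
      simp [hzl]
    rw [this]
    exact (hA m).inter (hL _)
  let J := ((Finset.range m).image fun n => code (p n)).filter Valid
  refine ⟨z, J, ?_, ?_, ?_, ?_, ?_, ?_⟩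
  · rintro (_ | (s | v))
    · have : {x | z x = none} = (⋃ o, {x | z x = some o})ᶜ := by
        ext x
        cases hx : z x <;> simp [hx]
      rw [this]
      refine (MeasurableSet.iUnion ?_).compl
      rintro (s | v)
      · exact hzlm s
      · exact hzrm v
    · exact hzlm s
    · exact hzrm v
  · intro v hv
    have := (Finset.mem_filter.1 hv).2
    exact ⟨this.1, this.2.1⟩
  · intro x v hx
    obtain ⟨n, hn, rfl, hxR⟩ := (hzr x v).1 hx
    exact Finset.mem_filter.2 ⟨Finset.mem_image.2 ⟨n, Finset.mem_range.2 hn, rfl⟩, (hRC n hxR).1⟩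
  · intro x s
    constructor
    · intro hx
      by_cases hxm : x ∈ A m
      · exact Or.inl ((hzl x s).2 ⟨hxm, hx⟩)
      · right
        have hx0 : x ∈ A 0 := by rw [hA0]; simp [hx]
        have hex : ∃ n, x ∉ A n := ⟨m, hxm⟩
        obtain ⟨n, hn⟩ : ∃ n, Nat.find hex = n + 1 :=
          Nat.exists_eq_succ_of_ne_zero fun e => Nat.find_spec hex (by rw [e]; exact hx0)
        have hnm : n < m := by
          have := Nat.find_min' hex hxm
          omega
        have h1 : x ∈ A n := not_not.1 (Nat.find_min hex (m := n) (by omega))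
        have h2 := Nat.find_spec hex
        rw [hn, hAs] at h2
        have h3 : x ∈ tiles (tl (code (p n))) (R n) := by
          by_contra h
          exact h2 ⟨h1, h⟩
        obtain ⟨g, hg, r, hr, rfl⟩ := mem_tiles.1 h3
        obtain ⟨s', hs'⟩ := (htl _ _).1 hg
        have h4 := ((hRC n hr).2 _ hs').2
        simp only at h4
        rw [hx, Option.some_inj] at h4
        subst h4
        exact ⟨_, g, hs', by rw [inv_smul_smul]; exact hz1 n hnm r hr⟩
    · rintro (h | ⟨v, g, hg, h⟩)
      · exact ((hzl x s).1 h).2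
      · obtain ⟨n, hn, rfl, hxR⟩ := (hzr _ v).1 h
        have := ((hRC n hxR).2 _ hg).2
        simpa using this
  · refine (measure_mono ?_).trans hm
    rintro x ⟨s, hs⟩
    exact ((hzl x s).1 hs).1
  · have hle : ∀ v ∈ J, ((2 * v.length : ℕ) : ℝ≥0∞) * μ {x | z x = some (Sum.inr v)} ≤
        ∑ n ∈ (Finset.range m).filter (fun n => code (p n) = v),
          μ (tiles (tl (code (p n))) (R n)) := by
      intro v hv
      have hval := (Finset.mem_filter.1 hv).2
      have : {x | z x = some (Sum.inr v)}
          = ⋃ n ∈ (Finset.range m).filter (fun n => code (p n) = v), R n := by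
        ext x
        simp [hzr, and_assoc]
      rw [this]
      refine (mul_le_mul_right (measure_biUnion_finset_le _ _) _).trans ?_
      rw [Finset.mul_sum]
      refine Finset.sum_le_sum fun n hn => ?_
      rw [measure_tiles hfree μ (hR n) (hRd n), (Finset.mem_filter.1 hn).2, htlcard v hval]
    refine (Finset.sum_le_sum hle).trans ?_
    have hfib : ∑ v ∈ J, ∑ n ∈ (Finset.range m).filter (fun n => code (p n) = v),
        μ (tiles (tl (code (p n))) (R n)) ≤
        ∑ v ∈ (Finset.range m).image (fun n => code (p n)),
          ∑ n ∈ (Finset.range m).filter (fun n => code (p n) = v),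
          μ (tiles (tl (code (p n))) (R n)) :=
      Finset.sum_le_sum_of_subset (Finset.filter_subset _ _)
    refine hfib.trans ?_
    rw [Finset.sum_fiberwise_of_maps_to fun n hn => Finset.mem_image_of_mem _ hn,
      ← measure_biUnion_finset]
    · refine measure_mono (Set.iUnion₂_subset fun n _ => ?_)
      exact fun x hx => hAL n x (htilA n hx)
    · intro n _ n' _ hnn
      rcases lt_or_gt_of_ne hnn with h | h
      · exact (htdisj n n' h).mono_right (htilA n')
      · exact ((htdisj n' n h).mono_right (htilA n)).symm
    · exact fun n _ => measurableSet_tiles _ (hR n)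

end Cycles

section Naming

/-- Names over a finite alphabet with Kraft weights can be rewritten injectively with few
letters. -/
lemma exists_code {P V I : Type*} [Fintype P] [Fintype V] [Fintype I] {l : V → ℝ}
    (hl : ∑ v, Real.exp (-l v) ≤ 1) {Λ : ℝ} (hΛ : 0 < Λ) (hI : Real.exp Λ = Fintype.card I)
    (hlΛ : ∀ v, l v ≤ Λ) :
    ∃ code : (P → V) → P → Option I, Function.Injective code ∧
      ∀ w, (Nat.card {p // code w p ≠ none} : ℝ) ≤ (∑ p, l (w p)) / Λ + 1 := by
  classical
  have hl0 : ∀ v, 0 ≤ l v := by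
    intro v
    have := (Finset.single_le_sum (f := fun v => Real.exp (-l v))
      (fun v _ => (Real.exp_pos _).le) (Finset.mem_univ v)).trans hl
    have := Real.exp_le_one_iff.1 this
    linarith
  let c : (P → V) → ℝ := fun w => ∑ p, l (w p)
  have hc0 : ∀ w, 0 ≤ c w := fun w => Finset.sum_nonneg fun p _ => hl0 _
  let n : (P → V) → ℕ := fun w => ⌈c w / Λ⌉₊
  have hnP : ∀ w, n w ≤ Fintype.card P := by
    intro w
    apply Nat.ceil_le.2
    rw [div_le_iff₀ hΛ]
    calc c w ≤ ∑ _p : P, Λ := Finset.sum_le_sum fun p _ => hlΛ _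
      _ = _ := by simp
  have hsum : ∑ w : P → V, Real.exp (-c w) ≤ 1 := by
    have : ∑ w : P → V, Real.exp (-c w) = (∑ v, Real.exp (-l v)) ^ Fintype.card P := by
      rw [← Finset.card_univ, ← Finset.prod_const, Finset.prod_univ_sum]
      simp only [Fintype.piFinset_univ]
      refine Finset.sum_congr rfl fun w _ => ?_
      rw [← Real.exp_sum]
      simp [c]
    rw [this]
    exact pow_le_one₀ (Finset.sum_nonneg fun v _ => (Real.exp_pos _).le) hl
  have hcard : ∀ k : ℕ, Nonempty ({w : P → V // n w = k} ↪ (Fin k → I)) := by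
    intro k
    apply Function.Embedding.nonempty_of_card_le
    have h1 : (Fintype.card {w : P → V // n w = k} : ℝ) * Real.exp (-(k * Λ)) ≤ 1 := by
      calc (Fintype.card {w : P → V // n w = k} : ℝ) * Real.exp (-(k * Λ))
          = ∑ w ∈ Finset.univ.filter (fun w : P → V => n w = k), Real.exp (-(k * Λ)) := by
            rw [Finset.sum_const, nsmul_eq_mul, Fintype.card_subtype]
        _ ≤ ∑ w ∈ Finset.univ.filter (fun w : P → V => n w = k), Real.exp (-c w) := by
            refine Finset.sum_le_sum fun w hw => ?_
            apply Real.exp_le_exp.2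
            have : c w / Λ ≤ k := by
              rw [← (Finset.mem_filter.1 hw).2]
              exact Nat.le_ceil _
            rw [div_le_iff₀ hΛ] at this
            linarith
        _ ≤ ∑ w : P → V, Real.exp (-c w) :=
            Finset.sum_le_sum_of_subset_of_nonneg (Finset.filter_subset _ _)
              fun w _ _ => (Real.exp_pos _).le
        _ ≤ 1 := hsum
    have h2 : (Fintype.card {w : P → V // n w = k} : ℝ) ≤ Fintype.card (Fin k → I) := by
      rw [Real.exp_neg, ← div_eq_mul_inv, div_le_one (Real.exp_pos _)] at h1
      refine h1.trans_eq ?_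
      rw [Real.exp_nat_mul, hI]
      simp
    exact_mod_cast h2
  have emb := fun k => (hcard k).some
  let e := Fintype.equivFin P
  let code : (P → V) → P → Option I := fun w p =>
    if h : (e p : ℕ) < n w then some (emb (n w) ⟨w, rfl⟩ ⟨e p, h⟩) else none
  have hne : ∀ w p, code w p ≠ none ↔ (e p : ℕ) < n w := by
    intro w p
    by_cases h : (e p : ℕ) < n w <;> simp [code, h]
  have hcode : ∀ k w (hk : n w = k) p (h : (e p : ℕ) < k),
      code w p = some (emb k ⟨w, hk⟩ ⟨e p, h⟩) := by
    intro k w hk p h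
    subst hk
    simp only [code, dif_pos h]
  have hnum : ∀ w, Nat.card {p // code w p ≠ none} = n w := by
    intro w
    have e1 : {p // code w p ≠ none} ≃ Fin (n w) :=
      { toFun := fun p => ⟨e p.1, (hne w p.1).1 p.2⟩
        invFun := fun i => ⟨e.symm ⟨i, i.2.trans_le (hnP w)⟩, (hne w _).2 (by simp)⟩
        left_inv := fun p => by simp
        right_inv := fun i => by simp }
    rw [Nat.card_congr e1, Nat.card_fin]
  refine ⟨code, ?_, ?_⟩
  · intro w w' h
    have hn : n w = n w' := by rw [← hnum w, ← hnum w', h]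
    have key : ∀ k (hk : n w = k) (hk' : n w' = k), w = w' := by
      intro k hk hk'
      have : emb k ⟨w, hk⟩ = emb k ⟨w', hk'⟩ := by
        funext i
        have hi := congrFun h (e.symm ⟨i, (i.2.trans_eq hk.symm).trans_le (hnP w)⟩)
        rw [hcode k w hk _ (by simp), hcode k w' hk' _ (by simp)] at hi
        simpa using hi
      have := (emb k).injective this
      exact congrArg Subtype.val this
    exact key _ rfl hn.symm
  · intro w
    rw [hnum]
    exact (Nat.ceil_lt_add_one (div_nonneg (hc0 w) hΛ.le)).le

end Naming

section Codes

variable {G X : Type*} [Group G] [MulAction G X]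

/-- The invariant σ-algebra generated by a labelling. -/
abbrev codeAlg (G : Type*) {X A : Type*} [Group G] [MulAction G X] (φ : X → A) :
    MeasurableSpace X :=
  sigmaG G (Set.range fun a => φ ⁻¹' {a})

lemma measurableSet_codeAlg_smul {A : Type*} (φ : X → A) (g : G) (a : A) :
    MeasurableSet[codeAlg G φ] {x | φ (g • x) = a} :=
  MeasurableSpace.measurableSet_generateFrom ⟨g, φ ⁻¹' {a}, ⟨a, rfl⟩, rfl⟩

/-- A labelling determined by a finite window of another one is measurable for its
σ-algebra. -/
lemma measurableSet_codeAlg_of_window {A B : Type*} [Finite A] {φ : X → A} {ψ : X → B}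
    (E : Finset G) (h : ∀ x x', (∀ e ∈ E, φ (e • x) = φ (e • x')) → ψ x = ψ x') (o : B) :
    MeasurableSet[codeAlg G φ] {x | ψ x = o} := by
  have : {x | ψ x = o} = ⋃ w ∈ {w : E → A | ∃ x, ψ x = o ∧ ∀ e : E, φ ((e : G) • x) = w e},
      ⋂ e : E, {x | φ ((e : G) • x) = w e} := by
    ext x
    simp only [Set.mem_ofPred_eq, Set.mem_iUnion, Set.mem_iInter, exists_prop]
    constructor
    · intro hx
      exact ⟨fun e => φ ((e : G) • x), ⟨x, hx, fun _ => rfl⟩, fun _ => rfl⟩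
    · rintro ⟨w, ⟨x', hx', hw'⟩, hw⟩
      rw [← hx']
      exact h _ _ fun e he => (hw ⟨e, he⟩).trans (hw' ⟨e, he⟩).symm
  rw [this]
  refine @Set.Finite.measurableSet_biUnion _ _ (codeAlg G φ) _ _ (Set.toFinite _) fun w _ => ?_
  exact @MeasurableSet.iInter _ _ (codeAlg G φ) _ _ fun e => measurableSet_codeAlg_smul φ _ _

lemma codeAlg_le_of_window {A B : Type*} [Finite A] {φ : X → A} {ψ : X → B}
    (E : Finset G) (h : ∀ x x', (∀ e ∈ E, φ (e • x) = φ (e • x')) → ψ x = ψ x') :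
    codeAlg G ψ ≤ codeAlg G φ := by
  classical
  apply MeasurableSpace.generateFrom_le
  rintro _ ⟨g, _, ⟨o, rfl⟩, rfl⟩
  refine measurableSet_codeAlg_of_window (φ := φ) (ψ := fun x => ψ (g • x))
    (E.image fun e => e * g) (fun x x' hx => h _ _ fun e he => ?_) o
  simpa [mul_smul] using hx (e * g) (Finset.mem_image_of_mem _ he)

lemma codeAlg_le {A : Type*} [MeasurableSpace X] [MeasurableConstSMul G X] {φ : X → A}
    (h : ∀ a, MeasurableSet {x | φ x = a}) : codeAlg G φ ≤ ‹MeasurableSpace X› := by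
  apply MeasurableSpace.generateFrom_le
  rintro _ ⟨g, _, ⟨o, rfl⟩, rfl⟩
  exact measurable_const_smul g (h o)

end Codes

section Cost

variable {X : Type*} [MeasurableSpace X] (μ : Measure X)

/-- The labelling `φ` has a measurable weighting with Kraft sum at most one and expected weight at
most `c`. -/
def HasCost {A : Type*} [Fintype A] (φ : X → A) (c : ℝ) : Prop :=
  (∀ a, MeasurableSet {x | φ x = a}) ∧
    ∃ l : A → ℝ, ∑ a, Real.exp (-l a) ≤ 1 ∧ ∑ a, l a * μ.real {x | φ x = a} ≤ c

variable {μ}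

lemma HasCost.prod [IsFiniteMeasure μ] {A B : Type*} [Fintype A] [Fintype B] {φ : X → A}
    {ψ : X → B} {c d : ℝ} (h : HasCost μ φ c) (h' : HasCost μ ψ d) :
    HasCost μ (fun x => (φ x, ψ x)) (c + d) := by
  obtain ⟨hm, l, hl, hc⟩ := h
  obtain ⟨hm', l', hl', hd⟩ := h'
  have hpair : ∀ a b, {x | (φ x, ψ x) = (a, b)} = {x | φ x = a} ∩ {x | ψ x = b} := by
    intro a b
    ext x
    simp
  have hsum : ∀ s : Set X, MeasurableSet s →
      ∑ b, μ.real (s ∩ {x | ψ x = b}) = μ.real s := by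
    intro s hs
    rw [← measureReal_biUnion_finset]
    · congr 1
      ext x
      simp
    · intro b _ b' _ hbb
      exact Set.disjoint_left.2 fun x hx hx' => hbb (hx.2.symm.trans hx'.2)
    · exact fun b _ => hs.inter (hm' b)
  have hsum' : ∀ s : Set X, MeasurableSet s →
      ∑ a, μ.real ({x | φ x = a} ∩ s) = μ.real s := by
    intro s hs
    rw [← measureReal_biUnion_finset]
    · congr 1
      ext x
      simp
    · intro b _ b' _ hbb
      exact Set.disjoint_left.2 fun x hx hx' => hbb (hx.1.symm.trans hx'.1)
    · exact fun b _ => (hm b).inter hs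
  refine ⟨fun p => hpair p.1 p.2 ▸ (hm p.1).inter (hm' p.2), fun p => l p.1 + l' p.2, ?_, ?_⟩
  · rw [Fintype.sum_prod_type]
    simp only [neg_add, Real.exp_add, ← Finset.mul_sum, ← Finset.sum_mul]
    exact mul_le_one₀ hl (Finset.sum_nonneg fun _ _ => (Real.exp_pos _).le) hl'
  · rw [Fintype.sum_prod_type]
    simp only [hpair, add_mul, Finset.sum_add_distrib, ← Finset.mul_sum]
    rw [Finset.sum_comm (f := fun a b => l' b * μ.real ({x | φ x = a} ∩ {x | ψ x = b}))]
    simp only [← Finset.mul_sum]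
    refine add_le_add ((Finset.sum_congr rfl fun a _ => ?_).trans_le hc)
      ((Finset.sum_congr rfl fun b _ => ?_).trans_le hd)
    · rw [hsum _ (hm a)]
    · rw [hsum' _ (hm' b)]

lemma HasCost.equiv {A B : Type*} [Fintype A] [Fintype B] {φ : X → A} {c : ℝ}
    (h : HasCost μ φ c) (e : A ≃ B) : HasCost μ (fun x => e (φ x)) c := by
  obtain ⟨hm, l, hl, hc⟩ := h
  have he : ∀ b, {x | e (φ x) = b} = {x | φ x = e.symm b} := by
    intro b
    ext x
    simp [Equiv.eq_symm_apply]
  refine ⟨fun b => he b ▸ hm _, fun b => l (e.symm b), ?_, ?_⟩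
  · rwa [Equiv.sum_comp e.symm (fun a => Real.exp (-l a))]
  · simp only [he]
    rwa [Equiv.sum_comp e.symm (fun a => l a * μ.real {x | φ x = a})]

lemma HasCost.mono {A : Type*} [Fintype A] {φ : X → A} {c d : ℝ}
    (h : HasCost μ φ c) (hcd : c ≤ d) : HasCost μ φ d :=
  ⟨h.1, h.2.imp fun _ hl => ⟨hl.1, hl.2.trans hcd⟩⟩

open Classical in
/-- The cost of the indicator of a small set. -/
lemma hasCost_indicator [IsProbabilityMeasure μ] {Y : Set X} (hY : MeasurableSet Y) {d : ℝ}
    (hd : 1 < d) (hYd : μ.real Y ≤ 1 / d) :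
    HasCost μ (fun x => decide (x ∈ Y)) (Real.log d / d + 1 / (d - 1)) := by
  have h1 : ∀ b, {x | decide (x ∈ Y) = b} = if b then Y else Yᶜ := by
    intro b
    ext x
    cases b <;> simp
  refine ⟨fun b => ?_, fun b => if b then Real.log d else -Real.log (1 - 1 / d), ?_, ?_⟩
  · rw [h1]
    split_ifs
    exacts [hY, hY.compl]
  · have : 0 < 1 - 1 / d := by
      rw [sub_pos, div_lt_one (by linarith)]
      exact hd
    simp only [Fintype.sum_bool, if_true, Bool.false_eq_true, if_false, neg_neg]
    rw [Real.exp_neg, Real.exp_log (by linarith), Real.exp_log this]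
    simp
  · have h0 : 0 < 1 - 1 / d := by
      rw [sub_pos, div_lt_one (by linarith)]
      exact hd
    have hlog : -Real.log (1 - 1 / d) ≤ 1 / (d - 1) := by
      rw [← Real.log_inv]
      refine (Real.log_le_sub_one_of_pos (inv_pos.2 h0)).trans_eq ?_
      have : d - 1 ≠ 0 := by linarith
      have : d ≠ 0 := by linarith
      field_simp
      ring
    simp only [Fintype.sum_bool, h1, if_true, Bool.false_eq_true, if_false]
    have hlog0 : 0 ≤ Real.log d := Real.log_nonneg hd.le
    refine add_le_add ?_ ?_
    · calc Real.log d * μ.real Y ≤ Real.log d * (1 / d) := by gcongr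
        _ = _ := by ring
    · calc -Real.log (1 - 1 / d) * μ.real Yᶜ ≤ 1 / (d - 1) * 1 := by
            have : 0 ≤ 1 / (d - 1) := by apply div_nonneg <;> linarith
            gcongr
            exact measureReal_le_one
        _ = _ := by ring

end Cost

section Cells

open Pointwise

variable {G X : Type*} [Group G] [Countable G] [MeasurableSpace X] [StandardBorelSpace X]
  [MulAction G X] [MeasurableConstSMul G X]

omit [Countable G] in
/-- A sparse Borel set meeting every translate window. -/
lemma exists_maximal_separated [DecidableEq G] (hfree : ∀ (g : G) (x : X), g • x = x → g = 1)
    (μ : Measure X) [IsProbabilityMeasure μ] [SMulInvariantMeasure G X μ] {D : Finset G}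
    (hD : D.Nonempty) : ∃ Y : Set X, MeasurableSet Y ∧ 0 < μ Y ∧ D.card * μ Y ≤ 1 ∧
      ∀ x, ∃ f ∈ D⁻¹ * D, f • x ∈ Y := by
  set F := D⁻¹ * D with hF
  have h1F : (1 : G) ∈ F := by
    obtain ⟨q, hq⟩ := hD
    exact Finset.mem_mul.2 ⟨q⁻¹, Finset.inv_mem_inv hq, q, hq, by simp⟩
  have hFinv : ∀ f ∈ F, f⁻¹ ∈ F := by
    intro f hf
    obtain ⟨a, ha, b, hb, rfl⟩ := Finset.mem_mul.1 hf
    exact Finset.mem_mul.2 ⟨b⁻¹, Finset.inv_mem_inv hb, a⁻¹, Finset.mem_inv'.1 ha, by simp⟩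
  obtain ⟨p, A, R, hA0, hA, hR, hAs, hRA, hdisj, hev⟩ :=
    exists_greedy hfree (MeasurableSet.univ : MeasurableSet (Set.univ : Set X)) (fun _ => F)
      (fun _ A => A) (fun _ _ h => h)
  have hanti : ∀ n m, n ≤ m → A m ⊆ A n := by
    intro n m hnm
    induction m, hnm using Nat.le_induction with
    | base => exact subset_rfl
    | succ m _ ih =>
      rw [hAs]
      exact Set.sdiff_subset.trans ih
  have hcov : ∀ x, ∃ f ∈ F, f • x ∈ ⋃ n, R n := by
    intro x
    by_cases hx : ∀ n, x ∈ A n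
    · obtain ⟨n, -, -, hn⟩ := hev 0 x 0
      exact ⟨1, h1F, by simpa using ⟨n, hn (hx n)⟩⟩
    · have : ∃ n, x ∉ A n := by push Not at hx; exact hx
      classical
      have hn := Nat.find_spec this
      have hmin := fun m (hm : m < Nat.find this) => Nat.find_min this hm
      set n := Nat.find this
      rcases hn0 : n with _ | m
      · rw [hn0, hA0] at hn
        exact absurd trivial hn
      · have hm : x ∈ A m := by
          by_contra h
          exact hmin m (by omega) h
        rw [hn0, hAs] at hn
        have : x ∈ tiles F (R m) := by
          by_contra h
          exact hn ⟨hm, h⟩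
        obtain ⟨q, hq, r, hr, rfl⟩ := mem_tiles.1 this
        exact ⟨q⁻¹, hFinv q hq, Set.mem_iUnion.2 ⟨m, by simpa using hr⟩⟩
  have hsep : ∀ n m, n ≤ m → ∀ y ∈ R n, ∀ y' ∈ R m, ∀ f ∈ F, y' = f • y → y = y' := by
    intro n m hnm y hy y' hy' f hf h
    rcases hnm.eq_or_lt with rfl | hlt
    · exact (hdisj n y' hy' y hy 1 h1F f hf (by simpa using h)).symm
    · have h2 := hanti (n + 1) m hlt (hRA m hy')
      rw [hAs] at h2
      exact absurd (mem_tiles.2 ⟨f, hf, y, hy, h.symm⟩) h2.2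
  have hYm : MeasurableSet (⋃ n, R n) := MeasurableSet.iUnion hR
  refine ⟨⋃ n, R n, hYm, ?_, ?_, hcov⟩
  · rw [pos_iff_ne_zero]
    intro h0
    have h2 : (Set.univ : Set X) ⊆ ⋃ f ∈ F, (fun x => f • x) ⁻¹' ⋃ n, R n := by
      intro x _
      simpa using hcov x
    have h3 : μ (⋃ f ∈ F, (fun x => f • x) ⁻¹' ⋃ n, R n) = 0 := by
      refine (measure_biUnion_null_iff F.countable_toSet).2 fun f _ => ?_
      rw [measure_preimage_smul, h0]
    have := measure_mono_null h2 h3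
    simp at this
  · rw [← measure_tiles hfree μ hYm]
    · exact prob_le_one
    · intro y hy y' hy' q hq q' hq' h
      obtain ⟨n, hn⟩ := Set.mem_iUnion.1 hy
      obtain ⟨m, hm⟩ := Set.mem_iUnion.1 hy'
      have e1 : y = (q⁻¹ * q') • y' := by
        rw [mul_smul, ← h, inv_smul_smul]
      have e2 : y' = (q'⁻¹ * q) • y := by
        rw [mul_smul, h, inv_smul_smul]
      rcases le_total n m with hnm | hnm
      · exact hsep n m hnm y hn y' hm _
          (Finset.mul_mem_mul (Finset.inv_mem_inv hq') hq) e2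
      · exact (hsep m n hnm y' hm y hn _
          (Finset.mul_mem_mul (Finset.inv_mem_inv hq) hq') e1).symm

omit [Countable G] [MeasurableSpace X] [StandardBorelSpace X] [MeasurableConstSMul G X] in
/-- Equivariant choice of a point of `Y` in the window of each point. -/
lemma exists_cell_map {Y : Set X} {F : Finset G} (hY : ∀ x, ∃ f ∈ F, f • x ∈ Y) :
    ∃ b : X → G, (∀ x, b x ∈ F) ∧ (∀ x, b x • x ∈ Y) ∧
      ∀ x x', (∀ e ∈ F, e • x ∈ Y ↔ e • x' ∈ Y) → b x = b x' := by
  classical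
  let s : X → Finset G := fun x => F.filter fun f => f • x ∈ Y
  have hs : ∀ x, (s x).Nonempty := fun x => by
    obtain ⟨f, hf, h⟩ := hY x
    exact ⟨f, Finset.mem_filter.2 ⟨hf, h⟩⟩
  let ch : Finset G → G := fun s => if h : s.Nonempty then h.choose else 1
  have hch : ∀ x, ch (s x) ∈ s x := by
    intro x
    simp only [ch, dif_pos (hs x)]
    exact (hs x).choose_spec
  refine ⟨fun x => ch (s x), fun x => (Finset.mem_filter.1 (hch x)).1,
    fun x => (Finset.mem_filter.1 (hch x)).2, fun x x' h => ?_⟩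
  have : s x = s x' := Finset.filter_congr h
  simp only [this]

lemma lintegral_fintype_comp {X V : Type*} [MeasurableSpace X] [Fintype V] (μ : Measure X)
    {γ : X → V} (hγ : ∀ v, MeasurableSet {x | γ x = v}) (f : V → ℝ≥0∞) :
    ∫⁻ x, f (γ x) ∂μ = ∑ v, f v * μ {x | γ x = v} := by
  classical
  have : ∀ x, f (γ x) = ∑ v, {x | γ x = v}.indicator (fun _ => f v) x := by
    intro x
    rw [Finset.sum_eq_single (γ x)]
    · simp
    · intro v _ hv
      exact Set.indicator_of_notMem (fun h => hv (Eq.symm h)) _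
    · simp
  simp only [this]
  rw [lintegral_finsetSum _ fun v _ => measurable_const.indicator (hγ v)]
  simp [hγ]

omit [StandardBorelSpace X] in
/-- A finite labelling is rewritten by letters, few per unit of cost. -/
lemma exists_naming [DecidableEq G] {V I : Type*} [Fintype V] [Fintype I] (μ : Measure X)
    [IsProbabilityMeasure μ] [SMulInvariantMeasure G X μ] {γ : X → V}
    (hγ : ∀ v, MeasurableSet {x | γ x = v})
    {l : V → ℝ} (hl : ∑ v, Real.exp (-l v) ≤ 1) {Λ : ℝ} (hΛ : 0 < Λ)
    (hI : Real.exp Λ = Fintype.card I) (hlΛ : ∀ v, l v ≤ Λ) {Y : Set X} (hY : MeasurableSet Y)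
    {F : Finset G} (hF : ∀ f ∈ F, f⁻¹ ∈ F) {b : X → G} (hbF : ∀ x, b x ∈ F)
    (hbY : ∀ x, b x • x ∈ Y)
    (hb : ∀ x x', (∀ e ∈ F, e • x ∈ Y ↔ e • x' ∈ Y) → b x = b x') :
    ∃ L : X → Option I, (∀ o, MeasurableSet {x | L x = o}) ∧
      (∃ E : Finset G, ∀ x x', (∀ e ∈ E, (e • x ∈ Y ↔ e • x' ∈ Y) ∧ L (e • x) = L (e • x')) →
        γ x = γ x') ∧
      μ {x | L x ≠ none} ≤
        ENNReal.ofReal ((∑ v, l v * μ.real {x | γ x = v}) / Λ) + μ Y := by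
  classical
  choose code hcode1 hcode2 using fun P : Finset G => exists_code (P := P) hl hΛ hI hlΛ
  have hl0 : ∀ v, 0 ≤ l v := by
    intro v
    have := (Finset.single_le_sum (f := fun v => Real.exp (-l v))
      (fun v _ => (Real.exp_pos _).le) (Finset.mem_univ v)).trans hl
    have := Real.exp_le_one_iff.1 this
    linarith
  let P : X → Finset G := fun y => F.filter fun g => b (g • y) = g⁻¹
  let Lf : Finset G → (G → V) → G → Option I := fun P w g =>
    if h : g ∈ P then code P (fun p => w p) ⟨g, h⟩ else none
  let L : X → Option I := fun x => Lf (P (b x • x)) (fun p => γ (p • b x • x)) (b x)⁻¹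
  have hmemP : ∀ x, (b x)⁻¹ ∈ P (b x • x) := by
    intro x
    simp only [P, Finset.mem_filter, inv_smul_smul, inv_inv, and_true]
    exact hF _ (hbF x)
  have hL : ∀ y, ∀ p ∈ P y, L (p • y) = Lf (P y) (fun p => γ (p • y)) p := by
    intro y p hp
    have h := (Finset.mem_filter.1 hp).2
    simp only [L, h, inv_smul_smul, inv_inv]
  let E : Finset G := F ∪ F * F ∪ F * F * F
  have hP : ∀ x x', (∀ e ∈ E, e • x ∈ Y ↔ e • x' ∈ Y) → b x = b x' ∧
      P (b x • x) = P (b x • x') := by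
    intro x x' h
    refine ⟨hb _ _ fun e he => h e (by simp [E, he]), Finset.filter_congr fun g hg => ?_⟩
    rw [hb (g • b x • x) (g • b x • x')]
    intro e he
    have := h (e * g * b x) (Finset.mem_union_right _
      (Finset.mul_mem_mul (Finset.mul_mem_mul he hg) (hbF x)))
    simpa [mul_smul] using this
  have hLm : ∀ o, MeasurableSet {x | L x = o} := by
    intro o
    refine codeAlg_le (G := G) (φ := fun x => (decide (x ∈ Y), γ x)) ?_ _
      (measurableSet_codeAlg_of_window E (fun x x' h => ?_) o)
    · rintro ⟨a, v⟩
      have : {x | (decide (x ∈ Y), γ x) = (a, v)} =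
          (if a then Y else Yᶜ) ∩ {x | γ x = v} := by
        ext x
        cases a <;> simp
      rw [this]
      refine MeasurableSet.inter ?_ (hγ v)
      split_ifs
      exacts [hY, hY.compl]
    · have hdec : ∀ e ∈ E, e • x ∈ Y ↔ e • x' ∈ Y := fun e he => by
        simpa using congrArg Prod.fst (h e he)
      have hg : ∀ e ∈ E, γ (e • x) = γ (e • x') := fun e he => congrArg Prod.snd (h e he)
      obtain ⟨h1, h2⟩ := hP x x' hdec
      simp only [L, ← h1, h2]
      have h3 : ∀ p ∈ P (b x • x'), γ (p • b x • x) = γ (p • b x • x') := by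
        intro p hp
        have := hg (p * b x) (Finset.mem_union_left _ (Finset.mem_union_right _
          (Finset.mul_mem_mul (Finset.mem_filter.1 hp).1 (hbF x))))
        simpa [mul_smul] using this
      simp only [Lf]
      split_ifs with h4
      · congr 1
        funext p
        exact h3 p p.2
      · rfl
  have htr : ∀ f : X → ℝ≥0∞, Measurable f →
      ∫⁻ x, f x ∂μ = ∫⁻ y, ∑ p ∈ P y, f (p • y) ∂μ := by
    intro f hf
    have hbm : ∀ g, MeasurableSet {x | b x = g} := by
      intro g
      refine codeAlg_le (G := G) (φ := fun x => decide (x ∈ Y)) ?_ _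
        (measurableSet_codeAlg_of_window F (fun x x' h => hb _ _ fun e he => ?_) g)
      · intro a
        have : {x | decide (x ∈ Y) = a} = if a then Y else Yᶜ := by
          ext x
          cases a <;> simp
        rw [this]
        split_ifs
        exacts [hY, hY.compl]
      · simpa using h e he
    rw [lintegral_eq_lintegral_tsum_transport μ hbm hf]
    refine lintegral_congr fun y => ?_
    rw [tsum_eq_sum (s := (P y)⁻¹)]
    · rw [Finset.sum_inv_index]
      refine Finset.sum_congr rfl fun p hp => ?_
      rw [inv_inv]
      have : p • y ∈ {x | b x = p⁻¹} := (Finset.mem_filter.1 hp).2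
      exact Set.indicator_of_mem this f
    · intro g hg
      refine Set.indicator_of_notMem (fun h => hg ?_) _
      have h : b (g⁻¹ • y) = g := h
      rw [Finset.mem_inv', Finset.mem_filter, inv_inv]
      exact ⟨hF _ (h ▸ hbF _), h⟩
  refine ⟨L, hLm, ⟨E, fun x x' h => ?_⟩, ?_⟩
  · obtain ⟨h1, h2⟩ := hP x x' fun e he => (h e he).1
    set f := b x
    have h3 : ∀ p ∈ P (f • x'), Lf (P (f • x')) (fun p => γ (p • f • x)) p =
        Lf (P (f • x')) (fun p => γ (p • f • x')) p := by
      intro p hp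
      rw [← hL (f • x') p hp, ← h2, ← hL (f • x) p (h2 ▸ hp)]
      have := (h (p * f) (Finset.mem_union_left _ (Finset.mem_union_right _
        (Finset.mul_mem_mul (Finset.mem_filter.1 hp).1 (hbF x))))).2
      simpa [mul_smul] using this
    have h4 : (fun p : P (f • x') => γ ((p : G) • f • x)) =
        fun p : P (f • x') => γ ((p : G) • f • x') := by
      apply hcode1
      funext p
      have := h3 p p.2
      simpa only [Lf, p.2, dite_true, Subtype.coe_eta] using this
    have := congrFun h4 ⟨f⁻¹, h2 ▸ hmemP x⟩
    simpa using this
  · have hWm : MeasurableSet {x | L x ≠ none} := (hLm none).compl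
    rw [← lintegral_indicator_one hWm, htr _ (measurable_one.indicator hWm)]
    have hfm : Measurable fun x => ENNReal.ofReal (l (γ x) / Λ) := by
      let _ : MeasurableSpace V := ⊤
      exact (measurable_from_top (f := fun v => ENNReal.ofReal (l v / Λ))).comp
        (measurable_to_countable' hγ)
    have hlint : ∫⁻ x, ENNReal.ofReal (l (γ x) / Λ) ∂μ =
        ENNReal.ofReal ((∑ v, l v * μ.real {x | γ x = v}) / Λ) := by
      rw [lintegral_fintype_comp μ hγ fun v => ENNReal.ofReal (l v / Λ), Finset.sum_div,
        ENNReal.ofReal_sum_of_nonneg fun v _ =>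
          div_nonneg (mul_nonneg (hl0 v) measureReal_nonneg) hΛ.le]
      refine Finset.sum_congr rfl fun v _ => ?_
      rw [mul_div_right_comm, ENNReal.ofReal_mul (div_nonneg (hl0 v) hΛ.le), ofReal_measureReal]
    rw [← hlint, htr _ hfm, ← lintegral_indicator_one hY,
      ← lintegral_add_right _ (measurable_one.indicator hY)]
    refine lintegral_mono fun y => ?_
    by_cases hy : y ∈ Y
    · have e1 : ∑ p ∈ P y, {x | L x ≠ none}.indicator (1 : X → ℝ≥0∞) (p • y) =
          (Nat.card {p : P y // code (P y) (fun p => γ ((p : G) • y)) p ≠ none} : ℝ≥0∞) := by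
        rw [← Finset.sum_coe_sort, Nat.card_eq_fintype_card, Fintype.card_subtype,
          Finset.card_filter]
        push_cast
        refine Finset.sum_congr rfl fun p _ => ?_
        have : L ((p : G) • y) = code (P y) (fun p => γ ((p : G) • y)) p := by
          rw [hL y p p.2]
          simp [Lf]
        simp only [Set.indicator_apply, Set.mem_ofPred_eq, this, Pi.one_apply]
      have e2 : ∑ p ∈ P y, ENNReal.ofReal (l (γ (p • y)) / Λ) =
          ENNReal.ofReal ((∑ p : P y, l (γ ((p : G) • y))) / Λ) := by
        rw [← ENNReal.ofReal_sum_of_nonneg fun p _ => div_nonneg (hl0 _) hΛ.le,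
          ← Finset.sum_div, ← Finset.sum_coe_sort]
      have h := hcode2 (P y) (fun p => γ ((p : G) • y))
      dsimp only
      rw [e1, e2, Set.indicator_of_mem hy, Pi.one_apply, ← ENNReal.ofReal_one,
        ← ENNReal.ofReal_add (div_nonneg (Finset.sum_nonneg fun p _ => hl0 _) hΛ.le) zero_le_one,
        ← ENNReal.ofReal_natCast]
      exact ENNReal.ofReal_le_ofReal h
    · have : P y = ∅ := by
        refine Finset.filter_eq_empty_iff.2 fun g _ h => hy ?_
        have := hbY (g • y)
        rwa [h, inv_smul_smul] at this
      simp [this]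

end Cells

section Recoding

lemma ConvNormLE.mono {G I : Type*} [Group G] [Fintype I] {ev : I → G} {ρ ρ' : ℝ}
    (h : ConvNormLE ev ρ) (hρ : ρ ≤ ρ') : ConvNormLE ev ρ' := by
  refine ⟨h.1.trans hρ, fun f hf => (h.2 f hf).trans ?_⟩
  have := h.1
  have : 0 ≤ ∑' g, f g ^ 2 := tsum_nonneg fun g => sq_nonneg _
  gcongr

open Pointwise

variable {G X : Type*} [Group G] [Countable G] [MeasurableSpace X] [StandardBorelSpace X]
  [MulAction G X] [MeasurableConstSMul G X]

omit [Countable G] [StandardBorelSpace X] [MulAction G X] [MeasurableConstSMul G X] in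
/-- The cost of recording letters and closed codes. -/
lemma hasCost_letters_codes [DecidableEq G] {I : Type*} [Fintype I] {Q : Finset G} {ev : I → G}
    (μ : Measure X) [IsProbabilityMeasure μ] {J : Finset (List (CycStep I Q))}
    (hJ : ∀ v ∈ J, v ≠ [] ∧ codeDisp ev v = 1) {z : X → Option (I ⊕ J)}
    (hz : ∀ o, MeasurableSet {x | z x = o}) {B Λ θ y w : ℝ} (hB : 1 ≤ B)
    (hQ : ConvNormLE (stepDisp ev : CycStep I Q → G) B) (hI : Real.exp Λ = Fintype.card I)
    (hΛ : 0 ≤ Λ) (hθ : 0 < θ) (hθ1 : θ < 1)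
    (hy : μ.real {x | ∃ s, z x = some (Sum.inl s)} ≤ y)
    (hw : ∑ v : J, 2 * ((v : List (CycStep I Q)).length : ℝ) * μ.real {x | z x = some (Sum.inr v)}
      ≤ w) :
    HasCost μ z (-Real.log (1 - θ) + (Real.log (2 / θ) + Λ) * y +
      (Real.log (2 / θ) + Real.log (2 * B)) / 2 * w) := by
  have hlogθ : 0 ≤ Real.log (2 / θ) := Real.log_nonneg (by rw [le_div_iff₀ hθ]; linarith)
  have hlogB : 0 ≤ Real.log (2 * B) := Real.log_nonneg (by linarith)
  have hexpθ : Real.exp (-Real.log (2 / θ)) = θ / 2 := by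
    rw [Real.exp_neg, Real.exp_log (by positivity), inv_div]
  refine ⟨hz, fun o => o.elim (-Real.log (1 - θ)) (Sum.elim (fun _ => Real.log (2 / θ) + Λ)
    fun v => Real.log (2 / θ) + (v : List (CycStep I Q)).length * Real.log (2 * B)), ?_, ?_⟩
  · rw [Fintype.sum_option, Fintype.sum_sum_type]
    simp only [Option.elim, Sum.elim_inl, Sum.elim_inr, neg_neg, neg_add, Real.exp_add, hexpθ]
    rw [Real.exp_log (by linarith), Finset.sum_const, Finset.card_univ, nsmul_eq_mul, ← hI,
      ← Finset.mul_sum]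
    have h1 : Real.exp Λ * (θ / 2 * Real.exp (-Λ)) = θ / 2 := by
      rw [mul_left_comm, ← Real.exp_add, add_neg_cancel, Real.exp_zero, mul_one]
    have h2 : ∑ v : J, Real.exp (-((v : List (CycStep I Q)).length * Real.log (2 * B))) ≤ 1 := by
      refine le_trans (le_of_eq ?_) (sum_closed_codes_le ev (by linarith) hQ J hJ)
      rw [← Finset.sum_coe_sort J fun v => ((2 * B) ^ v.length)⁻¹]
      refine Finset.sum_congr rfl fun v _ => ?_
      rw [Real.exp_neg, Real.exp_nat_mul, Real.exp_log (by linarith)]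
    rw [h1]
    nlinarith
  · rw [Fintype.sum_option, Fintype.sum_sum_type]
    simp only [Option.elim, Sum.elim_inl, Sum.elim_inr]
    rw [← Finset.mul_sum]
    have h1 : ∑ s : I, μ.real {x | z x = some (Sum.inl s)} ≤ y := by
      refine le_trans (le_of_eq ?_) hy
      rw [← measureReal_biUnion_finset]
      · congr 1
        ext x
        simp
      · intro s _ s' _ hss
        refine Set.disjoint_left.2 fun x hx hx' => hss ?_
        have h : z x = some (Sum.inl s) := hx
        have h' : z x = some (Sum.inl s') := hx'
        simpa [h] using h'
      · exact fun s _ => hz _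
    have h2 : ∑ v : J, (Real.log (2 / θ) + (v : List (CycStep I Q)).length * Real.log (2 * B)) *
        μ.real {x | z x = some (Sum.inr v)} ≤ (Real.log (2 / θ) + Real.log (2 * B)) / 2 * w := by
      calc _ ≤ ∑ v : J, (Real.log (2 / θ) + Real.log (2 * B)) / 2 *
            (2 * ((v : List (CycStep I Q)).length : ℝ) * μ.real {x | z x = some (Sum.inr v)}) := by
            refine Finset.sum_le_sum fun v _ => ?_
            have hv : (1 : ℝ) ≤ (v : List (CycStep I Q)).length := by
              have := List.length_pos_iff.2 (hJ v v.2).1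
              exact_mod_cast this
            rw [← mul_assoc]
            refine mul_le_mul_of_nonneg_right ?_ measureReal_nonneg
            nlinarith
        _ = (Real.log (2 / θ) + Real.log (2 * B)) / 2 * ∑ v : J,
            (2 * ((v : List (CycStep I Q)).length : ℝ) * μ.real {x | z x = some (Sum.inr v)}) := by
            rw [Finset.mul_sum]
        _ ≤ _ := by gcongr
    have h3 : -Real.log (1 - θ) * μ.real {x | z x = none} ≤ -Real.log (1 - θ) := by
      have : Real.log (1 - θ) ≤ 0 := Real.log_nonpos (by linarith) (by linarith)
      have := measureReal_le_one (μ := μ) (s := {x | z x = none})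
      nlinarith
    have h4 : (Real.log (2 / θ) + Λ) * ∑ s : I, μ.real {x | z x = some (Sum.inl s)} ≤
        (Real.log (2 / θ) + Λ) * y := by gcongr
    linarith

/-- One round of recoding: name a labelling by letters over sparse cells, then record the cycles
of the graph spanned by the letters. -/
lemma exists_recode_step [DecidableEq G] (hfree : ∀ (g : G) (x : X), g • x = x → g = 1)
    (μ : Measure X) [IsProbabilityMeasure μ] [SMulInvariantMeasure G X μ] {V I : Type*} [Fintype V]
    [Fintype I] {γ : X → V} (hγ : ∀ v, MeasurableSet {x | γ x = v})
    {l : V → ℝ} (hl : ∑ v, Real.exp (-l v) ≤ 1) {Λ ρ c θ : ℝ} (hΛ : 0 < Λ)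
    (hI : Real.exp Λ = Fintype.card I) (hlΛ : ∀ v, l v ≤ Λ)
    (hc : ∑ v, l v * μ.real {x | γ x = v} ≤ c) {ev : I → G} (h : ConvNormLE ev ρ)
    (h' : ConvNormLE (fun i => (ev i)⁻¹) ρ) (hρ : 1 ≤ ρ) {D : Finset G} (hD : 1 < D.card)
    (hθ : 0 < θ) (hθ1 : θ < 1) :
    (∃ (A : Set X) (T : FreeGroup (Fin 2) → X → X), MeasurableSet A ∧ 0 < μ A ∧
      μ A ≤ ENNReal.ofReal (c / Λ + 1 / D.card) ∧ FreeOn G A T) ∨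
    ∃ (n : ℕ) (γ' : X → Fin n), codeAlg G γ ≤ codeAlg G γ' ∧ HasCost μ γ'
      (Real.log D.card / D.card + 1 / (D.card - 1) + (-Real.log (1 - θ) +
      (Real.log (2 / θ) + Λ) * (9 / D.card) +
      (Real.log (2 / θ) + Real.log (2 * ((D.card : ℝ) ^ 4 * ρ) ^ 2)) / 2 *
        (c / Λ + 1 / D.card))) := by
  classical
  set F := D⁻¹ * D with hF
  have hFinv : ∀ f ∈ F, f⁻¹ ∈ F := by
    intro f hf
    obtain ⟨a, ha, b, hb, rfl⟩ := Finset.mem_mul.1 hf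
    exact Finset.mem_mul.2 ⟨b⁻¹, Finset.inv_mem_inv hb, a⁻¹, Finset.mem_inv'.1 ha, by simp⟩
  have hd0 : (0 : ℝ) < D.card := by exact_mod_cast (by omega : 0 < D.card)
  have hd1 : (1 : ℝ) < D.card := by exact_mod_cast hD
  obtain ⟨Y, hYm, hY0, hYD, hYF⟩ := exists_maximal_separated hfree μ
    (Finset.card_pos.1 (by omega : 0 < D.card))
  obtain ⟨b, hbF, hbY, hb⟩ := exists_cell_map hYF
  obtain ⟨L, hLm, ⟨E, hE⟩, hLμ⟩ := exists_naming μ hγ hl hΛ hI hlΛ hYm hFinv hbF hbY hb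
  have hYr : μ.real Y ≤ 1 / D.card := by
    rw [le_div_iff₀ hd0, mul_comm]
    have := ENNReal.toReal_mono ENNReal.one_ne_top hYD
    simpa [ENNReal.toReal_mul, Measure.real] using this
  have hc0 : 0 ≤ c := by
    refine le_trans (Finset.sum_nonneg fun v _ => mul_nonneg ?_ measureReal_nonneg) hc
    have := (Finset.single_le_sum (f := fun v => Real.exp (-l v))
      (fun v _ => (Real.exp_pos _).le) (Finset.mem_univ v)).trans hl
    have := Real.exp_le_one_iff.1 this
    linarith
  have hw0 : 0 ≤ c / Λ + 1 / D.card := by positivity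
  have hLμ' : μ {x | L x ≠ none} ≤ ENNReal.ofReal (c / Λ + 1 / D.card) := by
    refine hLμ.trans ?_
    rw [ENNReal.ofReal_add (by positivity) (by positivity), ← ofReal_measureReal (μ := μ) (s := Y)]
    gcongr
  have hbm : ∀ g, MeasurableSet {x | b x = g} := by
    intro g
    refine codeAlg_le (G := G) (φ := fun x => decide (x ∈ Y)) ?_ _
      (measurableSet_codeAlg_of_window F (fun x x' h => hb _ _ fun e he => ?_) g)
    · intro a
      have : {x | decide (x ∈ Y) = a} = if a then Y else Yᶜ := by
        ext x
        cases a <;> simp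
      rw [this]
      split_ifs
      exacts [hYm, hYm.compl]
    · simpa using h e he
  let QF : Finset G := F * F
  let κ : Bool → X → X := fun t x =>
    if t then (match L x with
      | some s => b (ev s • x) • ev s • x
      | none => b x • x)
    else b x • x
  have hgap : ∀ x y, b x • x = b y • y → ∃ q ∈ QF, y = q • x := by
    intro x y hxy
    refine ⟨(b y)⁻¹ * b x, Finset.mul_mem_mul (hFinv _ (hbF y)) (hbF x), ?_⟩
    rw [mul_smul, hxy, inv_smul_smul]
  have hκt : ∀ x s, L x = some s → κ true x = b (ev s • x) • ev s • x := by
    intro x s hs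
    simp [κ, hs]
  have hη : ∀ x y s s', L x = some s → L y = some s' → κ true x = κ true y →
      ∃ q ∈ QF, y = (ev s')⁻¹ • q • ev s • x := by
    intro x y s s' hs hs' hxy
    rw [hκt x s hs, hκt y s' hs'] at hxy
    obtain ⟨q, hq, h⟩ := hgap _ _ hxy
    exact ⟨q, hq, by rw [← h, inv_smul_smul]⟩
  let Q' : Finset G := QF ∪ (Finset.univ ×ˢ QF ×ˢ Finset.univ).image
    fun p : I × G × I => (ev p.1)⁻¹ * (p.2.1 * ev p.2.2)
  have hQ' : ∀ t x y, L x ≠ none → L y ≠ none → κ t x = κ t y → ∃ g ∈ Q', y = g • x := by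
    intro t x y hx hy hxy
    cases t with
    | false =>
      obtain ⟨q, hq, h⟩ := hgap x y (by simpa [κ] using hxy)
      exact ⟨q, Finset.mem_union_left _ hq, h⟩
    | true =>
      obtain ⟨s, hs⟩ := Option.ne_none_iff_exists'.1 hx
      obtain ⟨s', hs'⟩ := Option.ne_none_iff_exists'.1 hy
      obtain ⟨q, hq, h⟩ := hη x y s s' hs hs' hxy
      refine ⟨(ev s')⁻¹ * (q * ev s), Finset.mem_union_right _ (Finset.mem_image.2
        ⟨(s', q, s), by simp [hq], rfl⟩), ?_⟩
      rw [mul_smul, mul_smul, h]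
  have hκo : ∀ t x, ∃ g : G, κ t x = g • x := by
    intro t x
    cases t with
    | false => exact ⟨b x, by simp [κ]⟩
    | true =>
      rcases hLx : L x with _ | s
      · exact ⟨b x, by simp [κ, hLx]⟩
      · exact ⟨b (ev s • x) * ev s, by rw [hκt x s hLx, mul_smul]⟩
  have hκm : ∀ t, Measurable (κ t) := by
    intro t
    refine measurable_of_orbit_map (hκo t) fun g => ?_
    cases t with
    | false =>
      have : {x | κ false x = g • x} = {x | b x = g} := by
        ext x
        simp only [κ, Set.mem_ofPred_eq, Bool.false_eq_true, if_false]
        exact ⟨fun h => smul_left_injective_of_free hfree h, fun h => by rw [h]⟩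
      rw [this]
      exact hbm g
    | true =>
      have : {x | κ true x = g • x} = ({x | L x = none} ∩ {x | b x = g}) ∪
          ⋃ s, {x | L x = some s} ∩ (fun x => ev s • x) ⁻¹' {x | b x = g * (ev s)⁻¹} := by
        ext x
        rcases hLx : L x with _ | s
        · simp only [κ, hLx, Set.mem_ofPred_eq, if_true, Set.mem_union, Set.mem_inter_iff,
            Set.mem_iUnion, reduceCtorEq, false_and, exists_false, or_false, true_and]
          exact ⟨fun h => smul_left_injective_of_free hfree h, fun h => by rw [h]⟩
        · simp only [κ, hLx, Set.mem_ofPred_eq, if_true, Set.mem_union, Set.mem_inter_iff,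
            Set.mem_iUnion, reduceCtorEq, false_and, false_or, Option.some.injEq,
            exists_eq_left', Set.mem_preimage]
          rw [eq_mul_inv_iff_mul_eq, ← mul_smul]
          exact ⟨fun h => smul_left_injective_of_free hfree h, fun h => by rw [h]⟩
      rw [this]
      exact ((hLm none).inter (hbm g)).union (MeasurableSet.iUnion fun s =>
        (hLm _).inter (measurable_const_smul (ev s) (hbm _)))
  have hκY : ∀ t x, κ t x ∈ Y := by
    intro t x
    cases t with
    | false => simpa [κ] using hbY x
    | true =>
      rcases hLx : L x with _ | s
      · simpa [κ, hLx] using hbY x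
      · rw [hκt x s hLx]
        exact hbY _
  rcases exists_cycle_removal (Q := QF) ev hfree μ hLm hYm hY0 hκm hκo hκY Q' hQ' hη
    (fun x y hxy => hgap x y (by simpa [κ] using hxy)) with
    ⟨A, T, hA, hAL, hA0, hT⟩ | ⟨z, J, hzm, hJ, hzJ, hLz, hz9, hzL⟩
  · exact Or.inl ⟨A, T, hA, hA0, (measure_mono hAL).trans hLμ', hT⟩
  right
  let ι : I ⊕ J → I ⊕ List (CycStep I QF) := Sum.map id Subtype.val
  have hι : Function.Injective ι := Function.Injective.sumMap Function.injective_id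
    Subtype.val_injective
  have hz' : ∀ x, ∃ o : Option (I ⊕ J), z x = o.map ι := by
    intro x
    rcases hx : z x with _ | s | v
    · exact ⟨none, rfl⟩
    · exact ⟨some (Sum.inl s), rfl⟩
    · exact ⟨some (Sum.inr ⟨v, hzJ x v hx⟩), rfl⟩
  choose z' hz' using hz'
  have hfib : ∀ o, {x | z' x = o} = {x | z x = o.map ι} := by
    intro o
    ext x
    simp only [Set.mem_ofPred_eq, hz' x]
    exact (Option.map_injective hι).eq_iff.symm
  have hz'm : ∀ o, MeasurableSet {x | z' x = o} := fun o => hfib o ▸ hzm _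
  have hcost2 : HasCost μ z' _ := hasCost_letters_codes (y := 9 / D.card)
    (w := c / Λ + 1 / D.card) μ hJ hz'm (B := ((D.card : ℝ) ^ 4 * ρ) ^ 2) ?_ ?_ hI hΛ.le hθ hθ1
    ?_ ?_
  rotate_left
  · exact one_le_pow₀ (one_le_mul_of_one_le_of_one_le (one_le_pow₀ hd1.le) hρ)
  · refine (convNormLE_stepDisp (Q := QF) ev h h').mono ?_
    have hF2 : F.card ≤ D.card * D.card := by
      have := Finset.card_mul_le (s := D⁻¹) (t := D)
      rwa [Finset.card_inv] at this
    have hQ4 : QF.card ≤ D.card ^ 4 := by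
      calc QF.card ≤ F.card * F.card := Finset.card_mul_le
        _ ≤ (D.card * D.card) * (D.card * D.card) := Nat.mul_le_mul hF2 hF2
        _ = _ := by ring
    have : (QF.card : ℝ) ≤ (D.card : ℝ) ^ 4 := by exact_mod_cast hQ4
    exact pow_le_pow_left₀ (mul_nonneg (Nat.cast_nonneg _) (zero_le_one.trans hρ))
      (mul_le_mul_of_nonneg_right this (zero_le_one.trans hρ)) 2
  · have e1 : {x | ∃ s, z' x = some (Sum.inl s)} = {x | ∃ s, z x = some (Sum.inl s)} := by
      ext x
      simp only [Set.mem_ofPred_eq, hz' x]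
      refine exists_congr fun s => ?_
      rw [← (Option.map_injective hι).eq_iff]
      rfl
    rw [e1, measureReal_def]
    have := ENNReal.toReal_mono (by finiteness) hz9
    rw [ENNReal.toReal_mul, ← measureReal_def] at this
    refine this.trans ?_
    have e2 : (9 : ℝ≥0∞).toReal = 9 := rfl
    rw [e2, div_eq_mul_one_div]
    exact mul_le_mul_of_nonneg_left hYr (by norm_num)
  · have e1 : ∀ v : J, {x | z' x = some (Sum.inr v)} = {x | z x = some (Sum.inr (v : List _))} :=
      fun v => hfib _
    simp only [e1]
    rw [Finset.sum_coe_sort J fun v => 2 * (v.length : ℝ) * μ.real {x | z x = some (Sum.inr v)}]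
    have := ENNReal.toReal_mono ENNReal.ofReal_ne_top (hzL.trans hLμ')
    rw [ENNReal.toReal_ofReal hw0, ENNReal.toReal_sum fun v _ =>
      ENNReal.mul_ne_top (ENNReal.natCast_ne_top _) (measure_ne_top _ _)] at this
    refine le_trans (le_of_eq (Finset.sum_congr rfl fun v _ => ?_)) this
    simp [ENNReal.toReal_mul, measureReal_def]
  have hcost := (hasCost_indicator hYm hd1 hYr).prod hcost2
  let e := Fintype.equivFin (Bool × Option (I ⊕ J))
  refine ⟨_, fun x => e (decide (x ∈ Y), z' x), ?_, hcost.equiv e⟩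
  let EL : Finset G := insert 1 (J.biUnion fun v => ((codePos ev v).map fun p => p.1⁻¹).toFinset)
  have hzz : ∀ x x', z' x = z' x' → z x = z x' := fun x x' h => by rw [hz' x, hz' x', h]
  have hLsome : ∀ x x', (∀ e ∈ EL, z' (e • x) = z' (e • x')) → ∀ s, L x = some s →
      L x' = some s := by
    intro x x' hx s hs
    rw [hLz] at hs ⊢
    rcases hs with hs | ⟨v, g, hg, hv⟩
    · left
      have := hzz _ _ (hx 1 (Finset.mem_insert_self _ _))
      rw [one_smul, one_smul] at this
      rw [← this, hs]
    · right
      refine ⟨v, g, hg, ?_⟩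
      rw [← hzz _ _ (hx g⁻¹ (Finset.mem_insert_of_mem (Finset.mem_biUnion.2
        ⟨v, hzJ _ v hv, ?_⟩))), hv]
      exact List.mem_toFinset.2 (List.mem_map.2 ⟨(g, s), hg, rfl⟩)
  refine codeAlg_le_of_window (E ∪ EL * E) fun x x' hx => hE x x' fun e' he' => ⟨?_, ?_⟩
  · have := e.injective (hx e' (Finset.mem_union_left _ he'))
    simpa using congrArg Prod.fst this
  · have key : ∀ a ∈ EL, z' (a • e' • x) = z' (a • e' • x') := by
      intro a ha
      have := e.injective (hx (a * e') (Finset.mem_union_right _ (Finset.mul_mem_mul ha he')))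
      simpa [mul_smul] using congrArg Prod.snd this
    ext s
    exact ⟨fun h => hLsome _ _ key s h, fun h => hLsome _ _ (fun a ha => (key a ha).symm) s h⟩

end Recoding

section Improvement

open Filter Topology Pointwise

lemma tendsto_recode_cost {c s a : ℝ} (hs : 0 < s) : Tendsto (fun j : ℕ =>
    Real.log ((j ^ 2 : ℕ) : ℝ) / ((j ^ 2 : ℕ) : ℝ) + 1 / (((j ^ 2 : ℕ) : ℝ) - 1) +
      (-Real.log (1 - 1 / (j : ℝ)) +
      (Real.log (2 / (1 / (j : ℝ))) + j * s) * (9 / ((j ^ 2 : ℕ) : ℝ)) +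
      (Real.log (2 / (1 / (j : ℝ))) +
        Real.log (2 * (((j ^ 2 : ℕ) : ℝ) ^ 4 * Real.exp (j * a)) ^ 2)) / 2 *
        (c / (j * s) + 1 / ((j ^ 2 : ℕ) : ℝ)))) atTop (𝓝 (a / s * c)) := by
  let H : ℝ × ℝ → ℝ := fun p => 2 * p.2 * p.1 + p.1 ^ 2 / (1 - p.1 ^ 2) + (-Real.log (1 - p.1) +
    9 * (Real.log 2 * p.1 ^ 2 + p.2 * p.1 + s * p.1) +
    (p.1 * Real.log 2 + 17 / 2 * p.2 + a) * (c / s + p.1))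
  have hH : ContinuousAt H (0, 0) := by
    have h1 : ContinuousAt (fun p : ℝ × ℝ => Real.log (1 - p.1)) (0, 0) :=
      ContinuousAt.log (by fun_prop) (by norm_num)
    have h2 : ContinuousAt (fun p : ℝ × ℝ => p.1 ^ 2 / (1 - p.1 ^ 2)) (0, 0) :=
      ContinuousAt.div (by fun_prop) (by fun_prop) (by norm_num)
    fun_prop
  have hH0 : H (0, 0) = a / s * c := by
    simp [H]
    ring
  rw [← hH0]
  have hu : Tendsto (fun j : ℕ => 1 / (j : ℝ)) atTop (𝓝 0) := tendsto_one_div_atTop_nhds_zero_nat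
  have hw : Tendsto (fun j : ℕ => Real.log j / (j : ℝ)) atTop (𝓝 0) :=
    (Real.isLittleO_log_id_atTop.tendsto_div_nhds_zero).comp tendsto_natCast_atTop_atTop
  refine (hH.tendsto.comp (hu.prodMk_nhds hw)).congr' ?_
  filter_upwards [eventually_ge_atTop 2] with j hj
  have hj' : (2 : ℝ) ≤ j := by exact_mod_cast hj
  have hj0 : (j : ℝ) ≠ 0 := by linarith
  have hj1 : (j : ℝ) ^ 2 - 1 ≠ 0 := by nlinarith
  have e1 : Real.log (2 / (1 / (j : ℝ))) = Real.log 2 + Real.log j := by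
    rw [← Real.log_mul (by norm_num) hj0]
    simp
  have e2 : Real.log (2 * (((j ^ 2 : ℕ) : ℝ) ^ 4 * Real.exp (j * a)) ^ 2) =
      Real.log 2 + 16 * Real.log j + 2 * (j * a) := by
    push_cast
    rw [Real.log_mul (by norm_num) (by positivity), Real.log_pow, Real.log_mul (by positivity)
      (by positivity), Real.log_exp, ← pow_mul, Real.log_pow]
    push_cast
    ring
  have e3 : Real.log ((j ^ 2 : ℕ) : ℝ) = 2 * Real.log j := by
    push_cast
    rw [Real.log_pow]
    push_cast
    ring
  rw [e1, e2, e3]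
  simp only [H, Function.comp]
  push_cast
  have e4 : (1 / (j : ℝ)) ^ 2 / (1 - (1 / (j : ℝ)) ^ 2) = 1 / ((j : ℝ) ^ 2 - 1) := by
    have : (1 - (1 / (j : ℝ)) ^ 2) = ((j : ℝ) ^ 2 - 1) / j ^ 2 := by
      field_simp
    rw [this]
    field_simp
  rw [e4]
  have hs0 := hs.ne'
  field_simp
  ring

variable {G : Type*} {X : Type*} [Group G] [Countable G] [MeasurableSpace X]
  [StandardBorelSpace X] [MulAction G X] [MeasurableConstSMul G X]

/-- If small sets carry no free actions of `F₂` inside the orbit relation, then any labelling can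
be recoded with cost smaller by a definite factor. -/
lemma exists_recoding [DecidableEq G] (hfree : ∀ (g : G) (x : X), g • x = x → g = 1)
    (μ : Measure X) [IsProbabilityMeasure μ] [SMulInvariantMeasure G X μ]
    {S : Finset G} (h1 : (1 : G) ∈ S) (hsymm : ∀ s ∈ S, s⁻¹ ∈ S)
    (hS : ∀ K : Finset G, 2 * K.card ≤ (S * K).card)
    (hsmall : ¬ ∀ ε : ℝ≥0∞, 0 < ε → ∃ (A : Set X) (T : FreeGroup (Fin 2) → X → X),
      MeasurableSet A ∧ 0 < μ A ∧ μ A ≤ ε ∧ FreeOn G A T) :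
    ∃ q : ℝ, 0 ≤ q ∧ q < 1 ∧ ∀ (n : ℕ) (γ : X → Fin n) (c : ℝ), HasCost μ γ c → ∀ τ > 0,
      ∃ (m : ℕ) (γ' : X → Fin m), codeAlg G γ ≤ codeAlg G γ' ∧ HasCost μ γ' (q * c + τ) := by
  push Not at hsmall
  obtain ⟨ε, hε, hsmall⟩ := hsmall
  have hr2 : 2 ≤ S.card := by simpa using hS {1}
  have hinf : Infinite G := by
    by_contra h
    rw [not_infinite_iff_finite] at h
    have := Fintype.ofFinite G
    have h2 := hS Finset.univ
    have h3 := Finset.card_le_univ (S * (Finset.univ : Finset G))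
    have : 0 < (Finset.univ : Finset G).card := Finset.card_pos.2 ⟨1, Finset.mem_univ _⟩
    rw [Finset.card_univ] at *
    omega
  have hr2' : (2 : ℝ) ≤ S.card := by exact_mod_cast hr2
  set R := Real.sqrt ((S.card : ℝ) ^ 2 - 1 / 6) with hR
  have hR1 : 1 ≤ R := by
    rw [hR, Real.one_le_sqrt]
    nlinarith
  have hRr : R < S.card := by
    rw [hR, Real.sqrt_lt' (by linarith)]
    linarith
  have hs : 0 < Real.log S.card := Real.log_pos (by linarith)
  have ha : 0 ≤ Real.log R := Real.log_nonneg hR1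
  refine ⟨Real.log R / Real.log S.card, div_nonneg ha hs.le, ?_, fun n γ c hγ τ hτ => ?_⟩
  · rw [div_lt_one hs]
    exact Real.log_lt_log (by linarith) hRr
  obtain ⟨hγm, l, hl, hc⟩ := hγ
  have ev1 := (tendsto_recode_cost (c := c) (a := Real.log R) hs).eventually
    (eventually_lt_nhds (lt_add_of_pos_right _ hτ))
  have ev2 : ∀ᶠ j : ℕ in atTop, ∀ v, l v ≤ j * Real.log S.card :=
    eventually_all.2 fun v => (tendsto_natCast_atTop_atTop.atTop_mul_const hs).eventually_ge_atTop _
  have ev3 : ∀ᶠ j : ℕ in atTop,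
      ENNReal.ofReal (c / (j * Real.log S.card) + 1 / ((j ^ 2 : ℕ) : ℝ)) < ε := by
    have ht : Tendsto (fun j : ℕ => c / (j * Real.log S.card) + 1 / ((j ^ 2 : ℕ) : ℝ)) atTop
        (𝓝 (0 + 0)) := by
      refine Tendsto.add ?_ ?_
      · exact Tendsto.const_div_atTop (tendsto_natCast_atTop_atTop.atTop_mul_const hs) c
      · exact tendsto_one_div_atTop_nhds_zero_nat.comp (tendsto_pow_atTop (two_ne_zero))
    have := ENNReal.tendsto_ofReal ht
    simp only [add_zero, ENNReal.ofReal_zero] at this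
    exact this.eventually (eventually_lt_nhds hε)
  obtain ⟨j, hj1, hj2, hj3, hj⟩ :=
    (ev1.and (ev2.and (ev3.and (eventually_ge_atTop 2)))).exists
  have hjR : (2 : ℝ) ≤ j := by exact_mod_cast hj
  have hconv := convNormLE_of_doubling h1 hsymm hS
  have hconv' : ConvNormLE (fun s : S => (s : G)⁻¹) R := by
    let e : S ≃ S :=
      { toFun := fun s => ⟨(s : G)⁻¹, hsymm s s.2⟩
        invFun := fun s => ⟨(s : G)⁻¹, hsymm s s.2⟩
        left_inv := fun s => by simp
        right_inv := fun s => by simp }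
    exact hconv.of_equiv e
  obtain ⟨I, _, ev, hI, hev, hev'⟩ := exists_letters hconv hconv' j
  obtain ⟨D, hD⟩ := Infinite.exists_subset_card_eq G (j ^ 2)
  have hIexp : Real.exp (j * Real.log S.card) = Fintype.card I := by
    rw [hI, Real.exp_nat_mul, Real.exp_log (by linarith)]
    simp
  have hRexp : R ^ j = Real.exp (j * Real.log R) := by
    rw [Real.exp_nat_mul, Real.exp_log (by linarith)]
  rcases exists_recode_step hfree μ hγm hl (mul_pos (by linarith) hs) hIexp hj2 hc hev hev'
    (one_le_pow₀ hR1) (D := D) (by rw [hD]; nlinarith) (θ := 1 / j) (by positivity)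
    (by rw [div_lt_one] <;> linarith) with ⟨A, T, hA, hA0, hAε, hT⟩ | ⟨m, γ', hle, hcost⟩
  · rw [hD] at hAε
    exact absurd hT (hsmall A T hA hA0 (hAε.trans hj3.le))
  · refine ⟨m, γ', hle, hcost.mono ?_⟩
    rw [hD, hRexp]
    exact hj1.le

/-- If small sets carry no free actions of `F₂` inside the orbit relation, then any measurable set
is coded at arbitrarily small cost. -/
lemma exists_cheap_code [DecidableEq G] (hfree : ∀ (g : G) (x : X), g • x = x → g = 1)
    (μ : Measure X) [IsProbabilityMeasure μ] [SMulInvariantMeasure G X μ]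
    {S : Finset G} (h1 : (1 : G) ∈ S) (hsymm : ∀ s ∈ S, s⁻¹ ∈ S)
    (hS : ∀ K : Finset G, 2 * K.card ≤ (S * K).card)
    (hsmall : ¬ ∀ ε : ℝ≥0∞, 0 < ε → ∃ (A : Set X) (T : FreeGroup (Fin 2) → X → X),
      MeasurableSet A ∧ 0 < μ A ∧ μ A ≤ ε ∧ FreeOn G A T) {B : Set X} (hB : MeasurableSet B)
    {δ : ℝ} (hδ : 0 < δ) :
    ∃ (m : ℕ) (γ : X → Fin m), MeasurableSet[codeAlg G γ] B ∧ HasCost μ γ δ := by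
  classical
  obtain ⟨q, hq0, hq1, hq⟩ := exists_recoding hfree μ h1 hsymm hS hsmall
  have key : ∀ k : ℕ, ∃ (m : ℕ) (γ : X → Fin m), MeasurableSet[codeAlg G γ] B ∧
      HasCost μ γ (q ^ k * (Real.log 2) + δ / 2) := by
    intro k
    induction k with
    | zero =>
      have h2 : ∀ a, {x | decide (x ∈ B) = a} = if a then B else Bᶜ := by
        intro a
        ext x
        cases a <;> simp
      have hb : HasCost μ (fun x => decide (x ∈ B)) (Real.log 2) := by
        refine ⟨fun a => ?_, fun _ => Real.log 2, ?_, ?_⟩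
        · rw [h2]
          split_ifs
          exacts [hB, hB.compl]
        · rw [Fintype.sum_bool, Real.exp_neg, Real.exp_log (by norm_num)]
          norm_num
        · rw [Fintype.sum_bool, h2, h2, ← mul_add]
          simp [measureReal_add_measureReal_compl hB]
      refine ⟨_, _, ?_, (hb.equiv (Fintype.equivFin Bool)).mono (by simp; linarith)⟩
      have := measurableSet_codeAlg_smul (G := G)
        (fun x => Fintype.equivFin Bool (decide (x ∈ B))) 1 (Fintype.equivFin Bool true)
      convert this using 1
      ext x
      rw [Set.mem_ofPred_eq, one_smul, (Fintype.equivFin Bool).injective.eq_iff, decide_eq_true_iff]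
    | succ k ih =>
      obtain ⟨m, γ, hγB, hγ⟩ := ih
      obtain ⟨m', γ', hle, hγ'⟩ := hq m γ _ hγ ((1 - q) * (δ / 2))
        (mul_pos (by linarith) (by linarith))
      refine ⟨m', γ', hle _ hγB, hγ'.mono (le_of_eq ?_)⟩
      ring
  have ht : Tendsto (fun k : ℕ => q ^ k * (Real.log 2) + δ / 2) atTop
      (𝓝 (0 * (Real.log 2) + δ / 2)) :=
    ((tendsto_pow_atTop_nhds_zero_of_lt_one hq0 hq1).mul_const _).add_const _
  obtain ⟨k, hk⟩ := (ht.eventually (eventually_lt_nhds (b := δ) (by linarith))).exists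
  obtain ⟨m, γ, h, h'⟩ := key k
  exact ⟨m, γ, h, h'.mono hk.le⟩

end Improvement

section Entropy

open Filter Topology

section Bound

variable {X : Type*} [MeasurableSpace X] {μ : Measure X}

lemma nonneg_of_kraft {A : Type*} [Fintype A] {l : A → ℝ} (hl : ∑ a, Real.exp (-l a) ≤ 1)
    (a : A) : 0 ≤ l a := by
  have := (Finset.single_le_sum (f := fun v => Real.exp (-l v))
    (fun v _ => (Real.exp_pos _).le) (Finset.mem_univ a)).trans hl
  have := Real.exp_le_one_iff.1 this
  linarith

/-- A cheap labelling is almost constant. -/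
lemma HasCost.exists_dominant [IsProbabilityMeasure μ] {A : Type*} [Fintype A] {γ : X → A}
    {c : ℝ} (h : HasCost μ γ c) : ∃ a, Real.log 2 * μ.real {x | γ x ≠ a} ≤ c := by
  classical
  obtain ⟨hm, l, hl, hc⟩ := h
  have hl0 := nonneg_of_kraft hl
  have : ∃ a, ∀ b ≠ a, Real.log 2 ≤ l b := by
    by_cases h : ∃ a, l a < Real.log 2
    · obtain ⟨a, ha⟩ := h
      refine ⟨a, fun b hb => ?_⟩
      by_contra! hlt
      have h1 : ∀ t, t < Real.log 2 → 1 / 2 < Real.exp (-t) := by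
        intro t ht
        rw [Real.exp_neg, one_div]
        refine inv_strictAnti₀ (Real.exp_pos _) ?_
        rwa [← Real.lt_log_iff_exp_lt (by norm_num)]
      have h2 := Finset.sum_le_sum_of_subset_of_nonneg (f := fun v => Real.exp (-l v))
        (Finset.subset_univ {b, a}) fun v _ _ => (Real.exp_pos _).le
      rw [Finset.sum_pair hb] at h2
      linarith [h1 _ ha, h1 _ hlt]
    · push Not at h
      have hne : Nonempty X := nonempty_of_isProbabilityMeasure μ
      exact ⟨γ hne.some, fun b _ => h b⟩
  obtain ⟨a, ha⟩ := this
  refine ⟨a, le_trans ?_ hc⟩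
  have e : μ.real {x | γ x ≠ a} = ∑ b ∈ Finset.univ.erase a, μ.real {x | γ x = b} := by
    rw [← measureReal_biUnion_finset]
    · congr 1
      ext x
      simp
    · intro b _ b' _ hbb
      exact Set.disjoint_left.2 fun x hx hx' => hbb (Eq.trans (Eq.symm hx) hx')
    · exact fun b _ => hm b
  rw [e, Finset.mul_sum]
  calc _ ≤ ∑ b ∈ Finset.univ.erase a, l b * μ.real {x | γ x = b} := by
        refine Finset.sum_le_sum fun b hb => ?_
        have := ha b (Finset.ne_of_mem_erase hb)
        gcongr
    _ ≤ _ := Finset.sum_le_sum_of_subset_of_nonneg (Finset.erase_subset _ _) fun b _ _ =>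
        mul_nonneg (hl0 b) measureReal_nonneg

/-- A countable partition which is the limit of cheap labellings has small entropy. -/
lemma partEnt_le_of_hasCost [IsProbabilityMeasure μ] (α : CtblPart X) {K : ℕ → ℕ}
    {ψ : ∀ N, X → Fin (K N)} {ε : ℝ} (hε : 0 < ε) (hψ : ∀ N, HasCost μ (ψ N) ε) {X₀ : Set X}
    (hX₀ : μ X₀ᶜ = 0)
    (h1 : ∀ N i, ∀ x ∈ α.piece i ∩ X₀, ∀ y ∈ α.piece i ∩ X₀, ψ N x = ψ N y)
    (h2 : ∀ i j, i ≠ j → ∃ N₀, ∀ N ≥ N₀, ∀ x ∈ α.piece i ∩ X₀, ∀ y ∈ α.piece j ∩ X₀,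
      ψ N x ≠ ψ N y) :
    partEnt μ α ≤ ENNReal.ofReal (2 * ε) := by
  classical
  set p : ℕ → ℝ := fun i => (μ (α.piece i)).toReal with hp
  have hp0 : ∀ i, 0 ≤ p i := fun i => ENNReal.toReal_nonneg
  have hp1 : ∀ i, p i ≤ 1 := fun i => measureReal_le_one
  have hsum : HasSum p 1 := by
    have e : ∑' i, μ (α.piece i) = 1 := by
      rw [← measure_iUnion α.disj α.measurable, α.cover, measure_univ]
    have := ENNReal.hasSum_toReal (f := fun i => μ (α.piece i)) (by simp [e])
    rwa [← ENNReal.tsum_toReal_eq (fun i => measure_ne_top μ _), e, ENNReal.toReal_one] at this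
  obtain ⟨F₀, hF₀⟩ := (hsum.eventually (eventually_gt_nhds (sub_lt_self 1 hε))).exists
  have hnn : ∀ i, 0 ≤ Real.negMulLog (p i) := fun i => Real.negMulLog_nonneg (hp0 i) (hp1 i)
  rw [partEnt, ENNReal.tsum_eq_iSup_sum]
  refine iSup_le fun F => ?_
  rw [← ENNReal.ofReal_sum_of_nonneg fun i _ => hnn i]
  refine ENNReal.ofReal_le_ofReal ?_
  choose! N₀ hN₀ using h2
  let P := (F ∪ F₀).filter fun i => p i ≠ 0
  let N := (P ×ˢ P).sup fun q => N₀ q.1 q.2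
  have hne : ∀ i ∈ P, ∃ x, x ∈ α.piece i ∩ X₀ := by
    intro i hi
    by_contra! h
    refine (Finset.mem_filter.1 hi).2 ?_
    have : α.piece i ⊆ X₀ᶜ := fun x hx hx' => h x ⟨hx, hx'⟩
    simp [hp, measure_mono_null this hX₀]
  have : Nonempty X := nonempty_of_isProbabilityMeasure μ
  choose! x hx using hne
  let f : ℕ → Fin (K N) := fun i => ψ N (x i)
  have hf : ∀ i ∈ P, ∀ j ∈ P, f i = f j → i = j := by
    intro i hi j hj hij
    by_contra hne
    have hle : N₀ i j ≤ N := Finset.le_sup (f := fun q : ℕ × ℕ => N₀ q.1 q.2) (b := (i, j))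
      (Finset.mem_product.2 ⟨hi, hj⟩)
    exact hN₀ i j hne N hle _ (hx i hi) _ (hx j hj) hij
  obtain ⟨hm, l, hl, hc⟩ := hψ N
  have hl0 := nonneg_of_kraft hl
  have hpf : ∀ i ∈ P, p i ≤ μ.real {y | ψ N y = f i} := by
    intro i hi
    refine ENNReal.toReal_mono (measure_ne_top _ _) ?_
    have e : μ (α.piece i) ≤ μ (α.piece i ∩ X₀) + μ X₀ᶜ := by
      refine (measure_mono ?_).trans (measure_union_le _ _)
      intro y hy
      by_cases h : y ∈ X₀
      exacts [Or.inl ⟨hy, h⟩, Or.inr h]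
    rw [hX₀, add_zero] at e
    exact e.trans (measure_mono fun y hy => h1 N i y hy _ (hx i hi))
  have gibbs : ∀ i ∈ P, Real.negMulLog (p i) ≤ l (f i) * p i + Real.exp (-l (f i)) - p i := by
    intro i hi
    have hpos : 0 < p i := lt_of_le_of_ne (hp0 i) (Ne.symm (Finset.mem_filter.1 hi).2)
    have := Real.log_le_sub_one_of_pos (div_pos (Real.exp_pos (-l (f i))) hpos)
    rw [Real.log_div (Real.exp_pos _).ne' hpos.ne', Real.log_exp] at this
    have h3 := mul_le_mul_of_nonneg_left this hpos.le
    rw [mul_sub, mul_sub, mul_div_cancel₀ _ hpos.ne'] at h3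
    rw [Real.negMulLog]
    linarith
  have s1 : ∑ i ∈ P, l (f i) * p i ≤ ε := by
    calc ∑ i ∈ P, l (f i) * p i ≤ ∑ i ∈ P, l (f i) * μ.real {y | ψ N y = f i} := by
          refine Finset.sum_le_sum fun i hi => ?_
          have := hpf i hi
          have := hl0 (f i)
          gcongr
      _ = ∑ v ∈ P.image f, l v * μ.real {y | ψ N y = v} := by
          rw [Finset.sum_image fun i hi j hj h => hf i hi j hj h]
      _ ≤ ∑ v, l v * μ.real {y | ψ N y = v} :=
          Finset.sum_le_sum_of_subset_of_nonneg (Finset.subset_univ _) fun v _ _ =>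
            mul_nonneg (hl0 v) measureReal_nonneg
      _ ≤ ε := hc
  have s2 : ∑ i ∈ P, Real.exp (-l (f i)) ≤ 1 := by
    calc _ = ∑ v ∈ P.image f, Real.exp (-l v) := by
          rw [Finset.sum_image fun i hi j hj h => hf i hi j hj h]
      _ ≤ _ := (Finset.sum_le_sum_of_subset_of_nonneg (Finset.subset_univ _) fun v _ _ =>
            (Real.exp_pos _).le).trans hl
  have s3 : 1 - ε ≤ ∑ i ∈ P, p i := by
    rw [Finset.sum_filter_ne_zero]
    exact hF₀.le.trans (Finset.sum_le_sum_of_subset_of_nonneg Finset.subset_union_right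
      fun i _ _ => hp0 i)
  calc ∑ i ∈ F, Real.negMulLog (p i) ≤ ∑ i ∈ F ∪ F₀, Real.negMulLog (p i) :=
        Finset.sum_le_sum_of_subset_of_nonneg Finset.subset_union_left fun i _ _ => hnn i
    _ = ∑ i ∈ P, Real.negMulLog (p i) := by
        refine (Finset.sum_filter_of_ne (p := fun i => p i ≠ 0) (fun i _ h h0 => h ?_)).symm
        rw [h0, Real.negMulLog_zero]
    _ ≤ ∑ i ∈ P, (l (f i) * p i + Real.exp (-l (f i)) - p i) := Finset.sum_le_sum gibbs
    _ ≤ 2 * ε := by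
        rw [Finset.sum_sub_distrib, Finset.sum_add_distrib]
        linarith

/-- Joining finitely many labellings. -/
lemma exists_join [IsProbabilityMeasure μ] {m : ℕ → ℕ} {γ : ∀ n, X → Fin (m n)} {c : ℕ → ℝ}
    (h : ∀ n, HasCost μ (γ n) (c n)) (N : ℕ) : ∃ (K : ℕ) (ψ : X → Fin K),
      HasCost μ ψ (∑ n ∈ Finset.range N, c n) ∧
      ∀ x y, ψ x = ψ y ↔ ∀ n < N, γ n x = γ n y := by
  induction N with
  | zero =>
    refine ⟨1, fun _ => 0, ⟨fun a => MeasurableSet.const _, fun _ => 0, by simp, by simp⟩, ?_⟩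
    simp
  | succ N ih =>
    obtain ⟨K, ψ, hψ, h2⟩ := ih
    let e := Fintype.equivFin (Fin K × Fin (m N))
    refine ⟨_, fun x => e (ψ x, γ N x), ?_, fun x y => ?_⟩
    · rw [Finset.sum_range_succ]
      exact (hψ.prod (h N)).equiv e
    · rw [e.injective.eq_iff, Prod.mk.injEq, h2, Nat.forall_lt_succ_right]

end Bound

variable {G X : Type*} [Group G] [Countable G] [MeasurableSpace X] [StandardBorelSpace X]
  [MulAction G X] [MeasurableConstSMul G X]

omit [Countable G] in
/-- A partition refining labellings which code all the sets of a generating sequence is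
generating. -/
lemma spansModNull_of_codes (μ : Measure X) [SMulInvariantMeasure G X μ] (α : CtblPart X)
    {m : ℕ → ℕ} (γ : ∀ n, X → Fin (m n)) {X₀ : Set X} (hX₀ : μ X₀ᶜ = 0)
    (h1 : ∀ n i, ∀ x ∈ α.piece i ∩ X₀, ∀ y ∈ α.piece i ∩ X₀, γ n x = γ n y)
    (hB : ∀ n, MeasurableSet[codeAlg G (γ n)] (MeasurableSpace.natGeneratingSequence X n)) :
    SpansModNull (sigmaG G (Set.range α.piece)) μ := by
  intro s hs
  have hle : ∀ n, codeAlg G (γ n) ≤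
      eventuallyMeasurableSpace (sigmaG G (Set.range α.piece)) (ae μ) := by
    intro n
    apply MeasurableSpace.generateFrom_le
    rintro _ ⟨g, _, ⟨v, rfl⟩, rfl⟩
    let S := {i : ℕ | ∃ x ∈ α.piece i ∩ X₀, γ n x = v}
    refine ⟨⋃ i ∈ S, (fun x => g • x) ⁻¹' α.piece i, ?_, ?_⟩
    · refine MeasurableSet.biUnion S.to_countable fun i _ => ?_
      exact MeasurableSpace.measurableSet_generateFrom ⟨g, _, ⟨i, rfl⟩, rfl⟩
    · have e : γ n ⁻¹' {v} =ᵐ[μ] ⋃ i ∈ S, α.piece i := by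
        have hae : ∀ᵐ x ∂μ, x ∈ X₀ := hX₀
        filter_upwards [hae] with x hx
        refine propext ?_
        change γ n x = v ↔ x ∈ ⋃ i ∈ S, α.piece i
        simp only [Set.mem_iUnion, exists_prop]
        constructor
        · intro hv
          have hxu : x ∈ ⋃ i, α.piece i := α.cover ▸ Set.mem_univ x
          obtain ⟨i, hi⟩ := Set.mem_iUnion.1 hxu
          exact ⟨i, ⟨x, ⟨hi, hx⟩, hv⟩, hi⟩
        · rintro ⟨i, ⟨y, hy, hv⟩, hxi⟩
          rw [← hv]
          exact h1 n i x ⟨hxi, hx⟩ y hy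
      have := (measurePreserving_smul g μ).quasiMeasurePreserving.preimage_ae_eq e
      simpa only [Set.preimage_iUnion] using this
  have hs' := hs
  rw [← MeasurableSpace.generateFrom_natGeneratingSequence X] at hs'
  have hall : MeasurableSpace.generateFrom (Set.range (MeasurableSpace.natGeneratingSequence X)) ≤
      eventuallyMeasurableSpace (sigmaG G (Set.range α.piece)) (ae μ) := by
    apply MeasurableSpace.generateFrom_le
    rintro _ ⟨n, rfl⟩
    exact hle n _ (hB n)
  obtain ⟨t, ht, hst⟩ := hall s hs'
  exact ⟨t, ht, measure_symmDiff_eq_zero_iff.2 hst⟩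

omit [Countable G] in
/-- If every measurable set has cheap codes then the Rokhlin entropy vanishes. -/
lemma rokhlinEnt_eq_zero_of_cheap_codes (μ : Measure X) [IsProbabilityMeasure μ]
    [SMulInvariantMeasure G X μ]
    (h : ∀ B : Set X, MeasurableSet B → ∀ δ : ℝ, 0 < δ → ∃ (m : ℕ) (γ : X → Fin m),
      MeasurableSet[codeAlg G γ] B ∧ HasCost μ γ δ) : rokhlinEnt G μ = 0 := by
  classical
  rw [← nonpos_iff_eq_zero]
  refine ENNReal.le_of_forall_pos_le_add fun ε hε _ => ?_
  rw [zero_add]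
  have hε' : (0 : ℝ) < ε / 2 := by positivity
  let B := MeasurableSpace.natGeneratingSequence X
  have hδ : ∀ n : ℕ, (0 : ℝ) < ε / 2 / 2 * (1 / 2) ^ n := fun n => by positivity
  choose m γ hγB hγ using fun n =>
    h (B n) (MeasurableSpace.measurableSet_natGeneratingSequence n) _ (hδ n)
  have hsumle : ∀ N, ∑ n ∈ Finset.range N, (ε / 2 / 2 * (1 / 2) ^ n : ℝ) ≤ ε / 2 := by
    intro N
    rw [← Finset.mul_sum]
    have := sum_geometric_two_le N
    nlinarith
  choose K ψ hψ hψγ using exists_join hγ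
  choose a ha using fun n => (hγ n).exists_dominant
  let bad : X → Set ℕ := fun x => {n | γ n x ≠ a n}
  let X₀ : Set X := {x | (bad x).Finite}
  have hγm : ∀ n v, MeasurableSet {x | γ n x = v} := fun n => (hγ n).1
  have hX₀m : MeasurableSet X₀ := by
    have : X₀ = ⋃ N : ℕ, ⋂ n : ℕ, ⋂ _ : N ≤ n, {x | γ n x = a n} := by
      ext x
      simp only [Set.mem_iUnion, Set.mem_iInter]
      constructor
      · intro hx
        obtain ⟨N, hN⟩ := Set.Finite.bddAbove hx
        refine ⟨N + 1, fun n hn => ?_⟩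
        by_contra hne
        have := hN hne
        omega
      · rintro ⟨N, hN⟩
        refine (Set.finite_Iio N).subset fun n hn => ?_
        by_contra hle
        exact hn (hN n (not_lt.1 hle))
    rw [this]
    exact MeasurableSet.iUnion fun N => MeasurableSet.iInter fun n => MeasurableSet.iInter
      fun _ => hγm n _
  have hX₀ : μ X₀ᶜ = 0 := by
    have hbc : μ {x | ∃ᶠ n in atTop, γ n x ≠ a n} = 0 := by
      refine measure_setOfPred_frequently_eq_zero ?_
      have hle : ∀ n, μ {x | γ n x ≠ a n} ≤
          ENNReal.ofReal (ε / 2 / 2 * (1 / 2) ^ n / Real.log 2) := by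
        intro n
        rw [← ofReal_measureReal]
        refine ENNReal.ofReal_le_ofReal ?_
        rw [le_div_iff₀ (Real.log_pos (by norm_num)), mul_comm]
        exact ha n
      refine ne_top_of_le_ne_top ?_ (ENNReal.tsum_le_tsum hle)
      refine Summable.tsum_ofReal_ne_top ?_
      exact (summable_geometric_two.mul_left _).div_const _
    refine measure_mono_null (fun x hx => ?_) hbc
    exact Nat.frequently_atTop_iff_infinite.2 hx
  let Γ : X → ℕ →₀ ℕ := fun x => if hx : x ∈ X₀ then
    Finsupp.ofSupportFinite (fun n => if γ n x = a n then 0 else (γ n x : ℕ) + 1)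
      (Set.Finite.subset hx fun n hn hna => hn (if_pos hna)) else 0
  have hΓ : ∀ x ∈ X₀, ∀ n, Γ x n = if γ n x = a n then 0 else (γ n x : ℕ) + 1 := by
    intro x hx n
    simp only [Γ, dif_pos hx]
    rfl
  have hΓγ : ∀ x ∈ X₀, ∀ y ∈ X₀, (Γ x = Γ y ↔ ∀ n, γ n x = γ n y) := by
    intro x hx y hy
    rw [DFunLike.ext_iff]
    refine forall_congr' fun n => ?_
    rw [hΓ x hx, hΓ y hy]
    constructor
    · intro hxy
      split_ifs at hxy with h1 h2 h2
      · rw [h1, h2]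
      · exact Fin.ext (by omega)
    · intro hxy
      rw [hxy]
  have hΓm : ∀ b, MeasurableSet {x | Γ x = b} := by
    intro b
    have : {x | Γ x = b} = (X₀ ∩ ⋂ n, {x | (if γ n x = a n then 0 else (γ n x : ℕ) + 1) = b n}) ∪
        (X₀ᶜ ∩ {_x | 0 = b}) := by
      ext x
      simp only [Set.mem_union, Set.mem_inter_iff, Set.mem_iInter, Set.mem_ofPred_eq,
        Set.mem_compl_iff]
      by_cases hx : x ∈ X₀
      · simp only [hx, true_and, not_true_eq_false, false_and, or_false, DFunLike.ext_iff,
          hΓ x hx]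
      · simp only [hx, false_and, not_false_eq_true, true_and, false_or, Γ, dif_neg]
    rw [this]
    refine (hX₀m.inter (MeasurableSet.iInter fun n => ?_)).union
      (hX₀m.compl.inter (MeasurableSet.const _))
    have : {x | (if γ n x = a n then 0 else (γ n x : ℕ) + 1) = b n} =
        ⋃ v ∈ {v | (if v = a n then 0 else (v : ℕ) + 1) = b n}, {x | γ n x = v} := by
      ext x
      simp
    rw [this]
    exact Set.Finite.measurableSet_biUnion (Set.toFinite _) fun v _ => hγm n v
  let enc : (ℕ →₀ ℕ) → ℕ := (Encodable.ofCountable (ℕ →₀ ℕ)).encode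
  have henc : Function.Injective enc := (Encodable.ofCountable (ℕ →₀ ℕ)).encode_injective
  let α : CtblPart X :=
    { piece := fun i => {x | enc (Γ x) = i}
      measurable := fun i => by
        have : {x | enc (Γ x) = i} = ⋃ b ∈ {b | enc b = i}, {x | Γ x = b} := by
          ext x
          simp
        rw [this]
        exact MeasurableSet.biUnion (Set.to_countable _) fun b _ => hΓm b
      disj := fun i j hij => Set.disjoint_left.2 fun x hx hx' => hij (hx.symm.trans hx')
      cover := by
        ext x
        simp }
  have hconst : ∀ n i, ∀ x ∈ α.piece i ∩ X₀, ∀ y ∈ α.piece i ∩ X₀, γ n x = γ n y :=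
    fun n i x hx y hy => (hΓγ x hx.2 y hy.2).1 (henc (Eq.trans hx.1 (Eq.symm hy.1))) n
  have hspan := spansModNull_of_codes (G := G) μ α γ hX₀ hconst hγB
  refine (iInf₂_le α hspan).trans ?_
  have := partEnt_le_of_hasCost (μ := μ) α (ψ := ψ) hε' (fun N => (hψ N).mono (hsumle N)) hX₀
    (fun N i x hx y hy => (hψγ N x y).2 fun n _ => hconst n i x hx y hy) fun i j hij => by
      by_cases hex : (∃ x, x ∈ α.piece i ∩ X₀) ∧ ∃ y, y ∈ α.piece j ∩ X₀
      · obtain ⟨⟨x₀, hx₀⟩, y₀, hy₀⟩ := hex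
        have hne : Γ x₀ ≠ Γ y₀ := fun h => hij (hx₀.1.symm.trans ((congrArg enc h).trans hy₀.1))
        rw [Ne, hΓγ _ hx₀.2 _ hy₀.2] at hne
        push Not at hne
        obtain ⟨n, hn⟩ := hne
        refine ⟨n + 1, fun N hN x hx y hy hxy => hn ?_⟩
        have e1 := (hΓγ x hx.2 x₀ hx₀.2).1 (henc (Eq.trans hx.1 (Eq.symm hx₀.1))) n
        have e2 := (hΓγ y hy.2 y₀ hy₀.2).1 (henc (Eq.trans hy.1 (Eq.symm hy₀.1))) n
        rw [← e1, ← e2]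
        exact (hψγ N x y).1 hxy n (by omega)
      · refine ⟨0, fun N _ x hx y hy => ?_⟩
        exact absurd ⟨⟨x, hx⟩, y, hy⟩ hex
  refine this.trans (le_of_eq ?_)
  rw [mul_div_cancel₀ _ (two_ne_zero), ENNReal.ofReal_coe_nnreal]

end Entropy

section Transfer

variable {G X Y : Type*} [Group G] [MeasurableSpace X] [MeasurableSpace Y] [MulAction G X]
  [MulAction G Y] {ι : Y → X}

omit [MeasurableSpace X] [MeasurableSpace Y] in
lemma preimage_smul_image (heq : ∀ (g : G) y, ι (g • y) = g • ι y)
    (g : G) (s : Set Y) : (fun x : X => g • x) ⁻¹' (ι '' s) = ι '' ((fun y => g • y) ⁻¹' s) := by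
  ext x
  constructor
  · rintro ⟨y, hy, hyx⟩
    refine ⟨g⁻¹ • y, ?_, ?_⟩
    · simpa using hy
    · rw [heq, hyx, inv_smul_smul]
  · rintro ⟨y, hy, rfl⟩
    exact ⟨g • y, hy, heq g y⟩

/-- Rokhlin entropy can only grow when passing to a conull invariant subset. -/
lemma rokhlinEnt_map_le (hι : MeasurableEmbedding ι) (heq : ∀ (g : G) y, ι (g • y) = g • ι y)
    (ν : Measure Y) : rokhlinEnt G (ν.map ι) ≤ rokhlinEnt G ν := by
  refine le_iInf₂ fun β hβ => ?_
  let piece : ℕ → Set X := fun i => Nat.casesOn i (Set.range ι)ᶜ fun i => ι '' β.piece i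
  have hp : ∀ x ∉ Set.range ι, ∀ i, x ∉ ι '' β.piece i :=
    fun x hx i h => hx (Set.image_subset_range _ _ h)
  let α : CtblPart X :=
    { piece := piece
      measurable := by
        rintro (_ | i)
        · exact hι.measurableSet_range.compl
        · exact hι.measurableSet_image.2 (β.measurable i)
      disj := by
        rintro (_ | i) (_ | j) hij
        · exact absurd rfl hij
        · exact Set.disjoint_left.2 fun x hx => hp x hx j
        · exact Set.disjoint_right.2 fun x hx => hp x hx i
        · refine (Set.disjoint_image_iff hι.injective).2 (β.disj fun h => hij ?_)
          rw [h]
      cover := by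
        refine Set.eq_univ_of_forall fun x => Set.mem_iUnion.2 ?_
        by_cases hx : x ∈ Set.range ι
        · obtain ⟨y, rfl⟩ := hx
          have hy : y ∈ ⋃ i, β.piece i := β.cover ▸ Set.mem_univ y
          obtain ⟨i, hi⟩ := Set.mem_iUnion.1 hy
          exact ⟨i + 1, y, hi, rfl⟩
        · exact ⟨0, hx⟩ }
  have hle : sigmaG G (Set.range β.piece) ≤ (sigmaG G (Set.range α.piece)).comap ι := by
    apply MeasurableSpace.generateFrom_le
    rintro _ ⟨g, _, ⟨i, rfl⟩, rfl⟩
    refine ⟨(fun x => g • x) ⁻¹' (ι '' β.piece i), ?_, ?_⟩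
    · exact MeasurableSpace.measurableSet_generateFrom ⟨g, _, ⟨i + 1, rfl⟩, rfl⟩
    · rw [preimage_smul_image heq, Set.preimage_image_eq _ hι.injective]
  have hspan : SpansModNull (sigmaG G (Set.range α.piece)) (ν.map ι) := by
    intro s hs
    obtain ⟨t₀, ht₀, hst⟩ := hβ (ι ⁻¹' s) (hι.measurable hs)
    obtain ⟨t, ht, rfl⟩ := hle t₀ ht₀
    refine ⟨t, ht, ?_⟩
    rw [hι.map_apply]
    exact hst
  refine (iInf₂_le α hspan).trans (le_of_eq ?_)
  have h0 : ν.map ι (α.piece 0) = 0 := by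
    rw [hι.map_apply]
    change ν (ι ⁻¹' (Set.range ι)ᶜ) = 0
    simp
  have h1 : ∀ i, ν.map ι (α.piece (i + 1)) = ν (β.piece i) := by
    intro i
    rw [hι.map_apply]
    change ν (ι ⁻¹' (ι '' β.piece i)) = _
    rw [Set.preimage_image_eq _ hι.injective]
  rw [partEnt, tsum_eq_zero_add' ENNReal.summable]
  simp only [h0, h1, ENNReal.toReal_zero, Real.negMulLog_zero, ENNReal.ofReal_zero, zero_add]
  rfl

/-- Hyperfiniteness almost everywhere passes from a conull invariant subset to the full space. -/
lemma MuHyperfinite.map [StandardBorelSpace X] [StandardBorelSpace Y]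
    (hι : MeasurableEmbedding ι) (heq : ∀ (g : G) y, ι (g • y) = g • ι y)
    {ν : Measure Y} (h : MuHyperfinite G ν) : MuHyperfinite G (ν.map ι) := by
  obtain ⟨Y₀, hY₀, hν, hinv, R, hmono, hR, hU⟩ := h
  have hi := hι.injective
  have hιι : MeasurableEmbedding (Prod.map ι ι) :=
    (hι.measurable.prodMap hι.measurable).measurableEmbedding (hi.prodMap hi)
  have hmem : ∀ n x y, (x, y) ∈ Prod.map ι ι '' R n ↔
      ∃ a b, (a, b) ∈ R n ∧ ι a = x ∧ ι b = y := by
    intro n x y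
    constructor
    · rintro ⟨⟨a, b⟩, hab, he⟩
      exact ⟨a, b, hab, congrArg Prod.fst he, congrArg Prod.snd he⟩
    · rintro ⟨a, b, hab, rfl, rfl⟩
      exact ⟨(a, b), hab, rfl⟩
  refine ⟨ι '' Y₀, hι.measurableSet_image.2 hY₀, ?_, fun g => ?_, fun n => Prod.map ι ι '' R n,
    fun m n hmn => Set.image_mono (hmono hmn), fun n => ?_, ?_⟩
  · rw [hι.map_apply, Set.preimage_compl, Set.preimage_image_eq _ hi, hν]
  · rw [preimage_smul_image heq, hinv]
  · obtain ⟨hm, hrefl, hsymm, htrans, hsub, hfin⟩ := hR n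
    refine ⟨hιι.measurableSet_image.2 hm, ?_, ?_, ?_, ?_, ?_⟩
    · rintro _ ⟨y, hy, rfl⟩
      exact (hmem n _ _).2 ⟨y, y, hrefl y hy, rfl, rfl⟩
    · intro x y hxy
      obtain ⟨a, b, hab, rfl, rfl⟩ := (hmem n _ _).1 hxy
      exact (hmem n _ _).2 ⟨b, a, hsymm _ _ hab, rfl, rfl⟩
    · intro x y z hxy hyz
      obtain ⟨a, b, hab, rfl, rfl⟩ := (hmem n _ _).1 hxy
      obtain ⟨b', c, hbc, hb, rfl⟩ := (hmem n _ _).1 hyz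
      cases hi hb
      exact (hmem n _ _).2 ⟨_, c, htrans _ _ _ hab hbc, rfl, rfl⟩
    · rintro _ ⟨⟨a, b⟩, hab, rfl⟩
      exact ⟨⟨a, (hsub hab).1, rfl⟩, ⟨b, (hsub hab).2, rfl⟩⟩
    · intro x
      by_cases hx : x ∈ Set.range ι
      · obtain ⟨a, rfl⟩ := hx
        refine ((hfin a).image ι).subset fun y hy => ?_
        obtain ⟨a', b, hab, ha, rfl⟩ := (hmem n _ _).1 hy
        cases hi ha
        exact ⟨b, hab, rfl⟩
      · refine Set.finite_empty.subset fun y hy => ?_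
        obtain ⟨a, b, hab, rfl, rfl⟩ := (hmem n _ _).1 hy
        exact hx ⟨a, rfl⟩
  · rw [← Set.image_iUnion, hU]
    ext ⟨x, y⟩
    constructor
    · rintro ⟨⟨a, b⟩, ⟨⟨g, hg⟩, ha, hb⟩, he⟩
      cases he
      refine ⟨⟨g, ?_⟩, ⟨a, ha, rfl⟩, ⟨b, hb, rfl⟩⟩
      exact (heq g a).symm.trans (congrArg ι hg)
    · rintro ⟨⟨g, hg⟩, ⟨a, ha, hax⟩, ⟨b, hb, hby⟩⟩
      refine ⟨(a, b), ⟨⟨g, hi ?_⟩, ha, hb⟩, Prod.ext hax hby⟩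
      rw [heq, hax, hby]
      exact hg

end Transfer

section Main

/-- The theorem for actions which are free everywhere. -/
lemma exists_freeOn_conull_of_rokhlinEnt_pos {G X : Type*} [Group G] [Countable G]
    [MeasurableSpace X] [StandardBorelSpace X] [MulAction G X] [MeasurableConstSMul G X]
    (hfree : ∀ (g : G) (x : X), g • x = x → g = 1)
    (μ : Measure X) [IsProbabilityMeasure μ] [SMulInvariantMeasure G X μ]
    (herg : ∀ s : Set X, MeasurableSet s → (∀ g : G, (fun x : X => g • x) ⁻¹' s = s) →
      μ s = 0 ∨ μ s = 1)
    (hnohyp : ¬ MuHyperfinite G μ) (hent : 0 < rokhlinEnt G μ) :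
    ∃ (A : Set X) (T : FreeGroup (Fin 2) → X → X), MeasurableSet A ∧ μ Aᶜ = 0 ∧
      FreeOn G A T := by
  classical
  obtain ⟨S, h1, hsymm, hS⟩ := exists_doubling_of_not_folner
    (mt (muHyperfinite_of_folner hfree μ) hnohyp)
  by_cases hsmall : ∀ ε : ℝ≥0∞, 0 < ε → ∃ (A : Set X) (T : FreeGroup (Fin 2) → X → X),
      MeasurableSet A ∧ 0 < μ A ∧ μ A ≤ ε ∧ FreeOn G A T
  · exact exists_freeOn_conull hfree μ herg hsmall
  · refine absurd (rokhlinEnt_eq_zero_of_cheap_codes (G := G) μ fun B hB δ hδ => ?_) hent.ne'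
    exact exists_cheap_code hfree μ h1 hsymm hS hsmall hB hδ

variable (G X : Type*) [Group G] [MulAction G X]

/-- The invariant set of points with trivial stabilizer. -/
def freePart : SubMulAction G X where
  carrier := {x | ∀ g : G, g • x = x → g = 1}
  smul_mem' h x hx g hg := by
    have := hx (h⁻¹ * g * h) (by rw [mul_smul, mul_smul, hg, inv_smul_smul])
    rwa [mul_assoc, inv_mul_eq_one, eq_comm, mul_eq_right] at this

end Main

/-- **The measurable von Neumann–Day conjecture for positive entropy actions**: if
`G ↷ (X, μ)` is a free ergodic p.m.p. action of a countable group whose orbit equivalence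
relation is not `μ`-hyperfinite and whose Rokhlin entropy is positive, then there is a free
measure-preserving action of the free group `F₂` on `(X, μ)` almost all of whose orbits are
contained in `G`-orbits. -/
theorem measurable_vonNeumannDay_of_positive_entropy
    {G X : Type*} [Group G] [Countable G]
    [MeasurableSpace X] [StandardBorelSpace X]
    [MulAction G X]
    (μ : Measure X) [IsProbabilityMeasure μ]
    (hpmp : ∀ g : G, MeasurePreserving (fun x : X => g • x) μ μ)
    (herg : ∀ s : Set X, MeasurableSet s → (∀ g : G, (fun x : X => g • x) ⁻¹' s = s) →
      μ s = 0 ∨ μ s = 1)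
    (hfree : ∀ᵐ x ∂μ, ∀ g : G, g • x = x → g = 1)
    (hnohyp : ¬ MuHyperfinite G μ)
    (hent : 0 < rokhlinEnt G μ) :
    ∃ T : FreeGroup (Fin 2) → X → X,
      T 1 = id ∧
      (∀ w w' : FreeGroup (Fin 2), T (w * w') = T w ∘ T w') ∧
      (∀ w : FreeGroup (Fin 2), MeasurePreserving (T w) μ μ) ∧
      (∀ᵐ x ∂μ, ∀ w : FreeGroup (Fin 2), w ≠ 1 → T w x ≠ x) ∧
      (∀ᵐ x ∂μ, ∀ w : FreeGroup (Fin 2), T w x ∈ MulAction.orbit G x) := by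
  have hg : ∀ g : G, Measurable fun x : X => g • x := fun g => (hpmp g).measurable
  have : MeasurableConstSMul G X := ⟨hg⟩
  have hF : MeasurableSet (freePart G X : Set X) := by
    have : (freePart G X : Set X) = ⋂ g : G, {x | g • x = x → g = 1} :=
      Set.ext fun x => (Set.mem_iInter (s := fun g : G => {x | g • x = x → g = 1})).symm
    rw [this]
    refine MeasurableSet.iInter fun g => ?_
    by_cases h : g = 1
    · simp [h]
    · simp only [h, imp_false]
      exact (measurableSet_eq_fun (hg g) measurable_id).compl
  have hF0 : μ (freePart G X : Set X)ᶜ = 0 := hfree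
  let ι : freePart G X → X := Subtype.val
  have hι : MeasurableEmbedding ι := MeasurableEmbedding.subtype_coe hF
  have heq : ∀ (g : G) (y : freePart G X), ι (g • y) = g • ι y := fun _ _ => rfl
  have : StandardBorelSpace (freePart G X) := hF.standardBorel
  let ν : Measure (freePart G X) := μ.comap ι
  have hμ : ν.map ι = μ := by
    rw [hι.map_comap]
    refine Measure.restrict_eq_self_of_ae_mem ?_
    rw [Subtype.range_coe_subtype]
    exact hfree
  have hν : ∀ s, ν s = μ (ι '' s) := hι.comap_apply μ
  have hnum : ∀ s : Set X, ν (ι ⁻¹' s) = μ s := fun s => by rw [← hι.map_apply, hμ]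
  have : IsProbabilityMeasure ν := ⟨by rw [← Set.preimage_univ (f := ι), hnum, measure_univ]⟩
  have : MeasurableConstSMul G (freePart G X) :=
    ⟨fun g => ((hg g).comp measurable_subtype_coe).subtype_mk⟩
  have : SMulInvariantMeasure G (freePart G X) ν := ⟨fun g s hs => by
    rw [hν, hν, ← preimage_smul_image heq,
      (hpmp g).measure_preimage (hι.measurableSet_image.2 hs).nullMeasurableSet]⟩
  obtain ⟨A, T, hA, hA0, hT⟩ := exists_freeOn_conull_of_rokhlinEnt_pos (G := G)
    (fun g x hgx => x.2 g (congrArg Subtype.val hgx)) ν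
    (fun s hs hinv => by
      rw [hν]
      refine herg _ (hι.measurableSet_image.2 hs) fun g => ?_
      rw [preimage_smul_image heq, hinv])
    (fun h => hnohyp (hμ ▸ h.map hι heq))
    (hent.trans_le (by simpa only [hμ] using rokhlinEnt_map_le hι heq ν))
  classical
  let T' : FreeGroup (Fin 2) → X → X := fun w x =>
    if hx : x ∈ freePart G X then ι (T w ⟨x, hx⟩) else x
  have hin : ∀ w (y : freePart G X), T' w (ι y) = ι (T w y) := fun w y => dif_pos y.2
  have hout : ∀ w, ∀ x ∉ freePart G X, T' w x = x := fun w x hx => dif_neg hx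
  have hTm : ∀ w, Measurable (T' w) := fun w =>
    Measurable.dite (hι.measurable.comp (hT.measurable w)) measurable_subtype_coe hF
  refine ⟨T', ?_, fun w w' => ?_, fun w => ⟨hTm w, ?_⟩, ?_, ?_⟩
  · funext x
    by_cases hx : x ∈ freePart G X
    · have := hin 1 ⟨x, hx⟩
      rwa [hT.map_one] at this
    · exact hout 1 x hx
  · funext x
    by_cases hx : x ∈ freePart G X
    · have h1 := hin (w * w') ⟨x, hx⟩
      have h2 := hin w' ⟨x, hx⟩
      rw [hT.map_mul] at h1
      change T' w' x = _ at h2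
      change T' (w * w') x = _ at h1
      rw [h1, Function.comp_apply, Function.comp_apply, h2, hin]
    · simp only [Function.comp_apply, hout _ x hx]
  · have hcomp : T' w ∘ ι = ι ∘ T w := funext (hin w)
    have hTw := (hT.measurePreserving (fun g x hgx => x.2 g (congrArg Subtype.val hgx)) ν w)
    conv_lhs => rw [← hμ]
    rw [Measure.map_map (hTm w) hι.measurable, hcomp,
      ← Measure.map_map hι.measurable hTw.measurable, hTw.map_eq, hμ]
  · have hA' : ∀ᵐ x ∂μ, x ∈ ι '' A := by
      rw [ae_iff, ← hnum]
      refine measure_mono_null (fun y hy => ?_) hA0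
      exact fun h => hy ⟨y, h, rfl⟩
    filter_upwards [hA'] with x hx w hw hxw
    obtain ⟨y, hy, rfl⟩ := hx
    rw [hin] at hxw
    exact hT.free y hy w hw (hι.injective hxw)
  · refine Filter.Eventually.of_forall fun x w => ?_
    by_cases hx : x ∈ freePart G X
    · obtain ⟨g, hgx⟩ := hT.orbit w ⟨x, hx⟩
      refine ⟨g, ?_⟩
      have := hin w ⟨x, hx⟩
      rw [hgx] at this
      exact this.symm
    · rw [hout w x hx]
      exact MulAction.mem_orbit_self x
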